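/- arXiv:1609.07339 — 2 statements merged into one kernel-verified Lean document; each statement's English description precedes it below -/
import Mathlib

section
/- Let (A,B) be a random vector such that A satisfies Assumption (A1) with parameters κ > 0 and h > 0 and E[|B|^κ] < ∞, and let X be a random variable independent of (A,B) whose distribution satisfies the perpetuity equation X =_d AX + B. Then there exist functions q₁, q₂ ∈ 𝒬(κ,h) such that lim_{n→∞} x^κ e^{κnh} P(X > x e^{nh}) = q₁(x) for every continuity point x > 0 of q₁, and lim_{n→∞} x^κ e^{κnh} P(X < −x e^{nh}) = q₂(x) for every continuity point x > 0 of q₂. Moreover, if P(Ax + B = x) < 1 for every x ∈ ℝ, then q₁(x) + q₂(x) > 0 for all x > 0. -/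
open MeasureTheory ProbabilityTheory Filter Topology

noncomputable section

/-- `q ∈ 𝒬(κ,h)`: `q : (0,∞) → [0,∞)`, `x ↦ x^{-κ} q(x)` is nonincreasing on `(0,∞)`,
and `q(x e^h) = q(x)` for all `x > 0`. -/
def MemQ (κ h : ℝ) (q : ℝ → ℝ) : Prop :=
  (∀ x : ℝ, 0 < x → 0 ≤ q x) ∧
  AntitoneOn (fun x : ℝ => x ^ (-κ) * q x) (Set.Ioi (0 : ℝ)) ∧
  (∀ x : ℝ, 0 < x → q (x * Real.exp h) = q x)

/-- The conditional distribution of `log A` given `A ≠ 0` is arithmetic with span `h`: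
given `A ≠ 0`, `log A ∈ hℤ` a.s., and `h` is the largest positive number with this property. -/
def CondLogArithSpan {Ω : Type*} [MeasurableSpace Ω] (P : Measure Ω) (A : Ω → ℝ)
    (h : ℝ) : Prop :=
  0 < h ∧
  P {ω | A ω ≠ 0 ∧ ∀ k : ℤ, Real.log (A ω) ≠ (k : ℝ) * h} = 0 ∧
  ∀ h' : ℝ, 0 < h' →
    P {ω | A ω ≠ 0 ∧ ∀ k : ℤ, Real.log (A ω) ≠ (k : ℝ) * h'} = 0 → h' ≤ h

/-- Assumption (A1): `A ≥ 0` a.s., `E A^κ = 1`, `E[A^κ log₊ A] < ∞`, and `log A`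
conditioned on `A ≠ 0` is arithmetic with span `h`. -/
def AssumptionA1 {Ω : Type*} [MeasurableSpace Ω] (P : Measure Ω) (A : Ω → ℝ)
    (κ h : ℝ) : Prop :=
  0 < κ ∧ (∀ᵐ ω ∂P, 0 ≤ A ω) ∧ (∫ ω, A ω ^ κ ∂P) = 1 ∧
  (∫⁻ ω, ENNReal.ofReal (A ω ^ κ * max (Real.log (A ω)) 0) ∂P) < ⊤ ∧
  CondLogArithSpan P A h

/-- The geometric quotient `(1 - u ^ k) / (1 - u)`, for an integer exponent `k`. -/
def geomQuot {R : Type*} [Ring R] (u : Rˣ) (k : ℤ) : R :=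
  ∑ j ∈ Finset.Ico 0 k, ((u ^ j : Rˣ) : R) - ∑ j ∈ Finset.Ico k 0, ((u ^ j : Rˣ) : R)

theorem geomQuot_zero {R : Type*} [Ring R] (u : Rˣ) : geomQuot u 0 = 0 := by
  simp [geomQuot]

theorem geomQuot_add_one {R : Type*} [Ring R] (u : Rˣ) (k : ℤ) :
    geomQuot u (k + 1) = geomQuot u k + ((u ^ k : Rˣ) : R) := by
  unfold geomQuot
  rcases lt_or_ge k 0 with hk | hk
  · rw [Finset.Ico_eq_empty (by omega : ¬ (0 : ℤ) < k + 1),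
      Finset.Ico_eq_empty (by omega : ¬ (0 : ℤ) < k),
      ← Finset.insert_Ico_add_one_left_eq_Ico hk, Finset.sum_insert (by simp)]
    simp
  · rw [Finset.Ico_eq_empty (by omega : ¬ k + 1 < (0 : ℤ)),
      Finset.Ico_eq_empty (by omega : ¬ k < (0 : ℤ)),
      ← Finset.insert_Ico_right_eq_Ico_add_one hk, Finset.sum_insert (by simp)]
    simp [add_comm]

theorem geomQuot_sub_one {R : Type*} [Ring R] (u : Rˣ) (k : ℤ) :
    geomQuot u (k - 1) = geomQuot u k - ((u ^ (k - 1) : Rˣ) : R) := by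
  have := geomQuot_add_one u (k - 1)
  rw [sub_add_cancel] at this
  rw [this, add_sub_cancel_right]

theorem one_sub_mul_geomQuot {R : Type*} [Ring R] (u : Rˣ) (k : ℤ) :
    (1 - (u : R)) * geomQuot u k = 1 - ((u ^ k : Rˣ) : R) := by
  have hu : ∀ j : ℤ, (u : R) * ((u ^ j : Rˣ) : R) = ((u ^ (j + 1) : Rˣ) : R) := fun j => by
    rw [← Units.val_mul, ← zpow_one_add, add_comm]
  induction k using Int.induction_on with
  | zero => simp [geomQuot_zero]
  | succ i ih => rw [geomQuot_add_one, mul_add, ih, sub_mul, hu, one_mul]; abel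
  | pred i ih => rw [geomQuot_sub_one, mul_sub, ih, sub_mul, hu, one_mul, sub_add_cancel]; abel

theorem map_geomQuot {R S : Type*} [Ring R] [Ring S] (f : R →+* S) (u : Rˣ) (k : ℤ) :
    f (geomQuot u k) = geomQuot (Units.map (f : R →* S) u) k := by
  simp only [geomQuot, map_sub, map_sum, ← map_zpow, Units.coe_map, MonoidHom.coe_coe]

theorem geomQuot_one {R : Type*} [Ring R] (k : ℤ) : geomQuot (1 : Rˣ) k = (k : R) := by
  induction k using Int.induction_on with
  | zero => simp [geomQuot_zero]
  | succ i ih => rw [geomQuot_add_one, ih]; simp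
  | pred i ih => rw [geomQuot_sub_one, ih]; simp

theorem norm_geomQuot_le {R : Type*} [NormedRing R] (u : Rˣ)
    (hu : ∀ j : ℤ, ‖((u ^ j : Rˣ) : R)‖ ≤ 1) (k : ℤ) : ‖geomQuot u k‖ ≤ |(k : ℝ)| := by
  have h (s : Finset ℤ) : ‖∑ j ∈ s, ((u ^ j : Rˣ) : R)‖ ≤ s.card := by
    simpa using norm_sum_le_of_le s (fun j _ => hu j)
  unfold geomQuot
  rcases le_total 0 k with hk | hk
  · rw [Finset.Ico_eq_empty (by omega : ¬ k < (0 : ℤ)), Finset.sum_empty, sub_zero,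
      abs_of_nonneg (by exact_mod_cast hk)]
    refine (h _).trans_eq ?_
    simp only [Int.card_Ico, sub_zero]
    exact_mod_cast Int.toNat_of_nonneg hk
  · rw [Finset.Ico_eq_empty (by omega : ¬ 0 < k), Finset.sum_empty, zero_sub, norm_neg,
      abs_of_nonpos (by exact_mod_cast hk)]
    refine (h _).trans_eq ?_
    simp only [Int.card_Ico, zero_sub]
    exact_mod_cast Int.toNat_of_nonneg (neg_nonneg.2 hk)

/-- A summable step distribution on `ℤ` of total mass one, with finite nonzero drift and
support generating `ℤ`. -/
structure IsAperiodicStep (μ : ℤ → ℝ) : Prop where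
  nonneg : ∀ k, 0 ≤ μ k
  hasSum_one : HasSum μ 1
  summable_abs : Summable fun k : ℤ => |(k : ℝ)| * μ k
  drift_ne : ∑' k : ℤ, (k : ℝ) * μ k ≠ 0
  aperiodic : ∀ d : ℤ, (∀ k, μ k ≠ 0 → d ∣ k) → IsUnit d

theorem IsAperiodicStep.eq_one_of_hasSum {μ : ℤ → ℝ} (hμ : IsAperiodicStep μ) (z : ℂˣ)
    (hz : ‖(z : ℂ)‖ = 1) (h : HasSum (fun k : ℤ => (μ k : ℂ) * (1 - ((z ^ k : ℂˣ) : ℂ))) 0) :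
    z = 1 := by
  have hn (k : ℤ) : ‖((z ^ k : ℂˣ) : ℂ)‖ = 1 := by simp [hz]
  have hre : HasSum (fun k : ℤ => μ k * (1 - (((z ^ k : ℂˣ) : ℂ)).re)) 0 := by
    simpa [Complex.hasSum_iff] using (Complex.hasSum_re h)
  have hnn (k : ℤ) : 0 ≤ 1 - (((z ^ k : ℂˣ) : ℂ)).re := by
    have := (Complex.abs_re_le_norm ((z ^ k : ℂˣ) : ℂ))
    rw [hn] at this
    linarith [le_abs_self (((z ^ k : ℂˣ) : ℂ)).re]
  have h0 := (hasSum_zero_iff_of_nonneg fun k => mul_nonneg (hμ.nonneg k) (hnn k)).1 hre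
  have hu := hμ.aperiodic (orderOf z) fun k hk => by
    rw [orderOf_dvd_iff_zpow_eq_one]
    have h1 : (((z ^ k : ℂˣ) : ℂ)).re = 1 := by
      have := congrFun h0 k
      simp only [Pi.zero_apply, mul_eq_zero, hk, false_or] at this
      linarith
    have h2 : (((z ^ k : ℂˣ) : ℂ)).im = 0 := by
      have h3 := Complex.sq_norm (((z ^ k : ℂˣ) : ℂ))
      rw [hn, Complex.normSq_apply, h1] at h3
      nlinarith
    ext1
    exact Complex.ext h1 h2
  rw [Int.isUnit_iff] at hu
  exact orderOf_eq_one_iff.1 (by omega)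

theorem IsAperiodicStep.summable_smul_geomQuot {μ : ℤ → ℝ} (hμ : IsAperiodicStep μ)
    {R : Type*} [NormedRing R] [NormedAlgebra ℂ R] [CompleteSpace R] (u : Rˣ)
    (hu : ∀ j : ℤ, ‖((u ^ j : Rˣ) : R)‖ ≤ 1) :
    Summable fun k => (μ k : ℂ) • geomQuot u k := by
  refine Summable.of_norm_bounded hμ.summable_abs fun k => ?_
  rw [norm_smul, Complex.norm_real, Real.norm_of_nonneg (hμ.nonneg k), mul_comm]
  exact mul_le_mul_of_nonneg_right (norm_geomQuot_le u hu k) (hμ.nonneg k)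

theorem norm_eq_one_of_zpow_bounded (z : ℂˣ) (C : ℝ) (h : ∀ j : ℤ, ‖((z ^ j : ℂˣ) : ℂ)‖ ≤ C) :
    ‖(z : ℂ)‖ = 1 := by
  refine le_antisymm ?_ ?_
  · by_contra! h1
    obtain ⟨n, hn⟩ := pow_unbounded_of_one_lt C h1
    have := h n
    simp at this
    linarith
  · by_contra! h1
    obtain ⟨n, hn⟩ := pow_unbounded_of_one_lt C (one_lt_inv₀ (by simp) |>.2 h1)
    have := h (-n)
    simp at this hn
    linarith

/-- A Wiener-type lemma: in a commutative Banach algebra the element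
`∑ k, μ k • (1 - u ^ k) / (1 - u)` is invertible. -/
theorem IsAperiodicStep.isUnit_tsum_of_comm {μ : ℤ → ℝ} (hμ : IsAperiodicStep μ)
    {R : Type*} [NormedCommRing R] [NormedAlgebra ℂ R] [CompleteSpace R] (u : Rˣ)
    (hu : ∀ j : ℤ, ‖((u ^ j : Rˣ) : R)‖ ≤ 1) :
    IsUnit (∑' k, (μ k : ℂ) • geomQuot u k) := by
  by_contra hnot
  obtain ⟨f, hf⟩ := WeakDual.CharacterSpace.exists_apply_eq_zero hnot
  set F : R →ₐ[ℂ] ℂ := WeakDual.CharacterSpace.toAlgHom f with hF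
  have hcont : Continuous F := map_continuous f
  set z : ℂˣ := Units.map ((F : R →+* ℂ) : R →* ℂ) u with hz
  have hsum : HasSum (fun k => (μ k : ℂ) * geomQuot z k) 0 := by
    have := (hμ.summable_smul_geomQuot u hu).hasSum.map F hcont
    have h2 : F (∑' k, (μ k : ℂ) • geomQuot u k) = 0 := hf
    rw [h2] at this
    refine this.congr_fun fun k => ?_
    simp only [Function.comp, map_smul, smul_eq_mul]
    congr 1
    exact (map_geomQuot (F : R →+* ℂ) u k).symm
  have hz1 : ‖(z : ℂ)‖ = 1 := by
    have hcl : ∀ x, ‖F x‖ ≤ ‖(WeakDual.CharacterSpace.toCLM f)‖ * ‖x‖ :=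
      fun x => (WeakDual.CharacterSpace.toCLM f).le_opNorm x
    refine norm_eq_one_of_zpow_bounded z ‖(WeakDual.CharacterSpace.toCLM f)‖ fun j => ?_
    rw [hz, ← map_zpow]
    refine (hcl _).trans ?_
    exact mul_le_of_le_one_right (norm_nonneg _) (hu j)
  have hz2 : z = 1 := by
    refine hμ.eq_one_of_hasSum z hz1 ?_
    have := hsum.mul_left (1 - (z : ℂ))
    rw [mul_zero] at this
    refine this.congr_fun fun k => ?_
    rw [← one_sub_mul_geomQuot]
    ring
  simp only [hz2, geomQuot_one] at hsum
  refine hμ.drift_ne ?_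
  have h3 := hsum.tsum_eq
  have h4 : ∑' k : ℤ, (μ k : ℂ) * (k : ℂ) = ((∑' k : ℤ, (k : ℝ) * μ k : ℝ) : ℂ) := by
    rw [Complex.ofReal_tsum]
    exact tsum_congr fun k => by push_cast; ring
  rw [h4] at h3
  exact_mod_cast h3

theorem IsAperiodicStep.isUnit_tsum {μ : ℤ → ℝ} (hμ : IsAperiodicStep μ)
    {R : Type*} [NormedRing R] [NormedAlgebra ℂ R] [CompleteSpace R] (u : Rˣ)
    (hu : ∀ j : ℤ, ‖((u ^ j : Rˣ) : R)‖ ≤ 1) :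
    IsUnit (∑' k, (μ k : ℂ) • geomQuot u k) := by
  set s : Set R := {(u : R), ((u⁻¹ : Rˣ) : R)} with hs
  have hcomm : ∀ a ∈ s, ∀ b ∈ s, a * b = b * a := by
    rintro a (rfl | rfl) b (rfl | rfl) <;> simp
  let S : Subalgebra ℂ R := (Algebra.adjoin ℂ s).topologicalClosure
  have hcS : ∀ a b : S, a * b = b * a :=
    (Subalgebra.commRingTopologicalClosure (Algebra.adjoin ℂ s)
      (Algebra.isMulCommutative_adjoin ℂ hcomm).is_comm.comm).mul_comm
  let : NormedCommRing S := { (inferInstance : NormedRing S) with mul_comm := hcS }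
  have : CompleteSpace S :=
    (Subalgebra.isClosed_topologicalClosure (Algebra.adjoin ℂ s)).completeSpace_coe
  have hsub : s ⊆ S := Algebra.subset_adjoin.trans (Subalgebra.le_topologicalClosure _)
  let v : Sˣ :=
    { val := ⟨u, hsub (by simp [hs])⟩
      inv := ⟨(u⁻¹ : Rˣ), hsub (by simp [hs])⟩
      val_inv := Subtype.ext (by simp)
      inv_val := Subtype.ext (by simp) }
  have hvu : Units.map ((S.val : S →+* R) : S →* R) v = u := by ext; rfl
  have hv (j : ℤ) : ‖((v ^ j : Sˣ) : S)‖ ≤ 1 := by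
    have : (((v ^ j : Sˣ) : S) : R) = ((u ^ j : Rˣ) : R) := by
      rw [← hvu, ← map_zpow]; rfl
    calc ‖((v ^ j : Sˣ) : S)‖ = ‖(((v ^ j : Sˣ) : S) : R)‖ := rfl
      _ ≤ 1 := by rw [this]; exact hu j
  have h1 := (hμ.isUnit_tsum_of_comm v hv).map S.val
  have h2 := (hμ.summable_smul_geomQuot v hv).hasSum.map S.val continuous_subtype_val
  rw [← h2.tsum_eq] at h1
  convert h1 using 3 with k
  simp only [Function.comp, map_smul]
  congr 1
  rw [← hvu]
  exact (map_geomQuot (S.val : S →+* R) v k).symm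

theorem hasSum_norm_comp_sub (f : lp (fun _ : ℤ => ℂ) 1) (j : ℤ) :
    HasSum (fun n => ‖f (n - j)‖) ‖f‖ := by
  have h := lp.hasSum_norm (p := 1) (by simp) f
  simp only [ENNReal.toReal_one, Real.rpow_one] at h
  exact (Equiv.subRight j).hasSum_iff.2 h

/-- The shift `f ↦ f (· - j)` on `ℓ¹(ℤ)`, as a linear map. -/
def lpShiftLinear (j : ℤ) : lp (fun _ : ℤ => ℂ) 1 →ₗ[ℂ] lp (fun _ : ℤ => ℂ) 1 where
  toFun f := ⟨fun n => f (n - j), memℓp_gen (by simpa using (hasSum_norm_comp_sub f j).summable)⟩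
  map_add' f g := by ext n; rfl
  map_smul' c f := by ext n; rfl

theorem norm_lpShiftLinear_le (j : ℤ) (f : lp (fun _ : ℤ => ℂ) 1) :
    ‖lpShiftLinear j f‖ ≤ 1 * ‖f‖ := by
  rw [one_mul]
  refine (lp.norm_eq_tsum_rpow (by simp) _).trans_le ?_
  simpa [lpShiftLinear] using (hasSum_norm_comp_sub f j).tsum_eq.le

/-- The shift `f ↦ f (· - j)` on `ℓ¹(ℤ)`. -/
def lpShift (j : ℤ) : lp (fun _ : ℤ => ℂ) 1 →L[ℂ] lp (fun _ : ℤ => ℂ) 1 :=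
  (lpShiftLinear j).mkContinuous 1 (norm_lpShiftLinear_le j)

theorem lpShift_apply (j : ℤ) (f : lp (fun _ : ℤ => ℂ) 1) (n : ℤ) :
    lpShift j f n = f (n - j) := rfl

theorem norm_lpShift_le (j : ℤ) : ‖lpShift j‖ ≤ 1 :=
  LinearMap.mkContinuous_norm_le _ zero_le_one (norm_lpShiftLinear_le j)

/-- The unit shift, as an invertible operator on `ℓ¹(ℤ)`. -/
def lpShiftUnit : (lp (fun _ : ℤ => ℂ) 1 →L[ℂ] lp (fun _ : ℤ => ℂ) 1)ˣ where
  val := lpShift 1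
  inv := lpShift (-1)
  val_inv := by ext f n; simp [lpShift_apply]
  inv_val := by ext f n; simp [lpShift_apply]

theorem lpShiftUnit_zpow (j : ℤ) :
    ((lpShiftUnit ^ j : (lp (fun _ : ℤ => ℂ) 1 →L[ℂ] lp (fun _ : ℤ => ℂ) 1)ˣ) :
      lp (fun _ : ℤ => ℂ) 1 →L[ℂ] lp (fun _ : ℤ => ℂ) 1) = lpShift j := by
  induction j using Int.induction_on with
  | zero => ext f n; simp [lpShift_apply]
  | succ i ih =>
    rw [zpow_add_one, Units.val_mul, ih]
    ext f n
    simp [lpShift_apply, lpShiftUnit, sub_sub]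
  | pred i ih =>
    rw [zpow_sub_one, Units.val_mul, ih]
    ext f n
    change f (n - -i - -1) = f (n - (-i - 1))
    rw [show n - -(i : ℤ) - -1 = n - (-i - 1) by ring]

/-- Existence of a bounded solution of the renewal equation `R - μ * R = g`, with limits at both
ends. -/
theorem IsAperiodicStep.exists_renewal_solution {μ : ℤ → ℝ} (hμ : IsAperiodicStep μ)
    {g : ℤ → ℝ} (hg : Summable fun n => |g n|) :
    ∃ R : ℤ → ℝ, (∃ C, ∀ n, |R n| ≤ C) ∧ Tendsto R atBot (𝓝 0) ∧ (∃ L, Tendsto R atTop (𝓝 L)) ∧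
      ∀ n, HasSum (fun k => μ k * (R n - R (n - k))) (g n) := by
  have hu (j : ℤ) : ‖((lpShiftUnit ^ j : (lp (fun _ : ℤ => ℂ) 1 →L[ℂ] lp (fun _ : ℤ => ℂ) 1)ˣ) :
      lp (fun _ : ℤ => ℂ) 1 →L[ℂ] lp (fun _ : ℤ => ℂ) 1)‖ ≤ 1 := by
    rw [lpShiftUnit_zpow]; exact norm_lpShift_le j
  obtain ⟨v, hv⟩ := hμ.isUnit_tsum lpShiftUnit hu
  let G : lp (fun _ : ℤ => ℂ) 1 := ⟨fun n => (g n : ℂ), memℓp_gen (by simpa using hg)⟩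
  let D : lp (fun _ : ℤ => ℂ) 1 := (v⁻¹ : (lp (fun _ : ℤ => ℂ) 1 →L[ℂ] _)ˣ).val G
  have hD : (∑' k, (μ k : ℂ) • geomQuot lpShiftUnit k) D = G := by
    rw [← hv]
    change (v.val * v⁻¹.val) G = G
    simp
  let d : ℤ → ℝ := fun n => (D n).re
  have hd : Summable fun n => ‖d n‖ := by
    have h := (lp.hasSum_norm (p := 1) (by simp) D).summable
    simp only [ENNReal.toReal_one, Real.rpow_one] at h
    exact h.of_nonneg_of_le (fun n => norm_nonneg _) fun n => Complex.abs_re_le_norm _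
  let R : ℤ → ℝ := fun n => ∑' j, (Set.Iic n).indicator d j
  have hRd (n : ℤ) : Summable ((Set.Iic n).indicator d) := hd.of_norm.indicator _
  have hstep (n : ℤ) : R n = R (n - 1) + d n := by
    have h1 : (Set.Iic n).indicator d = (Set.Iic (n - 1)).indicator d + Pi.single n (d n) := by
      ext j
      rcases lt_trichotomy j n with h | h | h
      · have h2 : j ≤ n - 1 := by omega
        simp [h.le, h2, h.ne]
      · subst h; simp
      · have h2 : ¬ j ≤ n - 1 := by omega
        simp [h2, h.not_ge, h.ne']
    have h2 : HasSum (Pi.single n (d n) : ℤ → ℝ) (d n) := hasSum_pi_single n (d n)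
    change ∑' j, (Set.Iic n).indicator d j = _
    rw [h1]
    exact ((hRd (n - 1)).hasSum.add h2).tsum_eq
  have hquot (k n : ℤ) : ((geomQuot lpShiftUnit k) D n).re = R n - R (n - k) := by
    induction k using Int.induction_on with
    | zero => simp [geomQuot_zero]
    | succ i ih =>
      rw [geomQuot_add_one, lpShiftUnit_zpow]
      simp only [_root_.add_apply, lp.coeFn_add, Pi.add_apply, Complex.add_re, ih,
        lpShift_apply]
      have := hstep (n - i)
      rw [sub_sub] at this
      rw [this]
      ring
    | pred i ih =>
      rw [geomQuot_sub_one, lpShiftUnit_zpow]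
      simp only [_root_.sub_apply, lp.coeFn_sub, Pi.sub_apply, Complex.sub_re, ih,
        lpShift_apply]
      have := hstep (n - (-i - 1))
      rw [show n - (-(i : ℤ) - 1) - 1 = n - -i by ring] at this
      rw [this]
      ring
  refine ⟨R, ⟨∑' j, ‖d j‖, fun n => ?_⟩, ?_, ⟨∑' j, d j, ?_⟩, fun n => ?_⟩
  · refine (norm_tsum_le_tsum_norm (hRd n).norm).trans ?_
    exact (hRd n).norm.tsum_le_tsum (fun j => norm_indicator_le_norm_self d j) hd
  · have := tendsto_tsum_of_dominated_convergence (𝓕 := (atBot : Filter ℤ))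
      (f := fun n j => (Set.Iic n).indicator d j) (g := fun _ => (0 : ℝ)) hd (fun j => ?_)
      (Eventually.of_forall fun n j => norm_indicator_le_norm_self d j)
    · simpa using this
    · refine tendsto_const_nhds.congr' ?_
      filter_upwards [eventually_lt_atBot j] with n hn
      simp [hn.not_ge]
  · refine tendsto_tsum_of_dominated_convergence (f := fun n j => (Set.Iic n).indicator d j) hd
      (fun j => ?_) (Eventually.of_forall fun n j => norm_indicator_le_norm_self d j)
    refine tendsto_const_nhds.congr' ?_
    filter_upwards [eventually_ge_atTop j] with n hn
    simp [hn]
  · let ev : (lp (fun _ : ℤ => ℂ) 1 →L[ℂ] lp (fun _ : ℤ => ℂ) 1) →+ ℝ :=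
      { toFun := fun T => (T D n).re, map_zero' := by simp, map_add' := by simp }
    have hev : Continuous ev :=
      Complex.continuous_re.comp ((lp.lipschitzWith_one_eval 1 n).continuous.comp
        (ContinuousLinearMap.apply ℂ _ D).continuous)
    have h := (hμ.summable_smul_geomQuot lpShiftUnit hu).hasSum.map ev hev
    have h1 : ev (∑' k, (μ k : ℂ) • geomQuot lpShiftUnit k) = g n := by
      change ((∑' k, (μ k : ℂ) • geomQuot lpShiftUnit k) D n).re = g n
      rw [hD]
      exact Complex.ofReal_re _
    rw [h1] at h
    refine h.congr_fun fun k => ?_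
    rw [← hquot]
    exact (Complex.re_ofReal_mul _ _).symm

/-- Uniqueness for `v = μ * v`, for `v` dominated by superharmonic weights. -/
theorem eq_zero_of_harmonic_of_bound {μ : ℤ → ℝ} (hμ : ∀ k, 0 ≤ μ k) {v w₁ w₂ : ℤ → ℝ} {ρ : ℝ}
    (hρ0 : 0 ≤ ρ) (hρ : ρ < 1) (hv : ∀ n, HasSum (fun k => μ k * v (n - k)) (v n))
    (hw₁ : ∀ n, ∃ a ≤ w₁ n, HasSum (fun k => μ k * w₁ (n - k)) a)
    (hw₂ : ∀ n, HasSum (fun k => μ k * w₂ (n - k)) (ρ * w₂ n))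
    (hb : ∀ η > 0, ∃ C, ∀ n, |v n| ≤ η * w₁ n + C * w₂ n) (n : ℤ) : v n = 0 := by
  have key : ∀ η > 0, ∃ C, ∀ (i : ℕ) (n : ℤ), |v n| ≤ η * w₁ n + ρ ^ i * C * w₂ n := by
    intro η hη
    obtain ⟨C, hC⟩ := hb η hη
    refine ⟨C, fun i => ?_⟩
    induction i with
    | zero => intro n; simpa using hC n
    | succ i ih =>
      intro n
      obtain ⟨a, ha, hsa⟩ := hw₁ n
      have hs := (hsa.mul_left η).add ((hw₂ n).mul_left (ρ ^ i * C))
      have h1 (k : ℤ) : |μ k * v (n - k)| ≤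
          η * (μ k * w₁ (n - k)) + ρ ^ i * C * (μ k * w₂ (n - k)) := by
        rw [abs_mul, abs_of_nonneg (hμ k)]
        calc μ k * |v (n - k)| ≤ μ k * (η * w₁ (n - k) + ρ ^ i * C * w₂ (n - k)) :=
              mul_le_mul_of_nonneg_left (ih _) (hμ k)
          _ = _ := by ring
      have h2 : |v n| ≤ η * a + ρ ^ i * C * (ρ * w₂ n) := by
        rw [abs_le]
        exact ⟨by
          have := hasSum_le (fun k => (abs_le.1 (h1 k)).1) hs.neg (hv n)
          linarith, hasSum_le (fun k => (abs_le.1 (h1 k)).2) (hv n) hs⟩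
      have h3 : η * a ≤ η * w₁ n := mul_le_mul_of_nonneg_left ha hη.le
      have h4 : ρ ^ (i + 1) * C * w₂ n = ρ ^ i * C * (ρ * w₂ n) := by ring
      linarith
  have key2 : ∀ η > 0, |v n| ≤ η * w₁ n := by
    intro η hη
    obtain ⟨C, hC⟩ := key η hη
    have ht : Tendsto (fun i : ℕ => η * w₁ n + ρ ^ i * C * w₂ n) atTop
        (𝓝 (η * w₁ n + 0 * C * w₂ n)) :=
      (((tendsto_pow_atTop_nhds_zero_of_lt_one hρ0 hρ).mul_const C).mul_const _).const_add _
    simpa using ge_of_tendsto' ht fun i => hC i n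
  have ht : Tendsto (fun η : ℝ => η * w₁ n) (𝓝[>] 0) (𝓝 (0 * w₁ n)) :=
    (tendsto_id.mul_const _).mono_left nhdsWithin_le_nhds
  rw [zero_mul] at ht
  have := ge_of_tendsto ht (eventually_mem_nhdsWithin.mono fun η hη => key2 η hη)
  exact abs_eq_zero.1 (le_antisymm this (abs_nonneg _))

/-- The data of a lattice random walk with exponential change of measure: `p` is the
sub-probability of `log A / h` on `A ≠ 0`. -/
structure IsLatticeStep (κ h : ℝ) (p : ℤ → ℝ) : Prop where
  kappa_pos : 0 < κ
  span_pos : 0 < h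
  nonneg : ∀ k, 0 ≤ p k
  summable : Summable p
  tsum_le_one : ∑' k, p k ≤ 1
  hasSum_one : HasSum (fun k : ℤ => p k * Real.exp (κ * (k * h))) 1
  summable_abs : Summable fun k : ℤ => |(k : ℝ)| * (p k * Real.exp (κ * (k * h)))
  aperiodic : ∀ d : ℤ, (∀ k, p k ≠ 0 → d ∣ k) → IsUnit d

namespace IsLatticeStep

variable {κ h : ℝ} {p : ℤ → ℝ}

theorem exists_ne_zero (H : IsLatticeStep κ h p) : ∃ k : ℤ, k ≠ 0 ∧ 0 < p k := by
  by_contra! hc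
  have := H.aperiodic 0 fun k hk => by
    by_contra hk0
    exact hk (le_antisymm (hc k (by simpa using hk0)) (H.nonneg k))
  simp at this

theorem isAperiodicStep (H : IsLatticeStep κ h p) :
    IsAperiodicStep fun k : ℤ => p k * Real.exp (κ * (k * h)) where
  nonneg k := mul_nonneg (H.nonneg k) (Real.exp_pos _).le
  hasSum_one := H.hasSum_one
  summable_abs := H.summable_abs
  aperiodic d hd := H.aperiodic d fun k hk => hd k (mul_ne_zero hk (Real.exp_pos _).ne')
  drift_ne := by
    have hs : Summable fun k : ℤ => (k : ℝ) * (p k * Real.exp (κ * (k * h))) := by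
      refine H.summable_abs.of_norm_bounded fun k => ?_
      rw [norm_mul, Real.norm_eq_abs,
        Real.norm_of_nonneg (mul_nonneg (H.nonneg k) (Real.exp_pos _).le)]
    have hκh : 0 < κ * h := mul_pos H.kappa_pos H.span_pos
    have hlt : ∑' k, (p k * Real.exp (κ * (k * h)) - p k) <
        ∑' k : ℤ, κ * h * ((k : ℝ) * (p k * Real.exp (κ * (k * h)))) := by
      have hE (x : ℝ) : Real.exp x - 1 ≤ x * Real.exp x := by
        have h1 := Real.add_one_le_exp (-x)
        have h2 : Real.exp (-x) * Real.exp x = 1 := by rw [← Real.exp_add]; simp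
        nlinarith [Real.exp_pos x]
      obtain ⟨k₀, hk0, hp0⟩ := H.exists_ne_zero
      refine Summable.tsum_lt_tsum (i := k₀) (fun k => ?_) ?_ (H.hasSum_one.summable.sub H.summable)
        (hs.mul_left _)
      · have := mul_le_mul_of_nonneg_left (hE (κ * (k * h))) (H.nonneg k)
        nlinarith
      · have hne : -(κ * ((k₀ : ℝ) * h)) ≠ 0 := by
          have : (k₀ : ℝ) ≠ 0 := by exact_mod_cast hk0
          have := H.kappa_pos.ne'
          have := H.span_pos.ne'
          simp_all
        have h1 := Real.add_one_lt_exp hne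
        set x := κ * ((k₀ : ℝ) * h) with hx
        have h2 : Real.exp (-x) * Real.exp x = 1 := by rw [← Real.exp_add]; simp
        have h3 : Real.exp x - 1 < x * Real.exp x := by nlinarith [Real.exp_pos x]
        have := mul_lt_mul_of_pos_left h3 hp0
        have h4 : κ * h * ((k₀ : ℝ) * (p k₀ * Real.exp x)) = p k₀ * (x * Real.exp x) := by
          rw [hx]; ring
        rw [h4]
        linarith
    rw [tsum_mul_left, H.hasSum_one.summable.tsum_sub H.summable, H.hasSum_one.tsum_eq] at hlt
    intro h0
    rw [h0] at hlt
    linarith [H.tsum_le_one]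

/-- The moment of order `s ∈ (0, κ)` is less than one. -/
theorem exists_moment_lt_one (H : IsLatticeStep κ h p) {s : ℝ} (hs : 0 < s) (hsκ : s < κ) :
    ∃ ρ, 0 ≤ ρ ∧ ρ < 1 ∧ HasSum (fun k : ℤ => p k * Real.exp (s * (k * h))) ρ := by
  set θ := s / κ with hθ
  have hκ := H.kappa_pos
  have hθ0 : 0 < θ := div_pos hs hκ
  have hθ1 : θ < 1 := (div_lt_one hκ).2 hsκ
  have hexp (k : ℤ) : s * (k * h) = θ * (κ * (k * h)) := by rw [hθ]; field_simp
  have hle (k : ℤ) : Real.exp (s * (k * h)) ≤ θ * Real.exp (κ * (k * h)) + (1 - θ) := by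
    rw [hexp]
    have := convexOn_exp.2 (Set.mem_univ (κ * (k * h))) (Set.mem_univ 0) hθ0.le
      (sub_nonneg.2 hθ1.le) (by ring)
    simpa using this
  have hlt (k : ℤ) (hk : k ≠ 0) :
      Real.exp (s * (k * h)) < θ * Real.exp (κ * (k * h)) + (1 - θ) := by
    rw [hexp]
    have hne : κ * ((k : ℝ) * h) ≠ 0 :=
      mul_ne_zero hκ.ne' (mul_ne_zero (by exact_mod_cast hk) H.span_pos.ne')
    have := strictConvexOn_exp.2 (Set.mem_univ (κ * (k * h))) (Set.mem_univ 0) hne hθ0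
      (sub_pos.2 hθ1) (by ring)
    simpa using this
  have hS : HasSum (fun k : ℤ => θ * (p k * Real.exp (κ * (k * h))) + (1 - θ) * p k)
      (θ * 1 + (1 - θ) * ∑' k, p k) :=
    (H.hasSum_one.mul_left θ).add (H.summable.hasSum.mul_left (1 - θ))
  have hle' (k : ℤ) : p k * Real.exp (s * (k * h)) ≤
      θ * (p k * Real.exp (κ * (k * h))) + (1 - θ) * p k := by
    have := mul_le_mul_of_nonneg_left (hle k) (H.nonneg k)
    linarith
  have h0 (k : ℤ) : 0 ≤ p k * Real.exp (s * (k * h)) := mul_nonneg (H.nonneg k) (Real.exp_pos _).le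
  have hsum := hS.summable.of_nonneg_of_le h0 hle'
  refine ⟨_, tsum_nonneg h0, ?_, hsum.hasSum⟩
  obtain ⟨k₀, hk0, hp0⟩ := H.exists_ne_zero
  calc _ < _ := hsum.tsum_lt_tsum (i := k₀) hle' (by
        have := mul_lt_mul_of_pos_left (hlt k₀ hk0) hp0
        linarith) hS.summable
    _ = _ := hS.tsum_eq
    _ ≤ 1 := by nlinarith [H.tsum_le_one]

/-- The uniqueness statement for the renewal equation of the tilted walk. -/
theorem eq_zero_of_harmonic (H : IsLatticeStep κ h p) {ε : ℝ} (hε : 0 < ε) (hεκ : ε < κ)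
    {v : ℤ → ℝ}
    (hv : ∀ n, HasSum (fun k : ℤ => p k * Real.exp (κ * (k * h)) * v (n - k)) (v n))
    (hb : ∀ η > 0, ∃ C, ∀ n : ℤ,
      |v n| ≤ η * (1 + Real.exp (κ * (n * h))) + C * Real.exp (ε * (n * h))) (n : ℤ) :
    v n = 0 := by
  obtain ⟨ρ, hρ0, hρ1, hρ⟩ := H.exists_moment_lt_one (s := κ - ε) (by linarith) (by linarith)
  refine eq_zero_of_harmonic_of_bound H.isAperiodicStep.nonneg hρ0 hρ1 hv
    (w₁ := fun n => 1 + Real.exp (κ * (n * h))) (w₂ := fun n => Real.exp (ε * (n * h)))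
    (fun n => ?_) (fun n => ?_) hb n
  · refine ⟨1 + Real.exp (κ * (n * h)) * ∑' k, p k, ?_, ?_⟩
    · have := mul_le_of_le_one_right (Real.exp_pos (κ * (n * h))).le H.tsum_le_one
      simpa using this
    · refine (H.hasSum_one.add (H.summable.hasSum.mul_left (Real.exp (κ * (n * h))))).congr_fun
        fun k => ?_
      have : Real.exp (κ * (n * h)) =
          Real.exp (κ * (k * h)) * Real.exp (κ * (((n - k : ℤ) : ℝ) * h)) := by
        rw [← Real.exp_add]; congr 1; push_cast; ring
      rw [this]; ring
  · rw [mul_comm]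
    refine (hρ.mul_left (Real.exp (ε * (n * h)))).congr_fun fun k => ?_
    have : Real.exp (ε * (n * h)) * Real.exp ((κ - ε) * (k * h)) =
          Real.exp (κ * (k * h)) * Real.exp (ε * (((n - k : ℤ) : ℝ) * h)) := by
      rw [← Real.exp_add, ← Real.exp_add]; congr 1; push_cast; ring
    rw [mul_assoc, ← this]; ring

/-- The renewal theorem: solutions of `r - μ * r = g` of controlled growth converge. -/
theorem exists_tendsto_of_renewal (H : IsLatticeStep κ h p) {ε : ℝ} (hε : 0 < ε) (hεκ : ε < κ)
    {r g : ℤ → ℝ} (hg : Summable fun n => |g n|)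
    (hr : ∀ n, HasSum (fun k : ℤ => p k * Real.exp (κ * (k * h)) * r (n - k)) (r n - g n))
    (hb : ∀ η > 0, ∃ C, ∀ n : ℤ,
      |r n| ≤ η * (1 + Real.exp (κ * (n * h))) + C * Real.exp (ε * (n * h))) :
    ∃ L, Tendsto r atTop (𝓝 L) := by
  obtain ⟨R, ⟨C₀, hC₀⟩, hbot, ⟨L, hL⟩, hR⟩ := H.isAperiodicStep.exists_renewal_solution hg
  refine ⟨L, hL.congr fun n => ?_⟩
  have hC₀' : 0 ≤ C₀ := (abs_nonneg _).trans (hC₀ 0)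
  refine (sub_eq_zero.1 (H.eq_zero_of_harmonic hε hεκ (v := fun n => r n - R n) (fun n => ?_)
    (fun η hη => ?_) n)).symm
  · have h1 := (H.hasSum_one.mul_right (R n)).sub (hR n)
    rw [show r n - R n = r n - g n - (1 * R n - g n) by ring]
    exact ((hr n).sub h1).congr_fun fun k => by ring
  · obtain ⟨C, hC⟩ := hb (η / 2) (by linarith)
    obtain ⟨N, hN⟩ := eventually_atBot.1
      ((Metric.tendsto_nhds.1 hbot) (η / 2) (by linarith))
    refine ⟨C + C₀ * Real.exp (-(ε * (N * h))), fun n => ?_⟩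
    have hRn : |R n| ≤ η / 2 + C₀ * Real.exp (-(ε * (N * h))) * Real.exp (ε * (n * h)) := by
      rcases le_total n N with hn | hn
      · have := (hN n hn).le
        rw [Real.dist_0_eq_abs] at this
        have : 0 ≤ C₀ * Real.exp (-(ε * (N * h))) * Real.exp (ε * (n * h)) := by positivity
        linarith
      · have h1 : (1 : ℝ) ≤ Real.exp (-(ε * (N * h))) * Real.exp (ε * (n * h)) := by
          rw [← Real.exp_add]
          refine Real.one_le_exp ?_
          have h2 : (N : ℝ) ≤ n := by exact_mod_cast hn
          have := mul_le_mul_of_nonneg_left (mul_le_mul_of_nonneg_right h2 H.span_pos.le) hε.le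
          linarith
        have := mul_le_mul_of_nonneg_left h1 hC₀'
        linarith [hC₀ n]
    have h3 := abs_sub (r n) (R n)
    have h4 : 0 ≤ η / 2 * Real.exp (κ * (n * h)) := by positivity
    have := hC n
    linarith

/-- A bounded superharmonic function vanishing at both ends is zero. -/
theorem eq_zero_of_superharmonic (H : IsLatticeStep κ h p) {r g : ℤ → ℝ} (hg : ∀ n, 0 ≤ g n)
    (hr : ∀ n, HasSum (fun k : ℤ => p k * Real.exp (κ * (k * h)) * r (n - k)) (r n - g n))
    {ε C : ℝ} (hε : 0 < ε) (hεκ : ε < κ) (hC : ∀ n : ℤ, |r n| ≤ C * Real.exp (ε * (n * h)))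
    {C' : ℝ} (hC' : ∀ n, |r n| ≤ C')
    (hbot : Tendsto r atBot (𝓝 0)) (htop : Tendsto r atTop (𝓝 0)) (n : ℤ) : r n = 0 := by
  have hd (n : ℤ) : HasSum (fun k : ℤ => p k * Real.exp (κ * (k * h)) * (r n - r (n - k)))
      (g n) := by
    rw [show g n = 1 * r n - (r n - g n) by ring]
    exact ((H.hasSum_one.mul_right (r n)).sub (hr n)).congr_fun fun k => by ring
  let D : ℕ → ℤ → ℝ := fun N k => ∑ n ∈ Finset.Icc (-N : ℤ) N, (r n - r (n - k))
  have htel (N : ℕ) (j : ℤ) : ∑ n ∈ Finset.Icc (-N : ℤ) N, (r (n - j) - r (n - (j + 1))) =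
      r (N - j) - r (-N - (j + 1)) := by
    induction N with
    | zero => simp
    | succ N ih =>
      have h1 : Finset.Icc (-(N + 1 : ℕ) : ℤ) (N + 1 : ℕ) =
          insert (-(N + 1 : ℕ) : ℤ) (insert ((N + 1 : ℕ) : ℤ) (Finset.Icc (-N : ℤ) N)) := by
        ext x; simp only [Finset.mem_Icc, Finset.mem_insert]; omega
      rw [h1, Finset.sum_insert (by simp; omega), Finset.sum_insert (by simp), ih]
      have h2 : ((N + 1 : ℕ) : ℤ) - (j + 1) = N - j := by push_cast; ring
      have h3 : (-(N + 1 : ℕ) : ℤ) - j = -N - (j + 1) := by push_cast; ring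
      rw [h2, h3]
      ring
  have hDsucc (N : ℕ) (k : ℤ) : D N (k + 1) = D N k + (r (N - k) - r (-N - (k + 1))) := by
    rw [← htel, ← Finset.sum_add_distrib]
    exact Finset.sum_congr rfl fun n _ => by ring
  have hD0 (N : ℕ) : D N 0 = 0 := by simp [D]
  have hDpred (N : ℕ) (k : ℤ) : D N (k - 1) = D N k - (r (N - (k - 1)) - r (-N - k)) := by
    have := hDsucc N (k - 1)
    rw [sub_add_cancel] at this
    rw [this]; ring
  have hDb (N : ℕ) (k : ℤ) : |D N k| ≤ 2 * C' * |(k : ℝ)| := by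
    induction k using Int.induction_on with
    | zero => simp [hD0]
    | succ i ih =>
      have h1 := abs_add_le (D N i) (r (N - i) - r (-N - (i + 1)))
      have h2 := abs_sub (r (N - i)) (r (-N - (i + 1)))
      have h3 : |(((i : ℤ) + 1 : ℤ) : ℝ)| = |((i : ℤ) : ℝ)| + 1 := by
        push_cast
        rw [abs_of_nonneg (by positivity), abs_of_nonneg (by positivity)]
      rw [hDsucc, h3]
      linarith [hC' (N - i), hC' (-N - (i + 1))]
    | pred i ih =>
      have h1 := abs_sub (D N (-i)) (r (N - (-i - 1)) - r (-N - -i))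
      have h2 := abs_sub (r (N - (-i - 1))) (r (-N - -i))
      have h3 : |((-(i : ℤ) - 1 : ℤ) : ℝ)| = |((-(i : ℤ) : ℤ) : ℝ)| + 1 := by
        push_cast
        rw [abs_neg, ← neg_add', abs_neg, abs_of_nonneg (by positivity),
          abs_of_nonneg (by positivity)]
      rw [hDpred, h3]
      linarith [hC' (N - (-i - 1)), hC' (-N - -i)]
  have hcast : Tendsto (fun N : ℕ => (N : ℤ)) atTop atTop := tendsto_natCast_atTop_atTop
  have hT (j : ℤ) : Tendsto (fun N : ℕ => r (N - j)) atTop (𝓝 0) :=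
    htop.comp (tendsto_atTop_add_const_right _ (-j) hcast)
  have hB (j : ℤ) : Tendsto (fun N : ℕ => r (-N - j)) atTop (𝓝 0) :=
    hbot.comp (tendsto_atBot_add_const_right _ (-j) (tendsto_neg_atTop_atBot.comp hcast))
  have hDt (k : ℤ) : Tendsto (fun N => D N k) atTop (𝓝 0) := by
    induction k using Int.induction_on with
    | zero => simp [hD0]
    | succ i ih => simpa [hDsucc] using ih.add ((hT i).sub (hB (i + 1)))
    | pred i ih => simpa only [hDpred, sub_zero] using ih.sub ((hT (-i - 1)).sub (hB (-i)))
  have hsum (N : ℕ) : HasSum (fun k : ℤ => p k * Real.exp (κ * (k * h)) * D N k)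
      (∑ n ∈ Finset.Icc (-N : ℤ) N, g n) := by
    refine (hasSum_sum fun n _ => hd n).congr_fun fun k => ?_
    rw [Finset.mul_sum]
  have hlim : Tendsto (fun N : ℕ => ∑ n ∈ Finset.Icc (-N : ℤ) N, g n) atTop (𝓝 0) := by
    have := tendsto_tsum_of_dominated_convergence (𝓕 := (atTop : Filter ℕ))
      (f := fun N k => p k * Real.exp (κ * (k * h)) * D N k) (g := fun _ => (0 : ℝ))
      (H.summable_abs.mul_left (2 * C')) (fun k => by simpa using (hDt k).const_mul _)
      (Eventually.of_forall fun N k => by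
        have hμ := H.isAperiodicStep.nonneg k
        rw [norm_mul, Real.norm_of_nonneg hμ, Real.norm_eq_abs]
        calc _ ≤ _ := mul_le_mul_of_nonneg_left (hDb N k) hμ
          _ = _ := by ring)
    simpa only [(hsum _).tsum_eq, tsum_zero] using this
  have hg0 (m : ℤ) : g m = 0 := by
    refine le_antisymm (ge_of_tendsto hlim ?_) (hg m)
    filter_upwards [eventually_ge_atTop m.natAbs] with N hN
    exact Finset.single_le_sum (f := g) (fun n _ => hg n) (Finset.mem_Icc.2 (by omega))
  refine H.eq_zero_of_harmonic hε hεκ (fun n => by simpa [hg0] using hr n) (fun η hη => ⟨C, ?_⟩) n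
  intro n
  have : 0 ≤ η * (1 + Real.exp (κ * (n * h))) := by positivity
  linarith [hC n]

end IsLatticeStep

/-- The atoms of `A` on the lattice `exp (h ℤ)`. -/
def latticeMass {Ω : Type*} [MeasurableSpace Ω] (P : Measure Ω) (A : Ω → ℝ) (h : ℝ) (k : ℤ) : ℝ :=
  P.real {ω | A ω = Real.exp (k * h)}

theorem AssumptionA1.ae_lattice {Ω : Type*} [MeasurableSpace Ω] {P : Measure Ω}
    {A : Ω → ℝ} {κ h : ℝ} (hA1 : AssumptionA1 P A κ h) :
    ∀ᵐ ω ∂P, A ω = 0 ∨ ∃ k : ℤ, A ω = Real.exp (k * h) := by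
  obtain ⟨-, hnn, -, -, -, h0, -⟩ := hA1
  filter_upwards [hnn, measure_eq_zero_iff_ae_notMem.1 h0] with ω h1 h2
  by_contra! hc
  refine h2 ⟨hc.1, fun k hk => hc.2 k ?_⟩
  rw [← hk, Real.exp_log (lt_of_le_of_ne h1 hc.1.symm)]

theorem measurableSet_lattice {Ω : Type*} [MeasurableSpace Ω] {A : Ω → ℝ} (hA : Measurable A) (h : ℝ) (k : ℤ) :
    MeasurableSet {ω | A ω = Real.exp (k * h)} :=
  hA (measurableSet_singleton _)

theorem pairwise_disjoint_lattice {Ω : Type*} (A : Ω → ℝ) {h : ℝ} (hh : 0 < h) :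
    Pairwise (Function.onFun Disjoint fun k : ℤ => {ω | A ω = Real.exp (k * h)}) := by
  intro i j hij
  refine Set.disjoint_left.2 fun ω hi hj => hij ?_
  have h1 : Real.exp (i * h) = Real.exp (j * h) := hi.symm.trans hj
  have h2 := mul_right_cancel₀ hh.ne' (Real.exp_injective h1)
  exact_mod_cast h2

theorem AssumptionA1.hasSum_integral {Ω : Type*} [MeasurableSpace Ω] {P : Measure Ω}
    {A : Ω → ℝ} {κ h : ℝ} (hA1 : AssumptionA1 P A κ h)
    (hA : Measurable A) {f : ℝ → ℝ} (hf0 : f 0 = 0)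
    (hf : Integrable (fun ω => f (A ω)) P) :
    HasSum (fun k : ℤ => latticeMass P A h k * f (Real.exp (k * h))) (∫ ω, f (A ω) ∂P) := by
  have hS := measurableSet_lattice hA h
  have h1 := hasSum_integral_iUnion (μ := P) (f := fun ω => f (A ω)) hS
    (pairwise_disjoint_lattice A hA1.2.2.2.2.1) hf.integrableOn
  have h2 : ∫ ω in ⋃ k : ℤ, {ω | A ω = Real.exp (k * h)}, f (A ω) ∂P = ∫ ω, f (A ω) ∂P := by
    refine setIntegral_eq_integral_of_ae_compl_eq_zero ?_
    filter_upwards [hA1.ae_lattice] with ω hω hnot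
    rcases hω with hω | ⟨k, hk⟩
    · rw [hω, hf0]
    · exact absurd (Set.mem_iUnion.2 ⟨k, hk⟩) hnot
  rw [h2] at h1
  refine h1.congr_fun fun k => ?_
  rw [setIntegral_congr_fun (g := fun _ => f (Real.exp (k * h))) (hS k)
    (fun ω hω => by simp only [show A ω = _ from hω])]
  simp [latticeMass]

theorem hasSum_measureReal_inter_lattice {Ω : Type*} [MeasurableSpace Ω] {P : Measure Ω}
    [IsProbabilityMeasure P] {A : Ω → ℝ} (hA : Measurable A) {h : ℝ} (hh : 0 < h) (T : Set Ω) :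
    HasSum (fun k : ℤ => P.real ({ω | A ω = Real.exp (k * h)} ∩ T))
      (P.real ((⋃ k : ℤ, {ω | A ω = Real.exp (k * h)}) ∩ T)) := by
  have hS := measurableSet_lattice hA h
  have h1 := hasSum_integral_iUnion (μ := P.restrict T) (f := fun _ => (1 : ℝ)) hS
    (pairwise_disjoint_lattice A hh) (integrable_const _).integrableOn
  simp only [integral_const, smul_eq_mul, mul_one, measureReal_restrict_apply MeasurableSet.univ,
    Set.univ_inter, measureReal_restrict_apply (MeasurableSet.iUnion hS)] at h1
  exact h1.congr_fun fun k => by rw [measureReal_restrict_apply (hS k)]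

theorem AssumptionA1.isLatticeStep {Ω : Type*} [MeasurableSpace Ω] {P : Measure Ω}
    [IsProbabilityMeasure P] {A : Ω → ℝ} {κ h : ℝ}
    (hA1 : AssumptionA1 P A κ h) (hA : Measurable A) :
    IsLatticeStep κ h (latticeMass P A h) := by
  have hκ := hA1.1
  have hh : 0 < h := hA1.2.2.2.2.1
  have hrpow (k : ℤ) : Real.exp (k * h) ^ κ = Real.exp (κ * (k * h)) := by
    rw [← Real.exp_mul, mul_comm]
  have hp0 (k : ℤ) : 0 ≤ latticeMass P A h k := measureReal_nonneg
  have hp : HasSum (latticeMass P A h) (P.real (⋃ k : ℤ, {ω | A ω = Real.exp (k * h)})) := by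
    have h1 := hasSum_measureReal_inter_lattice (P := P) hA hh Set.univ
    simp only [Set.inter_univ] at h1
    exact h1
  have hone : HasSum (fun k : ℤ => latticeMass P A h k * Real.exp (κ * (k * h))) 1 := by
    have hint : Integrable (fun ω => A ω ^ κ) P := by
      by_contra hc
      have := hA1.2.2.1
      rw [integral_undef hc] at this
      norm_num at this
    have := hA1.hasSum_integral hA (f := fun x => x ^ κ) (Real.zero_rpow hκ.ne') hint
    simpa only [hA1.2.2.1, hrpow] using this
  refine ⟨hκ, hh, hp0, hp.summable, ?_, hone, ?_, fun d hd => ?_⟩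
  · rw [hp.tsum_eq]
    exact measureReal_le_one
  · have hint : Integrable (fun ω => A ω ^ κ * max (Real.log (A ω)) 0) P := by
      refine ⟨by fun_prop, ?_⟩
      rw [hasFiniteIntegral_iff_ofReal]
      · exact hA1.2.2.2.1
      · filter_upwards [hA1.2.1] with ω hω
        exact mul_nonneg (Real.rpow_nonneg hω κ) (le_max_right _ _)
    have hs := (hA1.hasSum_integral hA (f := fun x => x ^ κ * max (Real.log x) 0)
      (by simp) hint).summable
    simp only [hrpow, Real.log_exp] at hs
    have hκh : 0 < κ * h := mul_pos hκ hh
    refine ((hs.mul_left (1 / h)).add (hp.summable.mul_left (1 / (κ * h)))).of_nonneg_of_le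
      (fun k => mul_nonneg (abs_nonneg _) (mul_nonneg (hp0 k) (Real.exp_pos _).le)) fun k => ?_
    have key : |(k : ℝ)| * Real.exp (κ * (k * h)) ≤
        1 / h * (Real.exp (κ * (k * h)) * max (k * h) 0) + 1 / (κ * h) := by
      rcases le_total 0 (k : ℝ) with hk | hk
      · rw [abs_of_nonneg hk, max_eq_left (by positivity)]
        have : 1 / h * (Real.exp (κ * (k * h)) * (k * h)) = k * Real.exp (κ * (k * h)) := by
          field_simp
        rw [this]
        have : 0 < 1 / (κ * h) := by positivity
        linarith
      · rw [abs_of_nonpos hk, max_eq_right (mul_nonpos_of_nonpos_of_nonneg hk hh.le)]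
        rw [mul_zero, mul_zero, zero_add, le_div_iff₀ hκh]
        have h1 := Real.add_one_le_exp (-(κ * (k * h)))
        have h2 : Real.exp (-(κ * (k * h))) * Real.exp (κ * (k * h)) = 1 := by
          rw [← Real.exp_add]; simp
        nlinarith [Real.exp_pos (κ * (k * h))]
    have := mul_le_mul_of_nonneg_left key (hp0 k)
    linarith
  · by_contra hnu
    obtain ⟨e, he2, he⟩ : ∃ e : ℤ, 2 ≤ e ∧ ∀ k, latticeMass P A h k ≠ 0 → e ∣ k := by
      by_cases hd0 : d = 0
      · refine ⟨2, le_rfl, fun k hk => ?_⟩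
        have := hd k hk
        rw [hd0, zero_dvd_iff] at this
        simp [this]
      · refine ⟨|d|, ?_, fun k hk => (abs_dvd _ _).2 (hd k hk)⟩
        rw [Int.isUnit_iff_abs_eq] at hnu
        have := abs_pos.2 hd0
        omega
    have heR : (2 : ℝ) ≤ e := by exact_mod_cast he2
    have hle := hA1.2.2.2.2.2.2 (e * h) (by positivity) ?_
    · nlinarith
    rw [measure_eq_zero_iff_ae_notMem]
    have hnull : ∀ᵐ ω ∂P, ∀ k : ℤ, latticeMass P A h k = 0 → A ω ≠ Real.exp (k * h) := by
      refine ae_all_iff.2 fun k => ?_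
      by_cases hk : latticeMass P A h k = 0
      · have := (measureReal_eq_zero_iff (by finiteness)).1 hk
        filter_upwards [measure_eq_zero_iff_ae_notMem.1 this] with ω hω _ using hω
      · exact Eventually.of_forall fun ω h0 => absurd h0 hk
    filter_upwards [hA1.ae_lattice, hnull] with ω h1 h2 ⟨h3, h4⟩
    rcases h1 with h1 | ⟨k, hk⟩
    · exact h3 h1
    · obtain ⟨j, hj⟩ := he k fun h0 => h2 k h0 hk
      refine h4 j ?_
      rw [hk, Real.log_exp, hj]
      push_cast
      ring

/-- The tail of `A * Y`, for `Y` independent of `A`. -/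
theorem AssumptionA1.hasSum_tail {Ω : Type*} [MeasurableSpace Ω] {P : Measure Ω}
    [IsProbabilityMeasure P] {A Y : Ω → ℝ} {κ h : ℝ}
    (hA1 : AssumptionA1 P A κ h) (hA : Measurable A) (hAY : IndepFun A Y P)
    (s : ℝ) :
    HasSum (fun k : ℤ => latticeMass P A h k * P.real {ω | Real.exp (s - k * h) < Y ω})
      (P.real {ω | Real.exp s < A ω * Y ω}) := by
  have hh : 0 < h := hA1.2.2.2.2.1
  have h1 := hasSum_measureReal_inter_lattice (P := P) hA hh {ω | Real.exp s < A ω * Y ω}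
  have h2 : P.real ((⋃ k : ℤ, {ω | A ω = Real.exp (k * h)}) ∩ {ω | Real.exp s < A ω * Y ω}) =
      P.real {ω | Real.exp s < A ω * Y ω} := by
    refine measureReal_congr ?_
    filter_upwards [hA1.ae_lattice] with ω hω
    refine propext ⟨fun h => h.2, fun h => ⟨?_, h⟩⟩
    rcases hω with hω | ⟨k, hk⟩
    · have h' : Real.exp s < A ω * Y ω := h
      rw [hω, zero_mul] at h'
      exact absurd h' (Real.exp_pos s).not_gt
    · exact Set.mem_iUnion.2 ⟨k, hk⟩
  rw [h2] at h1
  refine h1.congr_fun fun k => ?_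
  have h3 : {ω | A ω = Real.exp (k * h)} ∩ {ω | Real.exp s < A ω * Y ω} =
      A ⁻¹' {Real.exp (k * h)} ∩ Y ⁻¹' Set.Ioi (Real.exp (s - k * h)) := by
    ext ω
    refine and_congr_right fun (hω : A ω = _) => ?_
    change Real.exp s < A ω * Y ω ↔ Real.exp (s - k * h) < Y ω
    rw [hω, Real.exp_sub, div_lt_iff₀' (Real.exp_pos _)]
  rw [h3, measureReal_def P (_ ∩ _), hAY.measure_inter_preimage_eq_mul _ _ (measurableSet_singleton _)
    measurableSet_Ioi, ENNReal.toReal_mul]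
  rfl

/-- A tail `G`, in the logarithmic scale, that is almost subharmonic for the lattice step decays
exponentially at any rate `ε < κ`. -/
theorem IsLatticeStep.exists_le_mul_exp {κ h : ℝ} {p : ℤ → ℝ} (H : IsLatticeStep κ h p)
    {G : ℝ → ℝ} (hG1 : ∀ s, G s ≤ 1) (hGtop : Tendsto G atTop (𝓝 0))
    {ε : ℝ} (hε : 0 < ε) (hεκ : ε < κ)
    (hG : ∀ a > 0, ∃ D, 0 ≤ D ∧ ∀ s, ∃ T, HasSum (fun k : ℤ => p k * G (s - a - k * h)) T ∧
      G s ≤ T + D * Real.exp (-(ε * s))) :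
    ∃ C, 0 ≤ C ∧ ∀ s, G s ≤ C * Real.exp (-(ε * s)) := by
  obtain ⟨ρ, hρ0, hρ1, hρ⟩ := H.exists_moment_lt_one hε hεκ
  set a : ℝ := Real.log (2 / (1 + ρ)) / ε with ha
  have hτ : 1 < 2 / (1 + ρ) := by rw [lt_div_iff₀ (by linarith)]; linarith
  have ha0 : 0 < a := div_pos (Real.log_pos hτ) hε
  have hea : Real.exp (ε * a) = 2 / (1 + ρ) := by
    rw [ha, mul_div_cancel₀ _ hε.ne', Real.exp_log (by linarith)]
  set ρ' : ℝ := Real.exp (ε * a) * ρ with hρ'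
  have hρ'0 : 0 ≤ ρ' := mul_nonneg (Real.exp_pos _).le hρ0
  have hρ'1 : ρ' < 1 := by
    rw [hρ', hea, div_mul_eq_mul_div, div_lt_one (by linarith)]
    linarith
  obtain ⟨D, hD0, hD⟩ := hG a ha0
  refine ⟨D / (1 - ρ'), div_nonneg hD0 (by linarith), fun s => ?_⟩
  set C : ℝ := D / (1 - ρ') with hC
  have hC0 : 0 ≤ C := div_nonneg hD0 (by linarith)
  have hCe : C * ρ' + D = C := by
    rw [hC]; field_simp [show (1 - ρ') ≠ 0 by linarith]; ring
  refine le_of_forall_pos_le_add fun η hη => ?_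
  obtain ⟨N, hN⟩ := eventually_atTop.1 (hGtop.eventually (ge_mem_nhds hη))
  set M : ℝ := Real.exp (ε * N) with hM
  have hind (j : ℕ) : ∀ s, G s ≤ η + (C + M * ρ' ^ j) * Real.exp (-(ε * s)) := by
    induction j with
    | zero =>
      intro s
      have hM0 : 0 < M := Real.exp_pos _
      rcases le_total N s with hs | hs
      · have := hN s hs
        have h2 : 0 ≤ (C + M * ρ' ^ 0) * Real.exp (-(ε * s)) := by positivity
        linarith
      · have h1 : 1 ≤ M * Real.exp (-(ε * s)) := by
          rw [hM, ← Real.exp_add]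
          refine Real.one_le_exp ?_
          nlinarith
        have h2 : 0 ≤ C * Real.exp (-(ε * s)) := by positivity
        have h3 := hG1 s
        rw [pow_zero, mul_one, add_mul]
        linarith
    | succ j ih =>
      intro s
      obtain ⟨T, hT, hGT⟩ := hD s
      have h1 : HasSum (fun k : ℤ => p k * η + (C + M * ρ' ^ j) * Real.exp (ε * a) *
          Real.exp (-(ε * s)) * (p k * Real.exp (ε * (k * h))))
          ((∑' k, p k) * η + (C + M * ρ' ^ j) * Real.exp (ε * a) * Real.exp (-(ε * s)) * ρ) :=
        (H.summable.hasSum.mul_right η).add (hρ.mul_left _)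
      have h2 := hasSum_le (fun k => ?_) hT h1
      · have h3 := mul_le_mul_of_nonneg_right H.tsum_le_one hη.le
        have h4 : (C + M * ρ' ^ j) * Real.exp (ε * a) * Real.exp (-(ε * s)) * ρ =
            (C * ρ' + M * ρ' ^ (j + 1)) * Real.exp (-(ε * s)) := by
          rw [hρ']; ring
        have h5 : (C + M * ρ' ^ (j + 1)) * Real.exp (-(ε * s)) =
          (C * ρ' + M * ρ' ^ (j + 1)) * Real.exp (-(ε * s)) + D * Real.exp (-(ε * s)) := by
          rw [← add_mul]; congr 1; linarith
        linarith
      · have h3 := mul_le_mul_of_nonneg_left (ih (s - a - k * h)) (H.nonneg k)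
        refine h3.trans_eq ?_
        have : Real.exp (-(ε * (s - a - k * h))) =
            Real.exp (ε * a) * Real.exp (-(ε * s)) * Real.exp (ε * (k * h)) := by
          rw [← Real.exp_add, ← Real.exp_add]; congr 1; ring
        rw [this]; ring
  have hlim : Tendsto (fun j : ℕ => η + (C + M * ρ' ^ j) * Real.exp (-(ε * s))) atTop
      (𝓝 (η + (C + M * 0) * Real.exp (-(ε * s)))) :=
    ((((tendsto_pow_atTop_nhds_zero_of_lt_one hρ'0 hρ'1).const_mul M).const_add C).mul_const
      _).const_add η
  have := ge_of_tendsto' hlim fun j => hind j s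
  linarith

/-- `X` solves the perpetuity equation `X = A X + B` in distribution. -/
structure IsPerpetuity {Ω : Type*} [MeasurableSpace Ω] (P : Measure Ω) (A B X : Ω → ℝ)
    (κ h : ℝ) : Prop where
  measurable_A : Measurable A
  measurable_B : Measurable B
  measurable_X : Measurable X
  assumptionA1 : AssumptionA1 P A κ h
  lintegral_lt_top : (∫⁻ ω, ENNReal.ofReal (|B ω| ^ κ) ∂P) < ⊤
  indepFun : IndepFun (fun ω => (A ω, B ω)) X P
  map_eq : Measure.map X P = Measure.map (fun ω => A ω * X ω + B ω) P

namespace IsPerpetuity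

variable {Ω : Type*} [MeasurableSpace Ω] {P : Measure Ω} {A B X : Ω → ℝ} {κ h : ℝ}

theorem neg (hX : IsPerpetuity P A B X κ h) :
    IsPerpetuity P A (fun ω => -B ω) (fun ω => -X ω) κ h := by
  have hA := hX.measurable_A
  have hB := hX.measurable_B
  have hXm := hX.measurable_X
  refine ⟨hA, hB.neg, hXm.neg, hX.assumptionA1, by simpa using hX.lintegral_lt_top,
    hX.indepFun.comp (φ := fun x : ℝ × ℝ => (x.1, -x.2)) (ψ := fun x : ℝ => -x)
      (by fun_prop) (by fun_prop), ?_⟩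
  have := congrArg (Measure.map fun x : ℝ => -x) hX.map_eq
  rw [Measure.map_map (by fun_prop) (by fun_prop),
    Measure.map_map (by fun_prop) (by fun_prop)] at this
  refine this.trans ?_
  congr 1
  ext ω
  simp only [Function.comp]
  ring

theorem measureReal_preimage (hX : IsPerpetuity P A B X κ h) {S : Set ℝ} (hS : MeasurableSet S) :
    P.real {ω | A ω * X ω + B ω ∈ S} = P.real {ω | X ω ∈ S} := by
  have hA := hX.measurable_A
  have hB := hX.measurable_B
  have hXm := hX.measurable_X
  have := congrArg (fun μ => (μ S).toReal) hX.map_eq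
  rw [Measure.map_apply hXm hS, Measure.map_apply (by fun_prop) hS] at this
  exact this.symm

theorem integrable_abs_rpow_B [IsFiniteMeasure P] (hX : IsPerpetuity P A B X κ h) :
    Integrable (fun ω => |B ω| ^ κ) P := by
  have hB := hX.measurable_B
  refine ⟨(hB.abs.pow_const κ).aestronglyMeasurable, ?_⟩
  rw [hasFiniteIntegral_iff_ofReal]
  · exact hX.lintegral_lt_top
  · exact Eventually.of_forall fun ω => by positivity

theorem exists_measureReal_le_mul_exp [IsProbabilityMeasure P] (hX : IsPerpetuity P A B X κ h)
    {ε : ℝ} (hε : 0 < ε) (hεκ : ε < κ) :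
    ∃ C, 0 ≤ C ∧ ∀ s, P.real {ω | Real.exp s < |X ω|} ≤ C * Real.exp (-(ε * s)) := by
  have hA := hX.measurable_A
  have hB := hX.measurable_B
  have hXm := hX.measurable_X
  have hAX : IndepFun A (fun ω => |X ω|) P :=
    hX.indepFun.comp (φ := Prod.fst) (ψ := fun x : ℝ => |x|) (by fun_prop) (by fun_prop)
  refine (hX.assumptionA1.isLatticeStep hA).exists_le_mul_exp
    (G := fun s => P.real {ω | Real.exp s < |X ω|}) (fun s => measureReal_le_one) ?_ hε hεκ ?_
  · have h1 := tendsto_measure_iInter_atTop (μ := P) (s := fun s : ℝ => {ω | Real.exp s < |X ω|})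
      (fun s => (measurableSet_lt measurable_const hXm.abs).nullMeasurableSet)
      (fun s t hst ω (hω : Real.exp t < |X ω|) => (Real.exp_le_exp.2 hst).trans_lt hω)
      ⟨0, by finiteness⟩
    have h2 : ⋂ s : ℝ, {ω | Real.exp s < |X ω|} = ∅ := by
      refine Set.eq_empty_of_forall_notMem fun ω hω => ?_
      have h3 : Real.exp |X ω| < |X ω| := Set.mem_iInter.1 hω |X ω|
      linarith [Real.add_one_le_exp |X ω|]
    rw [h2, measure_empty] at h1
    exact (ENNReal.tendsto_toReal (by simp : (0 : ENNReal) ≠ ⊤)).comp h1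
  · intro a ha
    set b : ℝ := 1 - Real.exp (-a) with hb
    have hb0 : 0 < b := by
      have := Real.exp_lt_one_iff.2 (neg_lt_zero.2 ha)
      linarith
    have hint : Integrable (fun ω => |B ω| ^ ε) P := by
      refine ((integrable_const (1 : ℝ)).add hX.integrable_abs_rpow_B).mono'
        (hB.abs.pow_const ε).aestronglyMeasurable
        (Eventually.of_forall fun ω => ?_)
      rw [Real.norm_of_nonneg (by positivity)]
      change _ ≤ 1 + |B ω| ^ κ
      rcases le_total (|B ω|) 1 with h1 | h1
      · have := Real.rpow_le_one (abs_nonneg (B ω)) h1 hε.le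
        have : 0 ≤ |B ω| ^ κ := by positivity
        linarith
      · have := Real.rpow_le_rpow_of_exponent_le h1 hεκ.le
        linarith
    refine ⟨(∫ ω, |B ω| ^ ε ∂P) * b ^ (-ε), by positivity, fun s => ⟨_,
      hX.assumptionA1.hasSum_tail hA hAX (s - a), ?_⟩⟩
    have hsub : P.real {ω | Real.exp s < |A ω * X ω + B ω|} ≤
        P.real {ω | Real.exp (s - a) < A ω * |X ω|} +
          P.real {ω | b * Real.exp s ≤ |B ω|} := by
      refine (ENNReal.toReal_mono (by finiteness) (measure_mono_ae ?_)).trans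
        (measureReal_union_le _ _)
      filter_upwards [hX.assumptionA1.2.1] with ω hω h1
      change Real.exp s < |A ω * X ω + B ω| at h1
      change Real.exp (s - a) < A ω * |X ω| ∨ b * Real.exp s ≤ |B ω|
      by_contra! hc
      have h2 := abs_add_le (A ω * X ω) (B ω)
      rw [abs_mul, abs_of_nonneg hω] at h2
      have h3 : Real.exp (s - a) + b * Real.exp s = Real.exp s := by
        rw [hb, sub_eq_add_neg s a, Real.exp_add]; ring
      linarith
    have hmark : P.real {ω | b * Real.exp s ≤ |B ω|} ≤
        (∫ ω, |B ω| ^ ε ∂P) * b ^ (-ε) * Real.exp (-(ε * s)) := by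
      have h1 := mul_meas_ge_le_integral_of_nonneg (μ := P) (f := fun ω => |B ω| ^ ε)
        (Eventually.of_forall fun ω => by positivity) hint ((b * Real.exp s) ^ ε)
      have h2 : {ω | (b * Real.exp s) ^ ε ≤ |B ω| ^ ε} = {ω | b * Real.exp s ≤ |B ω|} := by
        ext ω
        exact Real.rpow_le_rpow_iff (by positivity) (abs_nonneg _) hε
      rw [h2] at h1
      have h3 : (b * Real.exp s) ^ ε * (b ^ (-ε) * Real.exp (-(ε * s))) = 1 := by
        rw [Real.mul_rpow hb0.le (Real.exp_pos _).le, ← Real.exp_mul, mul_mul_mul_comm,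
          ← Real.rpow_add hb0, ← Real.exp_add]
        simp [mul_comm]
      have h4 := mul_le_mul_of_nonneg_right h1
        (by positivity : 0 ≤ b ^ (-ε) * Real.exp (-(ε * s)))
      rw [mul_right_comm, h3, one_mul, ← mul_assoc] at h4
      exact h4
    have := hX.measureReal_preimage (S := {x | Real.exp s < |x|})
      (measurableSet_lt (by fun_prop) (by fun_prop))
    change P.real {ω | Real.exp s < |A ω * X ω + B ω|} = P.real {ω | Real.exp s < |X ω|} at this
    linarith

end IsPerpetuity

theorem abs_rpow_sub_rpow_le_of_le_one {κ x y b : ℝ} (hκ : 0 < κ) (hκ1 : κ ≤ 1) (hx : 0 ≤ x)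
    (hy : 0 ≤ y) (hxy : |x - y| ≤ b) : |x ^ κ - y ^ κ| ≤ b ^ κ := by
  wlog h : y ≤ x generalizing x y
  · rw [abs_sub_comm]
    exact this hy hx (by rwa [abs_sub_comm]) (le_of_not_ge h)
  rw [abs_of_nonneg (sub_nonneg.2 h)] at hxy
  rw [abs_of_nonneg (sub_nonneg.2 (Real.rpow_le_rpow hy h hκ.le))]
  have h1 := Real.rpow_add_le_add_rpow hy (sub_nonneg.2 h) hκ.le hκ1
  have h2 := Real.rpow_le_rpow (sub_nonneg.2 h) hxy hκ.le
  rw [add_sub_cancel] at h1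
  linarith

theorem add_rpow_le_two_rpow_mul {p x y : ℝ} (hp : 0 ≤ p) (hx : 0 ≤ x) (hy : 0 ≤ y) :
    (x + y) ^ p ≤ 2 ^ p * (x ^ p + y ^ p) := by
  have h1 : x + y ≤ 2 * max x y := by linarith [le_max_left x y, le_max_right x y]
  refine (Real.rpow_le_rpow (by positivity) h1 hp).trans ?_
  rw [Real.mul_rpow (by norm_num) (by positivity)]
  refine mul_le_mul_of_nonneg_left ?_ (by positivity)
  have hx' : 0 ≤ x ^ p := by positivity
  have hy' : 0 ≤ y ^ p := by positivity
  rcases max_choice x y with h | h <;> rw [h] <;> linarith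

theorem abs_rpow_sub_rpow_le_of_one_lt {κ x y b : ℝ} (hκ : 1 < κ) (hx : 0 ≤ x)
    (hy : 0 ≤ y) (hxy : |x - y| ≤ b) :
    |x ^ κ - y ^ κ| ≤ κ * b * (2 ^ (κ - 1) * (y ^ (κ - 1) + b ^ (κ - 1))) := by
  have hb : 0 ≤ b := (abs_nonneg _).trans hxy
  have key {x y : ℝ} (hx : 0 ≤ x) (hy : 0 ≤ y) (h : y ≤ x) (hxy : x - y ≤ b) :
      x ^ κ - y ^ κ ≤ κ * b * x ^ (κ - 1) := by
    rcases hx.eq_or_lt with h0 | h0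
    · have : y = 0 := le_antisymm (h0 ▸ h) hy
      rw [this, ← h0, sub_self]
      positivity
    · have h1 := one_add_mul_self_le_rpow_one_add (s := y / x - 1)
        (by have : 0 ≤ y / x := by positivity
            linarith) hκ.le
      rw [add_sub_cancel, Real.div_rpow hy hx, le_div_iff₀ (by positivity)] at h1
      have h2 : x ^ κ = x ^ (κ - 1) * x := by
        rw [← Real.rpow_add_one h0.ne', sub_add_cancel]
      have h3 : (1 + κ * (y / x - 1)) * x ^ κ = x ^ κ - κ * (x - y) * x ^ (κ - 1) := by
        rw [h2]; field_simp; ring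
      rw [h3] at h1
      have h4 : κ * (x - y) * x ^ (κ - 1) ≤ κ * b * x ^ (κ - 1) := by gcongr
      linarith
  have hmono {z : ℝ} (hz : 0 ≤ z) (hzy : z ≤ y + b) : κ * b * z ^ (κ - 1) ≤
      κ * b * (2 ^ (κ - 1) * (y ^ (κ - 1) + b ^ (κ - 1))) := by
    refine mul_le_mul_of_nonneg_left ?_ (by positivity)
    exact (Real.rpow_le_rpow hz hzy (by linarith)).trans
      (add_rpow_le_two_rpow_mul (by linarith) hy hb)
  rcases le_total y x with h | h
  · rw [abs_of_nonneg (sub_nonneg.2 h)] at hxy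
    rw [abs_of_nonneg (sub_nonneg.2 (Real.rpow_le_rpow hy h (by linarith)))]
    exact (key hx hy h hxy).trans (hmono hx (by linarith))
  · rw [abs_sub_comm, abs_of_nonneg (sub_nonneg.2 h)] at hxy
    rw [abs_sub_comm, abs_of_nonneg (sub_nonneg.2 (Real.rpow_le_rpow hx h (by linarith)))]
    exact (key hy hx h hxy).trans (hmono hy (by linarith))

namespace IsPerpetuity

variable {Ω : Type*} [MeasurableSpace Ω] {P : Measure Ω} {A B X : Ω → ℝ} {κ h : ℝ}

theorem integrable_abs_rpow [IsProbabilityMeasure P] (hX : IsPerpetuity P A B X κ h)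
    {p : ℝ} (hp : 0 < p) (hpκ : p < κ) : Integrable (fun ω => |X ω| ^ p) P := by
  have hXm := hX.measurable_X
  refine ⟨(hXm.abs.pow_const p).aestronglyMeasurable, ?_⟩
  rw [hasFiniteIntegral_iff_ofReal (Eventually.of_forall fun ω => by positivity),
    lintegral_rpow_eq_lintegral_meas_lt_mul P (Eventually.of_forall fun ω => abs_nonneg (X ω))
      hXm.abs.aemeasurable hp]
  refine ENNReal.mul_lt_top ENNReal.ofReal_lt_top ?_
  set ε : ℝ := (p + κ) / 2 with hε
  obtain ⟨C, hC0, hC⟩ := hX.exists_measureReal_le_mul_exp (ε := ε) (by linarith) (by linarith)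
  have hCt {t : ℝ} (ht : 0 < t) : P {ω | t < |X ω|} ≤ ENNReal.ofReal (C * t ^ (-ε)) := by
    have := hC (Real.log t)
    rw [Real.exp_log ht, show -(ε * Real.log t) = Real.log t * -ε by ring,
      ← Real.rpow_def_of_pos ht] at this
    rw [← ofReal_measureReal]
    exact ENNReal.ofReal_le_ofReal this
  rw [← Set.Ioc_union_Ioi_eq_Ioi zero_le_one, lintegral_union measurableSet_Ioi
    (Set.Ioc_disjoint_Ioi le_rfl)]
  refine ENNReal.add_lt_top.2 ⟨?_, ?_⟩
  · have h1 : IntegrableOn (fun t : ℝ => t ^ (p - 1)) (Set.Ioc 0 1) := by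
      have := intervalIntegral.intervalIntegrable_rpow' (a := 0) (b := 1) (r := p - 1) (by linarith)
      rwa [intervalIntegrable_iff_integrableOn_Ioc_of_le zero_le_one] at this
    refine lt_of_le_of_lt (lintegral_mono fun t => ?_) h1.lintegral_lt_top
    exact mul_le_of_le_one_left' prob_le_one
  · have h1 : IntegrableOn (fun t : ℝ => C * t ^ (p - 1 - ε)) (Set.Ioi 1) :=
      (integrableOn_Ioi_rpow_of_lt (by linarith) zero_lt_one).const_mul C
    refine lt_of_le_of_lt (setLIntegral_mono' measurableSet_Ioi fun t ht => ?_)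
      h1.lintegral_lt_top
    have ht0 : 0 < t := zero_lt_one.trans ht
    refine (mul_le_mul_left (hCt ht0) _).trans_eq ?_
    rw [← ENNReal.ofReal_mul (by positivity), mul_assoc, ← Real.rpow_add ht0]
    congr 3
    ring

theorem integrable_rpow_A (hX : IsPerpetuity P A B X κ h) :
    Integrable (fun ω => A ω ^ κ) P := by
  by_contra hc
  have := hX.assumptionA1.2.2.1
  rw [integral_undef hc] at this
  norm_num at this

theorem integrable_rpow_sub_rpow [IsProbabilityMeasure P] (hX : IsPerpetuity P A B X κ h) :
    Integrable (fun ω => |max (A ω * X ω + B ω) 0 ^ κ - max (A ω * X ω) 0 ^ κ|) P := by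
  have hA := hX.measurable_A
  have hB := hX.measurable_B
  have hXm := hX.measurable_X
  have hκ := hX.assumptionA1.1
  have hm : AEStronglyMeasurable
      (fun ω => |max (A ω * X ω + B ω) 0 ^ κ - max (A ω * X ω) 0 ^ κ|) P := by
    refine Measurable.aestronglyMeasurable (Measurable.abs (Measurable.sub ?_ ?_))
    · exact (((hA.mul hXm).add hB).max measurable_const).pow_const κ
    · exact ((hA.mul hXm).max measurable_const).pow_const κ
  have hdiff (ω : Ω) : |max (A ω * X ω + B ω) 0 - max (A ω * X ω) 0| ≤ |B ω| := by
    refine (abs_max_sub_max_le_abs _ _ _).trans ?_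
    simp
  rcases le_or_gt κ 1 with hκ1 | hκ1
  · refine hX.integrable_abs_rpow_B.mono' hm (Eventually.of_forall fun ω => ?_)
    rw [Real.norm_of_nonneg (abs_nonneg _)]
    exact abs_rpow_sub_rpow_le_of_le_one hκ hκ1 (le_max_right _ _) (le_max_right _ _) (hdiff ω)
  · have hκ0 : 0 < κ - 1 := by linarith
    have hBB (b : ℝ) : |b| * |b| ^ (κ - 1) = |b| ^ κ := by
      rcases (abs_nonneg b).eq_or_lt with h0 | h0
      · rw [← h0, zero_mul, Real.zero_rpow hκ.ne']
      · rw [mul_comm, ← Real.rpow_add_one h0.ne', sub_add_cancel]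
    have hBA : Integrable (fun ω => |B ω| * |A ω| ^ (κ - 1)) P := by
      refine (hX.integrable_abs_rpow_B.add hX.integrable_rpow_A).mono'
        (hB.abs.mul (hA.abs.pow_const _)).aestronglyMeasurable ?_
      filter_upwards [hX.assumptionA1.2.1] with ω hω
      rw [Real.norm_of_nonneg (by positivity)]
      change _ ≤ |B ω| ^ κ + A ω ^ κ
      have h1 : 0 ≤ |B ω| ^ κ := by positivity
      have h2 : 0 ≤ A ω ^ κ := by positivity
      rcases le_total (|B ω|) (|A ω|) with h | h
      · have : |B ω| * |A ω| ^ (κ - 1) ≤ |A ω| * |A ω| ^ (κ - 1) := by gcongr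
        rw [hBB, abs_of_nonneg hω] at this
        rw [abs_of_nonneg hω]
        linarith
      · have : |B ω| * |A ω| ^ (κ - 1) ≤ |B ω| * |B ω| ^ (κ - 1) := by gcongr
        rw [hBB] at this
        linarith
    have hBAX : Integrable (fun ω => |B ω| * |A ω| ^ (κ - 1) * |X ω| ^ (κ - 1)) P := by
      have hind : IndepFun (fun ω => |B ω| * |A ω| ^ (κ - 1)) (fun ω => |X ω| ^ (κ - 1)) P :=
        hX.indepFun.comp (φ := fun x : ℝ × ℝ => |x.2| * |x.1| ^ (κ - 1))
          (ψ := fun x : ℝ => |x| ^ (κ - 1))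
          (measurable_snd.abs.mul (measurable_fst.abs.pow_const _))
          (measurable_id.abs.pow_const _)
      exact hind.integrable_mul hBA (hX.integrable_abs_rpow hκ0 (by linarith))
    refine ((hBAX.add hX.integrable_abs_rpow_B).const_mul (κ * 2 ^ (κ - 1))).mono' hm
      (Eventually.of_forall fun ω => ?_)
    rw [Real.norm_of_nonneg (abs_nonneg _)]
    refine (abs_rpow_sub_rpow_le_of_one_lt hκ1 (le_max_right _ _) (le_max_right _ _)
      (hdiff ω)).trans ?_
    change _ ≤ κ * 2 ^ (κ - 1) * (|B ω| * |A ω| ^ (κ - 1) * |X ω| ^ (κ - 1) + |B ω| ^ κ)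
    have h1 : max (A ω * X ω) 0 ^ (κ - 1) ≤ |A ω| ^ (κ - 1) * |X ω| ^ (κ - 1) := by
      rw [← Real.mul_rpow (abs_nonneg _) (abs_nonneg _), ← abs_mul]
      exact Real.rpow_le_rpow (le_max_right _ _) (max_le (le_abs_self _) (abs_nonneg _)) hκ0.le
    calc κ * |B ω| * (2 ^ (κ - 1) * (max (A ω * X ω) 0 ^ (κ - 1) + |B ω| ^ (κ - 1)))
        ≤ κ * |B ω| * (2 ^ (κ - 1) * (|A ω| ^ (κ - 1) * |X ω| ^ (κ - 1) + |B ω| ^ (κ - 1))) := by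
          gcongr
      _ = _ := by
          rw [← hBB]; ring

end IsPerpetuity

theorem lintegral_exp_indicator {κ : ℝ} (hκ : 0 < κ) (u : ℝ) :
    ∫⁻ t in {t : ℝ | Real.exp t < u}, ENNReal.ofReal (Real.exp (κ * t)) =
      ENNReal.ofReal (max u 0 ^ κ / κ) := by
  rcases le_or_gt u 0 with hu | hu
  · have : {t : ℝ | Real.exp t < u} = ∅ :=
      Set.eq_empty_of_forall_notMem fun t (ht : Real.exp t < u) =>
        absurd ht (hu.trans (Real.exp_pos t).le).not_gt
    rw [this, max_eq_right hu, Real.zero_rpow hκ.ne']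
    simp
  · have : {t : ℝ | Real.exp t < u} = Set.Iio (Real.log u) := by
      ext t
      exact (Real.lt_log_iff_exp_lt hu).symm
    rw [this, setLIntegral_congr Iio_ae_eq_Iic,
      ← ofReal_integral_eq_lintegral_ofReal (integrableOn_exp_mul_Iic hκ _)
        (Eventually.of_forall fun t => (Real.exp_pos _).le), integral_exp_mul_Iic hκ,
      max_eq_left hu.le, Real.rpow_def_of_pos hu, mul_comm κ]

theorem lintegral_exp_between_le {κ : ℝ} (hκ : 0 < κ) (u v : ℝ) :
    ∫⁻ t in {t : ℝ | Real.exp t < u ∧ v ≤ Real.exp t}, ENNReal.ofReal (Real.exp (κ * t)) ≤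
      ENNReal.ofReal (|max u 0 ^ κ - max v 0 ^ κ| / κ) := by
  rcases le_total u v with huv | huv
  · have : {t : ℝ | Real.exp t < u ∧ v ≤ Real.exp t} = ∅ :=
      Set.eq_empty_of_forall_notMem fun t ht => absurd (ht.1.trans_le huv) ht.2.not_gt
    rw [this]
    simp
  · have hm (w : ℝ) : MeasurableSet {t : ℝ | Real.exp t < w} :=
      measurableSet_lt (by fun_prop) (by fun_prop)
    have h1 : {t : ℝ | Real.exp t < u ∧ v ≤ Real.exp t} ∪ {t : ℝ | Real.exp t < v} =
        {t : ℝ | Real.exp t < u} := by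
      ext t
      change (Real.exp t < u ∧ v ≤ Real.exp t) ∨ Real.exp t < v ↔ Real.exp t < u
      constructor
      · rintro (h | h)
        · exact h.1
        · exact h.trans_le huv
      · intro h
        rcases le_or_gt v (Real.exp t) with h' | h'
        · exact Or.inl ⟨h, h'⟩
        · exact Or.inr h'
    have h2 := lintegral_union (μ := volume) (f := fun t => ENNReal.ofReal (Real.exp (κ * t)))
      (hm v) (A := {t : ℝ | Real.exp t < u ∧ v ≤ Real.exp t})
      (Set.disjoint_left.2 fun t ht h' => absurd h' ht.2.not_gt)
    rw [h1, lintegral_exp_indicator hκ, lintegral_exp_indicator hκ] at h2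
    have h3 : max v 0 ^ κ ≤ max u 0 ^ κ :=
      Real.rpow_le_rpow (le_max_right _ _) (max_le_max_right 0 huv) hκ.le
    rw [abs_of_nonneg (sub_nonneg.2 h3), sub_div,
      ENNReal.ofReal_sub _ (by positivity), h2, ENNReal.add_sub_cancel_right ENNReal.ofReal_ne_top]

theorem measurableSet_exp_between {Ω : Type*} [MeasurableSpace Ω] {U V : Ω → ℝ}
    (hU : Measurable U) (hV : Measurable V) :
    MeasurableSet {x : ℝ × Ω | Real.exp x.1 < U x.2 ∧ V x.2 ≤ Real.exp x.1} :=
  (measurableSet_lt (f := fun x : ℝ × Ω => Real.exp x.1) (g := fun x => U x.2)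
    (by fun_prop) (by fun_prop)).inter
    (measurableSet_le (f := fun x : ℝ × Ω => V x.2) (g := fun x => Real.exp x.1)
      (by fun_prop) (by fun_prop))

theorem lintegral_exp_mul_measure_lt_top {Ω : Type*} [MeasurableSpace Ω] {P : Measure Ω}
    [SFinite P] {U V : Ω → ℝ} (hU : Measurable U) (hV : Measurable V) {κ : ℝ} (hκ : 0 < κ)
    (hUV : Integrable (fun ω => |max (U ω) 0 ^ κ - max (V ω) 0 ^ κ|) P) :
    ∫⁻ t : ℝ, ENNReal.ofReal (Real.exp (κ * t)) * P {ω | Real.exp t < U ω ∧ V ω ≤ Real.exp t}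
      < ⊤ := by
  set S : Set (ℝ × Ω) := {x | Real.exp x.1 < U x.2 ∧ V x.2 ≤ Real.exp x.1} with hS
  have hSm : MeasurableSet S := measurableSet_exp_between hU hV
  set f : ℝ × Ω → ENNReal := S.indicator fun x => ENNReal.ofReal (Real.exp (κ * x.1)) with hf
  have hfm : Measurable f := Measurable.indicator (by fun_prop) hSm
  have h1 (t : ℝ) : ENNReal.ofReal (Real.exp (κ * t)) *
      P {ω | Real.exp t < U ω ∧ V ω ≤ Real.exp t} = ∫⁻ ω, f (t, ω) ∂P := by
    have : (fun ω => f (t, ω)) = {ω | Real.exp t < U ω ∧ V ω ≤ Real.exp t}.indicator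
        fun _ => ENNReal.ofReal (Real.exp (κ * t)) := by
      ext ω
      rfl
    have hm : MeasurableSet {ω | Real.exp t < U ω ∧ V ω ≤ Real.exp t} :=
      measurable_prodMk_left (x := t) hSm
    rw [this, lintegral_indicator hm, setLIntegral_const]
  have h2 (ω : Ω) : ∫⁻ t, f (t, ω) ≤
      ENNReal.ofReal (|max (U ω) 0 ^ κ - max (V ω) 0 ^ κ| / κ) := by
    have : (fun t => f (t, ω)) = {t | Real.exp t < U ω ∧ V ω ≤ Real.exp t}.indicator
        fun t => ENNReal.ofReal (Real.exp (κ * t)) := by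
      ext t
      rfl
    have hm : MeasurableSet {t | Real.exp t < U ω ∧ V ω ≤ Real.exp t} :=
      measurable_prodMk_right (y := ω) hSm
    rw [this, lintegral_indicator hm]
    exact lintegral_exp_between_le hκ _ _
  simp only [h1]
  rw [lintegral_lintegral_swap (f := fun t ω => f (t, ω)) hfm.aemeasurable]
  exact (lintegral_mono h2).trans_lt (hUV.div_const κ).lintegral_lt_top

/-- An integrable function on `ℝ` is summable along almost every translate of `h ℤ`. -/
theorem exists_mem_Ioo_tsum_lt_top {f : ℝ → ENNReal} (hf : Measurable f) (hf' : ∫⁻ t, f t < ⊤)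
    {h : ℝ} (hh : 0 < h) {a b : ℝ} (hab : a < b) :
    ∃ s ∈ Set.Ioo a b, ∑' n : ℤ, f (s + n * h) < ⊤ := by
  have h1 := (isAddFundamentalDomain_Ioc hh a).lintegral_eq_tsum'' f
  have h2 : ∫⁻ s in Set.Ioc a (a + h), ∑' n : ℤ, f (s + n * h) = ∫⁻ t, f t := by
    rw [h1, lintegral_tsum fun n => by fun_prop]
    let e : ℤ ≃ AddSubgroup.zmultiples h := Equiv.ofBijective
      (fun n => ⟨n • h, n, rfl⟩) ⟨fun m n hmn => ?_, fun ⟨x, n, hn⟩ => ⟨n, Subtype.ext hn⟩⟩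
    · rw [← e.tsum_eq]
      refine tsum_congr fun n => lintegral_congr fun s => congrArg f ?_
      change s + n * h = n • h + s
      rw [zsmul_eq_mul, add_comm]
    · have h3 : m • h = n • h := congrArg Subtype.val hmn
      rw [zsmul_eq_mul, zsmul_eq_mul] at h3
      exact_mod_cast mul_right_cancel₀ hh.ne' h3
  have h3 : ∀ᵐ s ∂volume.restrict (Set.Ioc a (a + h)), ∑' n : ℤ, f (s + n * h) < ⊤ := by
    refine ae_lt_top (by fun_prop) ?_
    rw [h2]
    exact hf'.ne
  rw [ae_restrict_iff' measurableSet_Ioc] at h3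
  by_contra! hc
  have h4 : volume (Set.Ioo a (min b (a + h))) = 0 := by
    refine measure_eq_zero_iff_ae_notMem.2 ?_
    filter_upwards [h3] with s hs hs'
    have h5 := lt_min_iff.1 hs'.2
    exact absurd (hs ⟨hs'.1, h5.2.le⟩) (hc s ⟨hs'.1, h5.1⟩).not_gt
  rw [Real.volume_Ioo, ENNReal.ofReal_eq_zero] at h4
  have := lt_min hab (lt_add_of_pos_right a hh)
  linarith

namespace IsPerpetuity

variable {Ω : Type*} [MeasurableSpace Ω] {P : Measure Ω} {A B X : Ω → ℝ} {κ h : ℝ}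

theorem exists_mem_Ioo_summable [IsProbabilityMeasure P] (hX : IsPerpetuity P A B X κ h)
    {a b : ℝ} (hab : a < b) :
    ∃ s ∈ Set.Ioo a b, Summable fun n : ℤ => |Real.exp (κ * (s + n * h)) *
      (P.real {ω | Real.exp (s + n * h) < X ω} -
        P.real {ω | Real.exp (s + n * h) < A ω * X ω})| := by
  have hA := hX.measurable_A
  have hB := hX.measurable_B
  have hXm := hX.measurable_X
  have hκ := hX.assumptionA1.1
  have hh : 0 < h := hX.assumptionA1.2.2.2.2.1
  set U : Ω → ℝ := fun ω => A ω * X ω + B ω with hU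
  set V : Ω → ℝ := fun ω => A ω * X ω with hV
  have hUm : Measurable U := by fun_prop
  have hVm : Measurable V := by fun_prop
  have hUV : Integrable (fun ω => |max (U ω) 0 ^ κ - max (V ω) 0 ^ κ|) P :=
    hX.integrable_rpow_sub_rpow
  have hVU : Integrable (fun ω => |max (V ω) 0 ^ κ - max (U ω) 0 ^ κ|) P := by
    simpa only [abs_sub_comm] using hUV
  have hmeas {U V : Ω → ℝ} (hU : Measurable U) (hV : Measurable V) :
      Measurable fun t : ℝ => ENNReal.ofReal (Real.exp (κ * t)) *
        P {ω | Real.exp t < U ω ∧ V ω ≤ Real.exp t} := by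
    refine Measurable.mul (by fun_prop) ?_
    exact measurable_measure_prodMk_left (ν := P)
      (s := {x : ℝ × Ω | Real.exp x.1 < U x.2 ∧ V x.2 ≤ Real.exp x.1})
      (measurableSet_exp_between hU hV)
  have h1 := lintegral_exp_mul_measure_lt_top hUm hVm hκ hUV
  have h2 := lintegral_exp_mul_measure_lt_top hVm hUm hκ hVU
  obtain ⟨s, hs, hlt⟩ := exists_mem_Ioo_tsum_lt_top ((hmeas hUm hVm).add (hmeas hVm hUm))
    (by
      simp only [Pi.add_apply]
      rw [lintegral_add_left (hmeas hUm hVm)]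
      exact ENNReal.add_lt_top.2 ⟨h1, h2⟩) hh hab
  refine ⟨s, hs, ?_⟩
  refine Summable.of_nonneg_of_le (fun n => abs_nonneg _) (fun n => ?_)
    (ENNReal.summable_toReal hlt.ne)
  set t : ℝ := s + n * h
  have hpre := hX.measureReal_preimage (S := Set.Ioi (Real.exp t)) measurableSet_Ioi
  change P.real {ω | Real.exp t < U ω} = P.real {ω | Real.exp t < X ω} at hpre
  rw [← hpre, abs_mul, abs_of_pos (Real.exp_pos _)]
  have h3 : ((fun t : ℝ => ENNReal.ofReal (Real.exp (κ * t)) *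
        P {ω | Real.exp t < U ω ∧ V ω ≤ Real.exp t}) t +
      (fun t : ℝ => ENNReal.ofReal (Real.exp (κ * t)) *
        P {ω | Real.exp t < V ω ∧ U ω ≤ Real.exp t}) t).toReal =
      Real.exp (κ * t) * (P.real {ω | Real.exp t < U ω ∧ V ω ≤ Real.exp t} +
        P.real {ω | Real.exp t < V ω ∧ U ω ≤ Real.exp t}) := by
    rw [ENNReal.toReal_add (by finiteness) (by finiteness), ENNReal.toReal_mul,
      ENNReal.toReal_mul, ENNReal.toReal_ofReal (Real.exp_pos _).le, ← mul_add]
    rfl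
  rw [Pi.add_apply, h3]
  refine mul_le_mul_of_nonneg_left ?_ (Real.exp_pos _).le
  have key (U V : Ω → ℝ) : P.real {ω | Real.exp t < U ω} ≤ P.real {ω | Real.exp t < V ω} +
      P.real {ω | Real.exp t < U ω ∧ V ω ≤ Real.exp t} := by
    refine (measureReal_mono fun ω hω => ?_).trans (measureReal_union_le _ _)
    rcases lt_or_ge (Real.exp t) (V ω) with h | h
    · exact Or.inl h
    · exact Or.inr ⟨hω, h⟩
  have h4 := key U V
  have h5 := key V U
  have h6 : 0 ≤ P.real {ω | Real.exp t < U ω ∧ V ω ≤ Real.exp t} := measureReal_nonneg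
  have h7 : 0 ≤ P.real {ω | Real.exp t < V ω ∧ U ω ≤ Real.exp t} := measureReal_nonneg
  rw [abs_le]
  constructor <;> linarith

/-- Convergence of the normalized right tail along a dense set of translates of `h ℤ`. -/
theorem exists_mem_Ioo_tendsto [IsProbabilityMeasure P] (hX : IsPerpetuity P A B X κ h)
    {a b : ℝ} (hab : a < b) :
    ∃ s ∈ Set.Ioo a b, ∃ L, Tendsto (fun n : ℤ => Real.exp (κ * (s + n * h)) *
      P.real {ω | Real.exp (s + n * h) < X ω}) atTop (𝓝 L) := by
  obtain ⟨s, hs, hsum⟩ := hX.exists_mem_Ioo_summable hab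
  have hκ := hX.assumptionA1.1
  have hA := hX.measurable_A
  refine ⟨s, hs, (hX.assumptionA1.isLatticeStep hA).exists_tendsto_of_renewal (half_pos hκ)
    (half_lt_self hκ) hsum (fun n => ?_) fun η hη => ?_⟩
  · have hAX : IndepFun A X P :=
      hX.indepFun.comp (φ := Prod.fst) (ψ := fun x : ℝ => x) (by fun_prop) (by fun_prop)
    have h1 := (hX.assumptionA1.hasSum_tail hA hAX (s + n * h)).mul_left
      (Real.exp (κ * (s + n * h)))
    have h2 : Real.exp (κ * (s + n * h)) * P.real {ω | Real.exp (s + n * h) < X ω} -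
        Real.exp (κ * (s + n * h)) * (P.real {ω | Real.exp (s + n * h) < X ω} -
          P.real {ω | Real.exp (s + n * h) < A ω * X ω}) =
        Real.exp (κ * (s + n * h)) * P.real {ω | Real.exp (s + n * h) < A ω * X ω} := by ring
    rw [h2]
    refine h1.congr_fun fun k => ?_
    have h3 : Real.exp (κ * (s + n * h)) =
        Real.exp (κ * (k * h)) * Real.exp (κ * (s + ((n - k : ℤ) : ℝ) * h)) := by
      rw [← Real.exp_add]; congr 1; push_cast; ring
    have h4 : s + n * h - k * h = s + ((n - k : ℤ) : ℝ) * h := by push_cast; ring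
    rw [h3, h4]; ring
  · obtain ⟨C, hC0, hC⟩ := hX.exists_measureReal_le_mul_exp (half_pos hκ) (half_lt_self hκ)
    refine ⟨C * Real.exp (κ / 2 * s), fun n => ?_⟩
    have h1 : P.real {ω | Real.exp (s + n * h) < X ω} ≤
        C * Real.exp (-(κ / 2 * (s + n * h))) :=
      (measureReal_mono fun ω (hω : Real.exp (s + n * h) < X ω) =>
        hω.trans_le (le_abs_self _)).trans (hC (s + n * h))
    rw [abs_of_nonneg (by positivity)]
    have h2 := mul_le_mul_of_nonneg_left h1 (Real.exp_pos (κ * (s + n * h))).le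
    have h3 : Real.exp (κ * (s + n * h)) * (C * Real.exp (-(κ / 2 * (s + n * h)))) =
        C * Real.exp (κ / 2 * s) * Real.exp (κ / 2 * (n * h)) := by
      rw [mul_left_comm, mul_assoc, ← Real.exp_add, ← Real.exp_add]; congr 2; ring
    have h4 : 0 ≤ η * (1 + Real.exp (κ * (n * h))) := by positivity
    linarith

end IsPerpetuity

open scoped Pointwise in
/-- If the normalized tails `exp (κ n h) T (x exp (n h))` converge for a dense set of `x > 0`,
then they converge at all continuity points of a log-periodic limit. -/
theorem exists_memQ_of_dense {κ h : ℝ} {T : ℝ → ℝ} (hT : Antitone T)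
    (hT0 : ∀ x, 0 ≤ T x) (hdense : ∀ a b : ℝ, 0 < a → a < b → ∃ y, a < y ∧ y < b ∧ ∃ L,
      Tendsto (fun n : ℕ => Real.exp (κ * (n * h)) * T (y * Real.exp (n * h))) atTop (𝓝 L)) :
    ∃ q, MemQ κ h q ∧ ∀ x, 0 < x → ContinuousAt q x →
      Tendsto (fun n : ℕ => x ^ κ * Real.exp (κ * (n * h)) * T (x * Real.exp (n * h))) atTop
        (𝓝 (q x)) := by
  set F : ℕ → ℝ → ℝ := fun n x => Real.exp (κ * (n * h)) * T (x * Real.exp (n * h)) with hF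
  have hF0 (n : ℕ) (x : ℝ) : 0 ≤ F n x := mul_nonneg (Real.exp_pos _).le (hT0 _)
  have hFanti (n : ℕ) : Antitone (F n) := fun x y hxy =>
    mul_le_mul_of_nonneg_left (hT (by gcongr)) (Real.exp_pos _).le
  have hLanti {y z L M : ℝ} (hyz : y ≤ z) (hL : Tendsto (fun n => F n y) atTop (𝓝 L))
      (hM : Tendsto (fun n => F n z) atTop (𝓝 M)) : M ≤ L :=
    le_of_tendsto_of_tendsto' hM hL fun n => hFanti n hyz
  have hshift (n : ℕ) (x : ℝ) : F n (x * Real.exp h) = Real.exp (-(κ * h)) * F (n + 1) x := by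
    have h1 : x * Real.exp h * Real.exp (n * h) = x * Real.exp ((n + 1 : ℕ) * h) := by
      rw [mul_assoc, ← Real.exp_add]; congr 2; push_cast; ring
    have h2 : Real.exp (κ * (n * h)) =
        Real.exp (-(κ * h)) * Real.exp (κ * ((n + 1 : ℕ) * h)) := by
      rw [← Real.exp_add]; congr 1; push_cast; ring
    simp only [hF]
    rw [h1, h2, mul_assoc]
  set S : ℝ → Set ℝ := fun x => {L | ∃ y, x < y ∧ Tendsto (fun n => F n y) atTop (𝓝 L)} with hS
  set Q : ℝ → ℝ := fun x => sSup (S x) with hQ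
  have hSne {x : ℝ} (hx : 0 < x) : (S x).Nonempty := by
    obtain ⟨y, hy, -, L, hL⟩ := hdense x (x + 1) hx (by linarith)
    exact ⟨L, y, hy, hL⟩
  have hle {x y L : ℝ} (hyx : y ≤ x) (hL : Tendsto (fun n => F n y) atTop (𝓝 L)) :
      ∀ M ∈ S x, M ≤ L := fun M ⟨z, hz, hM⟩ => hLanti (hyx.trans hz.le) hL hM
  have hSbdd {x : ℝ} (hx : 0 < x) : BddAbove (S x) := by
    obtain ⟨y, -, hy, L, hL⟩ := hdense (x / 2) x (by linarith) (by linarith)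
    exact ⟨L, hle hy.le hL⟩
  have hQle {x y L : ℝ} (hx : 0 < x) (hyx : y ≤ x)
      (hL : Tendsto (fun n => F n y) atTop (𝓝 L)) : Q x ≤ L := csSup_le (hSne hx) (hle hyx hL)
  have hleQ {x y L : ℝ} (hx : 0 < x) (hxy : x < y)
      (hL : Tendsto (fun n => F n y) atTop (𝓝 L)) : L ≤ Q x := le_csSup (hSbdd hx) ⟨y, hxy, hL⟩
  have hQ0 {x : ℝ} (hx : 0 < x) : 0 ≤ Q x := by
    obtain ⟨L, y, hy, hL⟩ := hSne hx
    exact (ge_of_tendsto' hL fun n => hF0 n y).trans (hleQ hx hy hL)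
  have hQanti {x y : ℝ} (hx : 0 < x) (hxy : x ≤ y) : Q y ≤ Q x :=
    csSup_le_csSup (hSbdd hx) (hSne (hx.trans_le hxy))
      fun L ⟨z, hz, hL⟩ => ⟨z, hxy.trans_lt hz, hL⟩
  have hQper (x : ℝ) : Q (x * Real.exp h) = Real.exp (-(κ * h)) * Q x := by
    have hSS : S (x * Real.exp h) = Real.exp (-(κ * h)) • S x := by
      ext L
      rw [Set.mem_smul_set]
      constructor
      · rintro ⟨y, hy, hL⟩
        have hy' : y = y * Real.exp (-h) * Real.exp h := by
          rw [mul_assoc, ← Real.exp_add]; simp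
        refine ⟨Real.exp (κ * h) * L, ⟨y * Real.exp (-h), ?_, ?_⟩, ?_⟩
        · rw [hy'] at hy
          exact lt_of_mul_lt_mul_right hy (Real.exp_pos _).le
        · rw [hy'] at hL
          simp only [hshift] at hL
          have := hL.const_mul (Real.exp (κ * h))
          simp only [← mul_assoc, ← Real.exp_add, add_neg_cancel, Real.exp_zero, one_mul] at this
          exact (tendsto_add_atTop_iff_nat (f := fun n => F n (y * Real.exp (-h))) 1).1 this
        · rw [smul_eq_mul, ← mul_assoc, ← Real.exp_add]; simp
      · rintro ⟨M, ⟨y, hy, hM⟩, rfl⟩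
        refine ⟨y * Real.exp h, mul_lt_mul_of_pos_right hy (Real.exp_pos _), ?_⟩
        simp only [hshift]
        exact ((tendsto_add_atTop_iff_nat (f := fun n => F n y) 1).2 hM).const_mul _
    rw [hQ]
    simp only
    rw [hSS, Real.sSup_smul_of_nonneg (Real.exp_pos _).le, smul_eq_mul]
  have hcancel {x : ℝ} (hx : 0 < x) : x ^ (-κ) * x ^ κ = 1 := by
    rw [← Real.rpow_add hx]; simp
  refine ⟨fun x => x ^ κ * Q x, ⟨fun x hx => mul_nonneg (by positivity) (hQ0 hx),
    fun x (hx : 0 < x) y (hy : 0 < y) hxy => ?_, fun x hx => ?_⟩, fun x hx hcont => ?_⟩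
  · change y ^ (-κ) * (y ^ κ * Q y) ≤ x ^ (-κ) * (x ^ κ * Q x)
    rw [← mul_assoc, ← mul_assoc, hcancel hx, hcancel hy, one_mul, one_mul]
    exact hQanti hx hxy
  · change (x * Real.exp h) ^ κ * Q (x * Real.exp h) = x ^ κ * Q x
    rw [hQper, Real.mul_rpow hx.le (Real.exp_pos _).le, ← Real.exp_mul, mul_mul_mul_comm,
      ← mul_assoc, mul_assoc (x ^ κ), mul_comm h, ← Real.exp_add]
    simp
  · have hQc : ContinuousAt Q x := by
      have h1 : ContinuousAt (fun y : ℝ => y ^ (-κ) * (y ^ κ * Q y)) x :=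
        (Real.continuousAt_rpow_const x (-κ) (Or.inl hx.ne')).mul hcont
      refine h1.congr ?_
      filter_upwards [lt_mem_nhds hx] with y hy
      rw [← mul_assoc, hcancel hy, one_mul]
    have hlim : Tendsto (fun n => F n x) atTop (𝓝 (Q x)) := by
      refine tendsto_order.2 ⟨fun a ha => ?_, fun a ha => ?_⟩
      · obtain ⟨x', hx', hxx'⟩ := (((hQc.eventually (lt_mem_nhds ha)).filter_mono
          nhdsWithin_le_nhds).and (self_mem_nhdsWithin (s := Set.Ioi x))).exists
        obtain ⟨z, hz, hz', L, hL⟩ := hdense x x' hx hxx'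
        filter_upwards [hL.eventually (lt_mem_nhds
          (hx'.trans_le (hQle (hx.trans hxx') hz'.le hL)))] with n hn
        exact hn.trans_le (hFanti n hz.le)
      · obtain ⟨x', ⟨hx', hx0⟩, hxx'⟩ := ((((hQc.eventually (gt_mem_nhds ha)).and
          (lt_mem_nhds hx)).filter_mono nhdsWithin_le_nhds).and
            (self_mem_nhdsWithin (s := Set.Iio x))).exists
        obtain ⟨z, hz, hz', L, hL⟩ := hdense x' x hx0 hxx'
        filter_upwards [hL.eventually (gt_mem_nhds ((hleQ hx0 hz hL).trans_lt hx'))] with n hn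
        exact (hFanti n hz'.le).trans_lt hn
    simpa only [hF, mul_assoc] using hlim.const_mul (x ^ κ)

namespace IsPerpetuity

variable {Ω : Type*} [MeasurableSpace Ω] {P : Measure Ω} {A B X : Ω → ℝ} {κ h : ℝ}

theorem exists_memQ [IsProbabilityMeasure P] (hX : IsPerpetuity P A B X κ h) :
    ∃ q, MemQ κ h q ∧ ∀ x, 0 < x → ContinuousAt q x →
      Tendsto (fun n : ℕ => x ^ κ * Real.exp (κ * (n * h)) *
        P.real {ω | x * Real.exp (n * h) < X ω}) atTop (𝓝 (q x)) := by
  refine exists_memQ_of_dense (T := fun x => P.real {ω | x < X ω})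
    (fun x y hxy => measureReal_mono fun ω (hω : y < X ω) => hxy.trans_lt hω)
    (fun x => measureReal_nonneg) fun a b ha hab => ?_
  obtain ⟨s, ⟨hs1, hs2⟩, L, hL⟩ := hX.exists_mem_Ioo_tendsto (Real.log_lt_log ha hab)
  refine ⟨Real.exp s, (Real.log_lt_iff_lt_exp ha).1 hs1,
    (Real.lt_log_iff_exp_lt (ha.trans hab)).1 hs2, Real.exp (-(κ * s)) * L, ?_⟩
  have := (hL.comp tendsto_natCast_atTop_atTop).const_mul (Real.exp (-(κ * s)))
  refine this.congr fun n => ?_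
  simp only [Function.comp, Int.cast_natCast]
  rw [← mul_assoc, ← Real.exp_add, ← Real.exp_add]
  congr 2
  ring

end IsPerpetuity

theorem exists_measure_le_pos_of_not_const {Ω : Type*} [MeasurableSpace Ω] {P : Measure Ω}
    [NeZero P] {X : Ω → ℝ} (hX : ∀ c, ¬ ∀ᵐ ω ∂P, X ω = c) :
    ∃ a b, a < b ∧ P {ω | X ω ≤ a} ≠ 0 ∧ P {ω | b ≤ X ω} ≠ 0 := by
  obtain ⟨x, hx1, hx2⟩ : ∃ x, P {ω | X ω < x} ≠ 0 ∧ P {ω | x < X ω} ≠ 0 := by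
    by_contra! hc
    have h1 : ∀ᵐ ω ∂P, ∀ q : ℚ, (P {ω | X ω < q} = 0 → (q : ℝ) ≤ X ω) ∧
        (P {ω | X ω < q} ≠ 0 → X ω ≤ q) := by
      refine ae_all_iff.2 fun q => ?_
      by_cases hq : P {ω | X ω < q} = 0
      · filter_upwards [measure_eq_zero_iff_ae_notMem.1 hq] with ω hω
        exact ⟨fun _ => not_lt.1 hω, fun h => absurd hq h⟩
      · filter_upwards [measure_eq_zero_iff_ae_notMem.1 (hc q hq)] with ω hω
        exact ⟨fun h => absurd h hq, fun _ => not_lt.1 hω⟩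
    obtain ⟨ω₀, h₀⟩ := h1.exists
    refine hX (X ω₀) ?_
    have key {ω ω' : Ω} (hω : ∀ q : ℚ, (P {ω | X ω < q} = 0 → (q : ℝ) ≤ X ω) ∧
        (P {ω | X ω < q} ≠ 0 → X ω ≤ q)) (hω' : ∀ q : ℚ, (P {ω | X ω < q} = 0 → (q : ℝ) ≤ X ω') ∧
        (P {ω | X ω < q} ≠ 0 → X ω' ≤ q)) : X ω' ≤ X ω := by
      by_contra! hlt
      obtain ⟨q, hq1, hq2⟩ := exists_rat_btwn hlt
      exact absurd hq2 ((hω' q).2 fun h => absurd hq1 ((hω q).1 h).not_gt).not_gt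
    filter_upwards [h1] with ω hω
    exact le_antisymm (key h₀ hω) (key hω h₀)
  obtain ⟨n, hn⟩ : ∃ n : ℕ, P {ω | X ω ≤ x - 1 / (n + 1)} ≠ 0 := by
    by_contra! hc
    refine hx1 (measure_mono_null (fun ω (hω : X ω < x) => ?_) (measure_iUnion_null hc))
    obtain ⟨n, hn⟩ := exists_nat_one_div_lt (sub_pos.2 hω)
    exact Set.mem_iUnion.2 ⟨n, (by linarith : X ω ≤ x - 1 / (n + 1))⟩
  refine ⟨x - 1 / (n + 1), x, ?_, hn, fun h => hx2 (measure_mono_null (fun ω hω => ?_) h)⟩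
  swap
  · exact (show x < X ω from hω).le
  have : (0 : ℝ) < 1 / (n + 1) := by positivity
  linarith

/-- The infimum over translates of the two-sided tail of `X`. -/
def infTail {Ω : Type*} [MeasurableSpace Ω] (P : Measure Ω) (X : Ω → ℝ) (s : ℝ) : ℝ :=
  ⨅ b : ℝ, P.real {ω | Real.exp s < |X ω + b|}

theorem infTail_nonneg {Ω : Type*} [MeasurableSpace Ω] (P : Measure Ω) (X : Ω → ℝ) (s : ℝ) :
    0 ≤ infTail P X s :=
  le_ciInf fun _ => measureReal_nonneg

theorem infTail_le {Ω : Type*} [MeasurableSpace Ω] (P : Measure Ω) (X : Ω → ℝ) (s b : ℝ) :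
    infTail P X s ≤ P.real {ω | Real.exp s < |X ω + b|} :=
  ciInf_le (f := fun b : ℝ => P.real {ω | Real.exp s < |X ω + b|})
    ⟨0, Set.forall_mem_range.2 fun _ => measureReal_nonneg⟩ b

theorem exists_infTail_pos {Ω : Type*} [MeasurableSpace Ω] {P : Measure Ω}
    [IsProbabilityMeasure P] {X : Ω → ℝ} (hX : ∀ c, ¬ ∀ᵐ ω ∂P, X ω = c) :
    ∃ s, 0 < infTail P X s := by
  obtain ⟨a, b, hab, ha, hb⟩ := exists_measure_le_pos_of_not_const hX
  have ha' : 0 < P.real {ω | X ω ≤ a} := ENNReal.toReal_pos ha (by finiteness)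
  have hb' : 0 < P.real {ω | b ≤ X ω} := ENNReal.toReal_pos hb (by finiteness)
  refine ⟨Real.log ((b - a) / 4), (lt_min ha' hb').trans_le (le_ciInf fun β => ?_)⟩
  rw [Real.exp_log (by linarith)]
  rcases le_total (-β) ((a + b) / 2) with hβ | hβ
  · refine (min_le_right _ _).trans (measureReal_mono fun ω (hω : b ≤ X ω) => ?_)
    exact lt_of_lt_of_le (by linarith) (le_abs_self (X ω + β))
  · refine (min_le_left _ _).trans (measureReal_mono fun ω (hω : X ω ≤ a) => ?_)
    exact lt_of_lt_of_le (by linarith) (neg_le_abs (X ω + β))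

namespace IsPerpetuity

variable {Ω : Type*} [MeasurableSpace Ω] {P : Measure Ω} {A B X : Ω → ℝ} {κ h : ℝ}

theorem not_const [IsProbabilityMeasure P] (hX : IsPerpetuity P A B X κ h)
    (hnd : ∀ x : ℝ, P {ω | A ω * x + B ω = x} < 1) (c : ℝ) : ¬ ∀ᵐ ω ∂P, X ω = c := by
  intro hc
  have hA := hX.measurable_A
  have hB := hX.measurable_B
  have hXm := hX.measurable_X
  have h1 : ∀ᵐ x ∂P.map X, x = c :=
    (ae_map_iff hXm.aemeasurable (measurableSet_singleton c)).2 hc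
  rw [hX.map_eq] at h1
  have h1' := (ae_map_iff (p := fun x => x = c)
    (by fun_prop : AEMeasurable (fun ω => A ω * X ω + B ω) P) (measurableSet_singleton c)).1 h1
  refine (hnd c).ne ((mem_ae_iff_prob_eq_one ?_).1 ?_)
  · exact measurableSet_eq_fun (by fun_prop) (by fun_prop)
  · filter_upwards [h1', hc] with ω h2 h3
    rwa [h3] at h2

theorem latticeMass_mul_infTail_le [IsProbabilityMeasure P] (hX : IsPerpetuity P A B X κ h)
    (s b : ℝ) (k : ℤ) :
    latticeMass P A h k * infTail P X (s - k * h) ≤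
      P.real ({ω | A ω = Real.exp (k * h)} ∩ {ω | Real.exp s < |A ω * X ω + B ω + b|}) := by
  have hA := hX.measurable_A
  have hB := hX.measurable_B
  have hXm := hX.measurable_X
  set W : Ω → ℝ × ℝ := fun ω => (A ω, B ω) with hW
  have hWm : Measurable W := by fun_prop
  have hprod := (indepFun_iff_map_prod_eq_prod_map_map hWm.aemeasurable hXm.aemeasurable).1
    hX.indepFun
  set R : Set ((ℝ × ℝ) × ℝ) :=
    {x | x.1.1 = Real.exp (k * h)} ∩ {x | Real.exp s < |x.1.1 * x.2 + x.1.2 + b|} with hR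
  have hS : MeasurableSet {w : ℝ × ℝ | w.1 = Real.exp (k * h)} :=
    measurable_fst (measurableSet_singleton _)
  have hRm : MeasurableSet R :=
    MeasurableSet.inter (measurable_fst hS) (measurableSet_lt (by fun_prop) (by fun_prop))
  have h1 : P ({ω | A ω = Real.exp (k * h)} ∩ {ω | Real.exp s < |A ω * X ω + B ω + b|}) =
      ∫⁻ w, P.map X (Prod.mk w ⁻¹' R) ∂(P.map W) := by
    rw [← Measure.prod_apply hRm, ← hprod, Measure.map_apply (by fun_prop) hRm]
    rfl
  have h2 : ENNReal.ofReal (infTail P X (s - k * h)) * P.map W {w | w.1 = Real.exp (k * h)} ≤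
      ∫⁻ w, P.map X (Prod.mk w ⁻¹' R) ∂(P.map W) := by
    rw [← setLIntegral_const]
    refine (setLIntegral_mono' hS fun w (hw : w.1 = _) => ?_).trans
      (setLIntegral_le_lintegral _ _)
    rw [Measure.map_apply hXm (measurable_prodMk_left hRm), ← ofReal_measureReal]
    refine ENNReal.ofReal_le_ofReal ((infTail_le P X _ ((w.2 + b) / w.1)).trans
      (measureReal_mono fun ω (hω : Real.exp (s - k * h) < |X ω + (w.2 + b) / w.1|) => ⟨hw, ?_⟩))
    have hw0 : 0 < w.1 := hw ▸ Real.exp_pos _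
    change Real.exp s < |w.1 * X ω + w.2 + b|
    have h3 : w.1 * X ω + w.2 + b = w.1 * (X ω + (w.2 + b) / w.1) := by field_simp; ring
    rw [h3, abs_mul, abs_of_pos hw0]
    rw [Real.exp_sub, ← hw, div_lt_iff₀' hw0] at hω
    exact hω
  rw [← h1, Measure.map_apply hWm hS] at h2
  have h3 := ENNReal.toReal_mono (by finiteness) h2
  rw [ENNReal.toReal_mul, ENNReal.toReal_ofReal (infTail_nonneg _ _ _), mul_comm] at h3
  exact h3

theorem sum_latticeMass_mul_infTail_le [IsProbabilityMeasure P] (hX : IsPerpetuity P A B X κ h)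
    {s t : ℝ} (ht : HasSum (fun k : ℤ => latticeMass P A h k * infTail P X (s - k * h)) t) :
    t ≤ infTail P X s := by
  refine le_ciInf fun b => ?_
  have hh : 0 < h := hX.assumptionA1.2.2.2.2.1
  refine (hasSum_le (hX.latticeMass_mul_infTail_le s b) ht
    (hasSum_measureReal_inter_lattice hX.measurable_A hh _)).trans ?_
  refine (measureReal_mono Set.inter_subset_right).trans_eq ?_
  exact hX.measureReal_preimage (S := {x | Real.exp s < |x + b|})
    (measurableSet_lt (by fun_prop) (by fun_prop))

/-- A nondegenerate perpetuity has tails of order at least `exp (-κ s)`. -/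
theorem not_tendsto_zero [IsProbabilityMeasure P] (hX : IsPerpetuity P A B X κ h)
    (hnd : ∀ x : ℝ, P {ω | A ω * x + B ω = x} < 1)
    (htail : ∀ y > 0, Tendsto (fun n : ℕ => Real.exp (κ * (n * h)) *
      P.real {ω | y * Real.exp (n * h) < |X ω|}) atTop (𝓝 0)) : False := by
  obtain ⟨s, hs⟩ := exists_infTail_pos (hX.not_const hnd)
  have hκ := hX.assumptionA1.1
  have hh : 0 < h := hX.assumptionA1.2.2.2.2.1
  have H := hX.assumptionA1.isLatticeStep hX.measurable_A
  set r : ℤ → ℝ := fun n => Real.exp (κ * (n * h)) * infTail P X (s + n * h) with hr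
  have hr0 (n : ℤ) : 0 ≤ r n := mul_nonneg (Real.exp_pos _).le (infTail_nonneg _ _ _)
  have hle (t : ℝ) : infTail P X t ≤ P.real {ω | Real.exp t < |X ω|} := by
    simpa using infTail_le P X t 0
  obtain ⟨C, hC0, hC⟩ := hX.exists_measureReal_le_mul_exp (half_pos hκ) (half_lt_self hκ)
  have hrC (n : ℤ) : r n ≤ C * Real.exp (-(κ / 2 * s)) * Real.exp (κ / 2 * (n * h)) := by
    refine (mul_le_mul_of_nonneg_left ((hle _).trans (hC _)) (Real.exp_pos _).le).trans_eq ?_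
    rw [mul_left_comm, mul_assoc, ← Real.exp_add, ← Real.exp_add]
    congr 2; ring
  have hexp : Tendsto (fun n : ℤ => κ / 2 * (n * h)) atBot atBot :=
    ((tendsto_intCast_atBot_iff (R := ℝ)).2 tendsto_id |>.atBot_mul_const hh).const_mul_atBot (half_pos hκ)
  have hbot : Tendsto r atBot (𝓝 0) := by
    refine squeeze_zero hr0 hrC ?_
    simpa using (Real.tendsto_exp_atBot.comp hexp).const_mul (C * Real.exp (-(κ / 2 * s)))
  have htop : Tendsto r atTop (𝓝 0) := by
    rw [← Nat.map_cast_int_atTop, tendsto_map'_iff]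
    refine squeeze_zero (fun n => hr0 n) (fun n => ?_) (htail (Real.exp s) (Real.exp_pos s))
    refine mul_le_mul_of_nonneg_left ?_ (Real.exp_pos _).le
    rw [← Real.exp_add]
    exact hle _
  obtain ⟨N, hN⟩ := eventually_atTop.1 (htop.eventually (ge_mem_nhds zero_lt_one))
  have hrB (n : ℤ) : |r n| ≤ max 1 (Real.exp (κ * (N * h))) := by
    rw [abs_of_nonneg (hr0 n)]
    rcases le_total N n with h1 | h1
    · exact (hN n h1).trans (le_max_left _ _)
    · refine le_trans ?_ (le_max_right _ _)
      have h2 : r n ≤ Real.exp (κ * (n * h)) :=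
        mul_le_of_le_one_right (Real.exp_pos _).le ((hle _).trans measureReal_le_one)
      refine h2.trans (Real.exp_le_exp.2 ?_)
      have : (n : ℝ) ≤ N := by exact_mod_cast h1
      gcongr
  have hsum (n : ℤ) : Summable fun k : ℤ =>
      latticeMass P A h k * Real.exp (κ * (k * h)) * r (n - k) := by
    refine Summable.of_norm_bounded
      (H.hasSum_one.summable.mul_right (max 1 (Real.exp (κ * (N * h))))) fun k => ?_
    rw [norm_mul, Real.norm_of_nonneg (mul_nonneg (H.nonneg k) (Real.exp_pos _).le)]
    exact mul_le_mul_of_nonneg_left (hrB _) (mul_nonneg (H.nonneg k) (Real.exp_pos _).le)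
  have hsuper (n : ℤ) : ∑' k : ℤ, latticeMass P A h k * Real.exp (κ * (k * h)) * r (n - k) ≤
      r n := by
    have h1 := (hsum n).hasSum.mul_left (Real.exp (-(κ * (n * h))))
    have h2 := hX.sum_latticeMass_mul_infTail_le (s := s + n * h) (h1.congr_fun fun k => ?_)
    · have h3 := mul_le_mul_of_nonneg_left h2 (Real.exp_pos (κ * (n * h))).le
      rw [← mul_assoc, ← Real.exp_add, add_neg_cancel, Real.exp_zero, one_mul] at h3
      exact h3
    · simp only [hr]
      have h3 : s + n * h - k * h = s + ((n - k : ℤ) : ℝ) * h := by push_cast; ring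
      have h4 : Real.exp (-(κ * (n * h))) * Real.exp (κ * (k * h)) *
          Real.exp (κ * (((n - k : ℤ) : ℝ) * h)) = 1 := by
        rw [← Real.exp_add, ← Real.exp_add, Real.exp_eq_one_iff]; push_cast; ring
      rw [h3]
      linear_combination (-latticeMass P A h k *
        infTail P X (s + ((n - k : ℤ) : ℝ) * h)) * h4
  have hzero := H.eq_zero_of_superharmonic
    (g := fun n => r n - ∑' k : ℤ, latticeMass P A h k * Real.exp (κ * (k * h)) * r (n - k))
    (fun n => sub_nonneg.2 (hsuper n)) (fun n => by simpa using (hsum n).hasSum)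
    (half_pos hκ) (half_lt_self hκ) (fun n => by rw [abs_of_nonneg (hr0 n)]; exact hrC n)
    hrB hbot htop 0
  simp only [hr, Int.cast_zero, zero_mul, mul_zero, Real.exp_zero, one_mul, add_zero] at hzero
  exact hs.ne' hzero

end IsPerpetuity

theorem MemQ.eq_zero_of_eq_zero {κ h : ℝ} {q : ℝ → ℝ} (hq : MemQ κ h q) (hh : 0 < h) {x : ℝ}
    (hx : 0 < x) (hqx : q x = 0) {y : ℝ} (hy : 0 < y) : q y = 0 := by
  obtain ⟨hq0, hanti, hper⟩ := hq
  have hz (n : ℕ) : q (x * Real.exp (-(n * h))) = 0 := by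
    induction n with
    | zero => simpa using hqx
    | succ n ih =>
      rw [← hper _ (by positivity), mul_assoc, ← Real.exp_add, ← ih]
      congr 3
      push_cast
      ring
  have hlim : Tendsto (fun n : ℕ => x * Real.exp (-(n * h))) atTop (𝓝 0) := by
    have := (Real.tendsto_exp_neg_atTop_nhds_zero.comp
      (tendsto_natCast_atTop_atTop.atTop_mul_const hh)).const_mul x
    simpa using this
  obtain ⟨n, hn⟩ := (hlim.eventually_lt_const hy).exists
  have hle := hanti (show _ ∈ Set.Ioi (0 : ℝ) from mul_pos hx (Real.exp_pos _))
    (show y ∈ Set.Ioi (0 : ℝ) from hy) hn.le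
  simp only [hz n, mul_zero] at hle
  exact le_antisymm (nonpos_of_mul_nonpos_right hle (Real.rpow_pos_of_pos hy _)) (hq0 y hy)

theorem MemQ.tendsto_zero_of_eq_zero {κ h : ℝ} {q T : ℝ → ℝ} (hq : MemQ κ h q) (hh : 0 < h)
    {x : ℝ} (hx : 0 < x) (hqx : q x = 0)
    (hlim : ∀ x, 0 < x → ContinuousAt q x → Tendsto (fun n : ℕ =>
      x ^ κ * Real.exp (κ * (n * h)) * T (x * Real.exp (n * h))) atTop (𝓝 (q x)))
    {y : ℝ} (hy : 0 < y) :
    Tendsto (fun n : ℕ => Real.exp (κ * (n * h)) * T (y * Real.exp (n * h))) atTop (𝓝 0) := by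
  have hcont : ContinuousAt q y := (continuousAt_const (y := (0 : ℝ))).congr <| by
    filter_upwards [lt_mem_nhds hy] with z hz
    exact (hq.eq_zero_of_eq_zero hh hx hqx hz).symm
  have hpos : 0 < y ^ κ := Real.rpow_pos_of_pos hy κ
  have := (hlim y hy hcont).const_mul (y ^ κ)⁻¹
  rw [hq.eq_zero_of_eq_zero hh hx hqx hy, mul_zero] at this
  refine this.congr fun n => ?_
  rw [mul_assoc (y ^ κ), inv_mul_cancel_left₀ hpos.ne']

/-- Theorem 2 (Grincevičius): perpetuity equation `X =_d AX + B` under (A1) and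
`E|B|^κ < ∞`: tails of the solution, with positivity in the nondegenerate case. -/
theorem stmt4 {Ω : Type*} [MeasurableSpace Ω] (P : Measure Ω) [IsProbabilityMeasure P]
    (A B X : Ω → ℝ) (hAmeas : Measurable A) (hBmeas : Measurable B) (hXmeas : Measurable X)
    (κ h : ℝ) (hA1 : AssumptionA1 P A κ h)
    (hB : (∫⁻ ω, ENNReal.ofReal (|B ω| ^ κ) ∂P) < ⊤)
    (hindep : IndepFun (fun ω => (A ω, B ω)) X P)
    (heq : Measure.map X P = Measure.map (fun ω => A ω * X ω + B ω) P) :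
    ∃ q₁ q₂ : ℝ → ℝ, MemQ κ h q₁ ∧ MemQ κ h q₂ ∧
      (∀ x : ℝ, 0 < x → ContinuousAt q₁ x →
        Tendsto (fun n : ℕ =>
            x ^ κ * Real.exp (κ * (n * h)) * (P {ω | X ω > x * Real.exp (n * h)}).toReal)
          atTop (𝓝 (q₁ x))) ∧
      (∀ x : ℝ, 0 < x → ContinuousAt q₂ x →
        Tendsto (fun n : ℕ =>
            x ^ κ * Real.exp (κ * (n * h)) * (P {ω | X ω < -(x * Real.exp (n * h))}).toReal)
          atTop (𝓝 (q₂ x))) ∧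
      ((∀ x : ℝ, P {ω | A ω * x + B ω = x} < 1) →
        ∀ x : ℝ, 0 < x → 0 < q₁ x + q₂ x) := by
  have hX : IsPerpetuity P A B X κ h := ⟨hAmeas, hBmeas, hXmeas, hA1, hB, hindep, heq⟩
  obtain ⟨q₁, hq₁, hlim₁⟩ := hX.exists_memQ
  obtain ⟨q₂, hq₂, hlim₂⟩ := hX.neg.exists_memQ
  refine ⟨q₁, q₂, hq₁, hq₂, hlim₁, fun x hx hc => ?_, fun hnd x hx => ?_⟩
  · simpa only [measureReal_def, lt_neg] using hlim₂ x hx hc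
  · by_contra! hle
    have h₁ := hq₁.1 x hx
    have h₂ := hq₂.1 x hx
    have hh : 0 < h := hA1.2.2.2.2.1
    refine hX.not_tendsto_zero hnd fun y hy => ?_
    have l₁ := hq₁.tendsto_zero_of_eq_zero (T := fun t => P.real {ω | t < X ω}) hh hx
      (by linarith) hlim₁ hy
    have l₂ := hq₂.tendsto_zero_of_eq_zero (T := fun t => P.real {ω | t < -X ω}) hh hx
      (by linarith) hlim₂ hy
    refine squeeze_zero (fun n => by positivity) (fun n => ?_) (by simpa using l₁.add l₂)
    rw [← mul_add]
    gcongr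
    simp only [lt_abs, Set.ofPred_or]
    exact measureReal_union_le _ _
end
end

section
/- Let (A,B) be a random vector such that A satisfies Assumption (A1) with parameters κ > 0 and h > 0 and E[|B|^κ] < ∞, and let X be a random variable independent of (A,B) whose distribution satisfies the maximum equation X =_d max(AX, B). Then there exists a function q ∈ 𝒬(κ,h) such that for EVERY x > 0, lim_{n→∞} x^κ e^{κnh} P(X > x e^{nh}) = q(x). Moreover, if B ≥ 0 a.s. and P(B > 0) > 0, then q(x) > 0 for all x > 0. -/
open MeasureTheory ProbabilityTheory Filter Topology

noncomputable section

/-- Convolution of two real functions on `ℤ`. -/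
def convZ (p f : ℤ → ℝ) (n : ℤ) : ℝ := ∑' s, p s * f (n - s)

/-- The signed sum of `f` over the `s` points ending at `n`. -/
def windowSum (f : ℤ → ℝ) (n s : ℤ) : ℝ :=
  ∑ j ∈ Finset.Ico 0 s, f (n - j) - ∑ j ∈ Finset.Ico s 0, f (n - j)

/-- The mean window sum of `f` for a random step with weights `p`. -/
def meanWindow (p f : ℤ → ℝ) (n : ℤ) : ℝ := ∑' s, p s * windowSum f n s

lemma abs_windowSum_le {f : ℤ → ℝ} {C : ℝ} (hf : ∀ n, |f n| ≤ C) (n s : ℤ) :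
    |windowSum f n s| ≤ C * |(s : ℝ)| := by
  unfold windowSum
  rcases le_total 0 s with h | h
  · rw [Finset.Ico_eq_empty (not_lt.2 h)]
    have h1 : |∑ j ∈ Finset.Ico 0 s, f (n - j)| ≤ ∑ j ∈ Finset.Ico 0 s, C :=
      (Finset.abs_sum_le_sum_abs _ _).trans (Finset.sum_le_sum fun j _ => hf _)
    have h2 : ((s.toNat : ℤ) : ℝ) = s := by rw [Int.toNat_of_nonneg h]
    have h3 : |(s : ℝ)| = s := abs_of_nonneg (by exact_mod_cast h)
    simp only [Finset.sum_const, Int.card_Ico, sub_zero, nsmul_eq_mul] at h1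
    push_cast at h2
    rw [Finset.sum_empty, sub_zero, h3]
    rw [h2] at h1
    linarith
  · rw [Finset.Ico_eq_empty (not_lt.2 h)]
    have h1 : |∑ j ∈ Finset.Ico s 0, f (n - j)| ≤ ∑ j ∈ Finset.Ico s 0, C :=
      (Finset.abs_sum_le_sum_abs _ _).trans (Finset.sum_le_sum fun j _ => hf _)
    have h2 : (((-s).toNat : ℤ) : ℝ) = -s := by
      rw [Int.toNat_of_nonneg (by omega)]; push_cast; rfl
    have h3 : |(s : ℝ)| = -s := abs_of_nonpos (by exact_mod_cast h)
    simp only [Finset.sum_const, Int.card_Ico, zero_sub, nsmul_eq_mul] at h1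
    push_cast at h2
    rw [Finset.sum_empty, zero_sub, abs_neg, h3]
    rw [h2] at h1
    linarith

lemma windowSum_zero (f : ℤ → ℝ) (n : ℤ) : windowSum f n 0 = 0 := by
  simp [windowSum]

lemma windowSum_add_one (f : ℤ → ℝ) (n s : ℤ) :
    windowSum f n (s + 1) = windowSum f n s + f (n - s) := by
  unfold windowSum
  rcases lt_or_ge s 0 with h | h
  · rw [Finset.Ico_eq_empty (show ¬ 0 < s + 1 by omega),
      Finset.Ico_eq_empty (show ¬ 0 < s by omega), ← Finset.insert_Ico_add_one_left_eq_Ico h,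
      Finset.sum_insert (by simp)]
    ring
  · rw [Finset.Ico_eq_empty (show ¬ s + 1 < 0 by omega),
      Finset.Ico_eq_empty (show ¬ s < 0 by omega), ← Finset.insert_Ico_right_eq_Ico_add_one h,
      Finset.sum_insert (by simp)]
    ring

lemma windowSum_sub_windowSum (f : ℤ → ℝ) (n s : ℤ) :
    windowSum f n s - windowSum f (n - 1) s = f n - f (n - s) := by
  induction s using Int.induction_on with
  | zero => simp [windowSum_zero]
  | succ i ih =>
    rw [windowSum_add_one, windowSum_add_one]
    have : n - (i + 1 : ℤ) = n - 1 - i := by ring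
    rw [this]; linarith
  | pred i ih =>
    have h1 := windowSum_add_one f n (-(i : ℤ) - 1)
    have h2 := windowSum_add_one f (n - 1) (-(i : ℤ) - 1)
    have e1 : n - 1 - (-(i : ℤ) - 1) = n - -(i : ℤ) := by ring
    rw [sub_add_cancel] at h1 h2
    rw [e1] at h2
    linarith

lemma windowSum_const (c : ℝ) (n s : ℤ) : windowSum (fun _ => c) n s = c * s := by
  induction s using Int.induction_on with
  | zero => simp [windowSum_zero]
  | succ i ih => rw [windowSum_add_one, ih]; push_cast; ring
  | pred i ih =>
    have h1 := windowSum_add_one (fun _ => c) n (-(i : ℤ) - 1)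
    rw [sub_add_cancel, ih] at h1
    push_cast at h1 ⊢; linarith

lemma summable_mul_of_abs_le {ι : Type*} {p u : ι → ℝ} {C : ℝ} (hp0 : ∀ s, 0 ≤ p s)
    (hp : Summable p) (hu : ∀ s, |u s| ≤ C) : Summable fun s => p s * u s := by
  refine Summable.of_norm_bounded (g := fun s => p s * C) (hp.mul_right C) fun s => ?_
  rw [Real.norm_eq_abs, abs_mul, abs_of_nonneg (hp0 s)]
  exact mul_le_mul_of_nonneg_left (hu s) (hp0 s)

lemma convZ_mono {p f g : ℤ → ℝ} {C D : ℝ} (hp0 : ∀ s, 0 ≤ p s) (hp : Summable p)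
    (hf : ∀ n, |f n| ≤ C) (hg : ∀ n, |g n| ≤ D) (h : ∀ n, f n ≤ g n) (n : ℤ) :
    convZ p f n ≤ convZ p g n :=
  Summable.tsum_le_tsum (fun s => mul_le_mul_of_nonneg_left (h _) (hp0 s))
    (summable_mul_of_abs_le hp0 hp fun _ => hf _) (summable_mul_of_abs_le hp0 hp fun _ => hg _)

lemma convZ_sub {p f g : ℤ → ℝ} {C D : ℝ} (hp0 : ∀ s, 0 ≤ p s) (hp : Summable p)
    (hf : ∀ n, |f n| ≤ C) (hg : ∀ n, |g n| ≤ D) (n : ℤ) :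
    convZ p (fun i => f i - g i) n = convZ p f n - convZ p g n := by
  unfold convZ
  rw [← (summable_mul_of_abs_le hp0 hp fun _ => hf _).tsum_sub
    (summable_mul_of_abs_le hp0 hp fun _ => hg _)]
  exact tsum_congr fun s => mul_sub _ _ _

lemma tendsto_convZ {α : Type*} {l : Filter α} {p f : ℤ → ℝ} {u : α → ℤ → ℝ} {C : ℝ}
    (hp0 : ∀ s, 0 ≤ p s) (hp : Summable p) (hu : ∀ k n, |u k n| ≤ C)
    (h : ∀ n, Tendsto (fun k => u k n) l (𝓝 (f n))) (n : ℤ) :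
    Tendsto (fun k => convZ p (u k) n) l (𝓝 (convZ p f n)) := by
  refine tendsto_tsum_of_dominated_convergence (bound := fun s => p s * C) (hp.mul_right C)
    (fun s => (h _).const_mul _) (Eventually.of_forall fun k s => ?_)
  rw [Real.norm_eq_abs, abs_mul, abs_of_nonneg (hp0 s)]
  exact mul_le_mul_of_nonneg_left (hu _ _) (hp0 s)

lemma abs_mul_windowSum_le {p f : ℤ → ℝ} {C : ℝ} (hp0 : ∀ s, 0 ≤ p s)
    (hf : ∀ n, |f n| ≤ C) (n s : ℤ) :
    ‖p s * windowSum f n s‖ ≤ C * (|(s : ℝ)| * p s) := by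
  rw [Real.norm_eq_abs, abs_mul, abs_of_nonneg (hp0 s)]
  have := mul_le_mul_of_nonneg_left (abs_windowSum_le hf n s) (hp0 s)
  linarith

lemma tendsto_meanWindow {α : Type*} {l : Filter α} {p f : ℤ → ℝ} {u : α → ℤ → ℝ} {C : ℝ}
    (hp0 : ∀ s, 0 ≤ p s) (hp1 : Summable fun s : ℤ => |(s : ℝ)| * p s)
    (hu : ∀ k n, |u k n| ≤ C)
    (h : ∀ n, Tendsto (fun k => u k n) l (𝓝 (f n))) (n : ℤ) :
    Tendsto (fun k => meanWindow p (u k) n) l (𝓝 (meanWindow p f n)) := by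
  refine tendsto_tsum_of_dominated_convergence (bound := fun s => C * (|(s : ℝ)| * p s))
    (hp1.mul_left C) (fun s => ?_)
    (Eventually.of_forall fun k s => abs_mul_windowSum_le hp0 (hu k) n s)
  exact ((tendsto_finsetSum _ fun j _ => h _).sub
    (tendsto_finsetSum _ fun j _ => h _)).const_mul _

lemma meanWindow_sub_meanWindow {p f : ℤ → ℝ} {C : ℝ} (hp0 : ∀ s, 0 ≤ p s) (hp : HasSum p 1)
    (hp1 : Summable fun s : ℤ => |(s : ℝ)| * p s) (hf : ∀ n, |f n| ≤ C) (n : ℤ) :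
    meanWindow p f n - meanWindow p f (n - 1) = f n - convZ p f n := by
  have hs : ∀ m, Summable fun s => p s * windowSum f m s := fun m =>
    Summable.of_norm_bounded (hp1.mul_left C) fun s => abs_mul_windowSum_le hp0 hf m s
  unfold meanWindow convZ
  rw [← (hs n).tsum_sub (hs _)]
  have h1 : f n = ∑' s, p s * f n := by rw [tsum_mul_right, hp.tsum_eq, one_mul]
  conv_rhs => rw [h1]
  rw [← (hp.summable.mul_right _).tsum_sub
    (summable_mul_of_abs_le hp0 hp.summable fun s => hf (n - s))]
  refine tsum_congr fun s => ?_
  rw [← mul_sub, windowSum_sub_windowSum, mul_sub]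

lemma meanWindow_comp_add (p f : ℤ → ℝ) (n m : ℤ) :
    meanWindow p (fun i => f (n + i)) m = meanWindow p f (n + m) := by
  simp [meanWindow, windowSum, add_sub_assoc]

lemma convZ_comp_add (p f : ℤ → ℝ) (n m : ℤ) :
    convZ p (fun i => f (n + i)) m = convZ p f (n + m) := by
  simp [convZ, add_sub_assoc]

lemma meanWindow_mul_left (p f : ℤ → ℝ) (c : ℝ) (n : ℤ) :
    meanWindow p (fun i => c * f i) n = c * meanWindow p f n := by
  simp only [meanWindow, windowSum, ← Finset.mul_sum, ← mul_sub]
  rw [← tsum_mul_left]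
  exact tsum_congr fun s => by ring

lemma convZ_mul_left (p f : ℤ → ℝ) (c : ℝ) (n : ℤ) :
    convZ p (fun i => c * f i) n = c * convZ p f n := by
  simp only [convZ]
  rw [← tsum_mul_left]
  exact tsum_congr fun s => by ring

lemma meanWindow_const (p : ℤ → ℝ) (c : ℝ) (n : ℤ) :
    meanWindow p (fun _ => c) n = c * ∑' s : ℤ, (s : ℝ) * p s := by
  simp only [meanWindow, windowSum_const]
  rw [← tsum_mul_left]
  exact tsum_congr fun s => by ring

lemma tendsto_meanWindow_atBot {p f : ℤ → ℝ} {C : ℝ} (hp0 : ∀ s, 0 ≤ p s)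
    (hp1 : Summable fun s : ℤ => |(s : ℝ)| * p s) (hf : ∀ n, |f n| ≤ C)
    (h : Tendsto f atBot (𝓝 0)) : Tendsto (meanWindow p f) atBot (𝓝 0) := by
  have := tendsto_meanWindow (l := atBot) (u := fun k i => f (k + i)) (f := fun _ => 0) hp0 hp1
    (fun k i => hf _) (fun n => h.comp (tendsto_atBot_add_const_right _ n tendsto_id)) 0
  simpa [meanWindow_comp_add, meanWindow_const] using this

lemma exists_ultralimit {α : Type*} (𝒰 : Ultrafilter α) {u : α → ℝ} {C : ℝ}
    (hu : ∀ k, |u k| ≤ C) : ∃ l, |l| ≤ C ∧ Tendsto u 𝒰 (𝓝 l) := by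
  obtain ⟨x, hx, h⟩ := (isCompact_Icc (a := -C) (b := C)).ultrafilter_le_nhds' (𝒰.map u)
    (Filter.mem_map.2 (Filter.univ_mem' fun k => abs_le.1 (hu k)))
  exact ⟨x, abs_le.2 hx, h⟩

/-- Maximum principle for subharmonic functions. -/
lemma eq_of_le_convZ {p d : ℤ → ℝ} {C D : ℝ} (hp0 : ∀ s, 0 ≤ p s) (hp : Summable p)
    (hp1 : ∑' s, p s ≤ 1) (hd : ∀ n, |d n| ≤ C) (hD : 0 ≤ D) (hle : ∀ n, d n ≤ D) {m s : ℤ}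
    (hm : d m = D) (hsub : d m ≤ convZ p d m) (hs : p s ≠ 0) : d (m - s) = D := by
  by_contra hne
  have hlt : d (m - s) < D := lt_of_le_of_ne (hle _) hne
  have : convZ p d m < ∑' s, p s * D :=
    Summable.tsum_lt_tsum (i := s) (fun t => mul_le_mul_of_nonneg_left (hle _) (hp0 t))
      (mul_lt_mul_of_pos_left hlt (lt_of_le_of_ne (hp0 s) hs.symm))
      (summable_mul_of_abs_le hp0 hp fun _ => hd _) (hp.mul_right D)
  rw [tsum_mul_right] at this
  nlinarith

lemma le_sub_of_harmonic {p f : ℤ → ℝ} {C : ℝ} (hp0 : ∀ s, 0 ≤ p s) (hp : Summable p)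
    (hp1 : ∑' s, p s ≤ 1) (hf : ∀ n, |f n| ≤ C) (hh : ∀ n, f n = convZ p f n) {s : ℤ}
    (hs : p s ≠ 0) (n : ℤ) : f n ≤ f (n - s) := by
  set d : ℤ → ℝ := fun n => f n - f (n - s) with hd
  have hdb : ∀ n, |d n| ≤ C + C := fun n => (abs_sub _ _).trans (add_le_add (hf _) (hf _))
  have hbdd : BddAbove (Set.range d) :=
    ⟨C + C, by rintro _ ⟨n, rfl⟩; exact (abs_le.1 (hdb n)).2⟩
  set D := ⨆ n, d n with hD
  have hdD : ∀ n, d n ≤ D := fun n => le_ciSup hbdd n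
  suffices D ≤ 0 by have := hdD n; simp only [hd] at this; linarith
  by_contra! hpos
  have hex : ∀ k : ℕ, ∃ n, D - 1 / ((k : ℝ) + 1) < d n := fun k =>
    exists_lt_of_lt_ciSup (sub_lt_self D Nat.one_div_pos_of_nat)
  choose x hx using hex
  choose F hFC hF using fun m : ℤ =>
    exists_ultralimit (hyperfilter ℕ) (u := fun k => f (x k + m)) (C := C) fun k => hf _
  have hFh : ∀ m, F m = convZ p F m := by
    intro m
    have h1 := tendsto_convZ (u := fun k i => f (x k + i)) hp0 hp (fun k i => hf _) hF m
    simp only [convZ_comp_add, ← hh] at h1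
    exact tendsto_nhds_unique (hF m) h1
  set e : ℤ → ℝ := fun m => F m - F (m - s) with he
  have heb : ∀ n, |e n| ≤ C + C := fun n => (abs_sub _ _).trans (add_le_add (hFC _) (hFC _))
  have hlim : ∀ m, Tendsto (fun k => d (x k + m)) (hyperfilter ℕ) (𝓝 (e m)) := fun m => by
    simpa only [hd, add_sub_assoc] using (hF m).sub (hF (m - s))
  have heD : ∀ m, e m ≤ D := fun m => le_of_tendsto (hlim m) (Eventually.of_forall fun k => hdD _)
  have he0 : e 0 = D := by
    refine le_antisymm (heD 0) ?_
    have h2 : Tendsto (fun k : ℕ => D - 1 / ((k : ℝ) + 1)) (hyperfilter ℕ) (𝓝 (D - 0)) :=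
      (tendsto_const_nhds.sub tendsto_one_div_add_atTop_nhds_zero_nat).mono_left
        Nat.hyperfilter_le_atTop
    rw [sub_zero] at h2
    exact le_of_tendsto_of_tendsto h2 (hlim 0)
      (Eventually.of_forall fun k => by simpa using (hx k).le)
  have heh : ∀ m, e m = convZ p e m := by
    intro m
    have h3 : e m = convZ p F m - convZ p F (m - s) := by rw [← hFh, ← hFh]
    rw [h3]
    unfold convZ
    rw [← (summable_mul_of_abs_le hp0 hp fun _ => hFC _).tsum_sub
      (summable_mul_of_abs_le hp0 hp fun _ => hFC _)]
    refine tsum_congr fun t => ?_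
    rw [← mul_sub, he]
    simp only [sub_right_comm]
  have hK : ∀ K : ℕ, e (-(K * s)) = D ∧ F 0 - F (-(K * s)) = K * D := by
    intro K
    induction K with
    | zero => simpa using he0
    | succ K ih =>
      have e1 : -(((K + 1 : ℕ) : ℤ) * s) = -(K * s) - s := by push_cast; ring
      rw [e1]
      refine ⟨eq_of_le_convZ hp0 hp hp1 heb hpos.le heD ih.1 (heh _).le hs, ?_⟩
      have h4 := ih.1
      have h5 := ih.2
      simp only [he] at h4
      push_cast
      linarith
  obtain ⟨K, hKb⟩ := exists_nat_gt ((C + C) / D)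
  rw [div_lt_iff₀ hpos] at hKb
  have h6 := (hK K).2
  have h7 := (abs_le.1 (hFC 0)).2
  have h8 := (abs_le.1 (hFC (-(K * s)))).1
  linarith

/-- Choquet–Deny on `ℤ`: bounded harmonic functions of an aperiodic walk are constant. -/
lemma const_of_harmonic {p f : ℤ → ℝ} {C : ℝ} (hp0 : ∀ s, 0 ≤ p s) (hp : Summable p)
    (hp1 : ∑' s, p s ≤ 1) (hgen : AddSubgroup.closure {s | p s ≠ 0} = ⊤)
    (hf : ∀ n, |f n| ≤ C) (hh : ∀ n, f n = convZ p f n) (m n : ℤ) : f m = f n := by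
  have key : ∀ s : ℤ, ∀ n, f n = f (n - s) := by
    intro s
    have hs : s ∈ AddSubgroup.closure {s | p s ≠ 0} := by rw [hgen]; trivial
    induction hs using AddSubgroup.closure_induction with
    | mem s hs =>
      intro n
      refine le_antisymm (le_sub_of_harmonic hp0 hp hp1 hf hh hs n) ?_
      have h1 := le_sub_of_harmonic (f := fun i => (-1) * f i) hp0 hp hp1 (C := C)
        (fun n => by simpa using hf n)
        (fun n => by rw [convZ_mul_left, ← hh]) hs n
      linarith
    | zero => simp
    | add x y _ _ hx hy => intro n; rw [hx n, hy (n - x), sub_sub]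
    | neg x _ hx => intro n; rw [hx (n - -x)]; congr 1; ring
  rw [key (m - n) m]; congr 1; ring

lemma exists_window_of_closure_eq_top {S : Set ℤ} (hS : AddSubgroup.closure S = ⊤) (L : ℕ) :
    ∃ m : ℤ, ∀ j : ℤ, |j| ≤ L → m + j ∈ AddSubmonoid.closure S := by
  have key : ∀ x ∈ AddSubgroup.closure S, ∃ a ∈ AddSubmonoid.closure S,
      ∃ b ∈ AddSubmonoid.closure S, x = a - b := by
    intro x hx
    induction hx using AddSubgroup.closure_induction with
    | mem x hx => exact ⟨x, AddSubmonoid.subset_closure hx, 0, zero_mem _, by simp⟩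
    | zero => exact ⟨0, zero_mem _, 0, zero_mem _, by simp⟩
    | add x y _ _ hx hy =>
      obtain ⟨a, ha, b, hb, rfl⟩ := hx
      obtain ⟨c, hc, d, hd, rfl⟩ := hy
      exact ⟨a + c, add_mem ha hc, b + d, add_mem hb hd, by ring⟩
    | neg x _ hx =>
      obtain ⟨a, ha, b, hb, rfl⟩ := hx
      exact ⟨b, hb, a, ha, by ring⟩
  obtain ⟨a, ha, b, hb, hab⟩ := key 1 (by rw [hS]; trivial)
  refine ⟨2 * L * b + L, fun j hj => ?_⟩
  obtain ⟨h1, h2⟩ := abs_le.1 hj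
  have e : 2 * L * b + L + j = (L + j).toNat • a + (L - j).toNat • b := by
    rw [nsmul_eq_mul, nsmul_eq_mul, Int.toNat_of_nonneg (by omega),
      Int.toNat_of_nonneg (by omega)]
    have : a = b + 1 := by omega
    subst this; ring
  rw [e]
  exact add_mem (nsmul_mem ha _) (nsmul_mem hb _)

lemma sum_range_comp_sub_le_tsum {ψ : ℤ → ℝ} (hψ0 : ∀ n, 0 ≤ ψ n) (hψ : Summable ψ) (n : ℤ)
    (N : ℕ) : ∑ i ∈ Finset.range N, ψ (n - i) ≤ ∑' j, ψ j := by
  have hinj : Function.Injective fun i : ℕ => n - (i : ℤ) := fun i j h => by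
    simp only at h; omega
  rw [← Finset.sum_image (f := ψ) (fun i _ j _ h => hinj h)]
  exact hψ.sum_le_tsum _ fun _ _ => hψ0 _

lemma le_tsum_of_sub_le {R ψ : ℤ → ℝ} (hψ0 : ∀ n, 0 ≤ ψ n) (hψ : Summable ψ)
    (hR : Tendsto R atBot (𝓝 0)) (hd : ∀ n, R n - R (n - 1) ≤ ψ n) (n : ℤ) :
    R n ≤ ∑' j, ψ j := by
  have h1 : ∀ N : ℕ, R n ≤ R (n - N) + ∑' j, ψ j := by
    intro N
    refine le_trans ?_ (add_le_add_right (sum_range_comp_sub_le_tsum hψ0 hψ n N) _)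
    induction N with
    | zero => simp
    | succ N ih =>
      rw [Finset.sum_range_succ]
      have := hd (n - N)
      have e : n - ((N + 1 : ℕ) : ℤ) = n - N - 1 := by push_cast; ring
      rw [e]; linarith
  have h2 : Tendsto (fun N : ℕ => R (n - N) + ∑' j, ψ j) atTop (𝓝 (0 + ∑' j, ψ j)) := by
    refine Tendsto.add_const _ (hR.comp ?_)
    simp only [sub_eq_add_neg]
    exact tendsto_atBot_add_const_left _ n
      (tendsto_neg_atTop_atBot.comp tendsto_natCast_atTop_atTop)
  rw [zero_add] at h2
  exact ge_of_tendsto h2 (Eventually.of_forall h1)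

/-- Bounded subsolutions of the renewal equation are bounded by a common constant. -/
lemma exists_bound_of_subsolution {p ψ : ℤ → ℝ} (hp0 : ∀ s, 0 ≤ p s) (hp : HasSum p 1)
    (hp1 : Summable fun s : ℤ => |(s : ℝ)| * p s) (hμ : 0 < ∑' s : ℤ, (s : ℝ) * p s)
    (hgen : AddSubgroup.closure {s | p s ≠ 0} = ⊤) (hψ0 : ∀ n, 0 ≤ ψ n) (hψ : Summable ψ) :
    ∃ C : ℝ, ∀ F : ℤ → ℝ, (∀ n, 0 ≤ F n) → BddAbove (Set.range F) → Tendsto F atBot (𝓝 0) →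
      (∀ n, F n ≤ convZ p F n + ψ n) → ∀ n, F n ≤ C := by
  by_contra! hcon
  choose F hF0 hFb hFbot hFsub y hy using fun k : ℕ => hcon k
  set M : ℕ → ℝ := fun k => ⨆ n, F k n with hM
  have hFM : ∀ k n, F k n ≤ M k := fun k n => le_ciSup (hFb k) n
  have hFabs : ∀ k n, |F k n| ≤ M k := fun k n => by
    rw [abs_of_nonneg (hF0 k n)]; exact hFM k n
  have hkM : ∀ k : ℕ, (k : ℝ) < M k := fun k => (hy k).trans_le (hFM k _)
  have hMpos : ∀ k, 0 < M k := fun k => (Nat.cast_nonneg k).trans_lt (hkM k)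
  choose x hx using fun k => exists_lt_of_lt_ciSup (sub_lt_self (M k) one_pos)
  have hMinv : Tendsto (fun k => (M k)⁻¹) (hyperfilter ℕ) (𝓝 0) :=
    (tendsto_inv_atTop_zero.comp (tendsto_atTop_mono (fun k => (hkM k).le)
      tendsto_natCast_atTop_atTop)).mono_left Nat.hyperfilter_le_atTop
  set u : ℕ → ℤ → ℝ := fun k m => (M k)⁻¹ * F k (x k + m) with hu
  have hu0 : ∀ k m, 0 ≤ u k m := fun k m => mul_nonneg (inv_nonneg.2 (hMpos k).le) (hF0 _ _)
  have hu1 : ∀ k m, |u k m| ≤ 1 := fun k m => by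
    rw [abs_of_nonneg (hu0 k m), hu]
    exact inv_mul_le_one_of_le₀ (hFM _ _) (hMpos k).le
  choose f hfb hf using fun m : ℤ =>
    exists_ultralimit (hyperfilter ℕ) (u := fun k => u k m) (C := 1) fun k => hu1 k m
  have hf1 : ∀ m, f m ≤ 1 := fun m => (abs_le.1 (hfb m)).2
  have hf0 : f 0 = 1 := by
    refine le_antisymm (hf1 0) ?_
    have h2 : Tendsto (fun k => 1 - (M k)⁻¹) (hyperfilter ℕ) (𝓝 (1 - 0)) :=
      tendsto_const_nhds.sub hMinv
    rw [sub_zero] at h2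
    refine le_of_tendsto_of_tendsto h2 (hf 0) (Eventually.of_forall fun k => ?_)
    have h3 := mul_le_mul_of_nonneg_left (hx k).le (inv_nonneg.2 (hMpos k).le)
    rw [mul_sub, inv_mul_cancel₀ (hMpos k).ne', mul_one] at h3
    simpa [hu] using h3
  have hfsub : ∀ m, f m ≤ convZ p f m := by
    intro m
    have h1 := tendsto_convZ hp0 hp.summable hu1 hf m
    have h2 : Tendsto (fun k => convZ p (u k) m + (M k)⁻¹ * ∑' j, ψ j) (hyperfilter ℕ)
        (𝓝 (convZ p f m + 0 * ∑' j, ψ j)) := h1.add (hMinv.mul_const _)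
    rw [zero_mul, add_zero] at h2
    refine le_of_tendsto_of_tendsto (hf m) h2 (Eventually.of_forall fun k => ?_)
    simp only [hu]
    rw [convZ_mul_left p (fun i => F k (x k + i)), convZ_comp_add, ← mul_add]
    refine mul_le_mul_of_nonneg_left ((hFsub k _).trans (add_le_add_right ?_ _))
      (inv_nonneg.2 (hMpos k).le)
    exact hψ.le_tsum _ fun _ _ => hψ0 _
  have hR : ∀ m, meanWindow p f m ≤ 0 := by
    intro m
    have h1 := tendsto_meanWindow hp0 hp1 hu1 hf m
    have h2 : Tendsto (fun k => (M k)⁻¹ * ∑' j, ψ j) (hyperfilter ℕ)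
        (𝓝 (0 * ∑' j, ψ j)) := hMinv.mul_const _
    rw [zero_mul] at h2
    refine le_of_tendsto_of_tendsto h1 h2 (Eventually.of_forall fun k => ?_)
    simp only [hu]
    rw [meanWindow_mul_left p (fun i => F k (x k + i)), meanWindow_comp_add]
    refine mul_le_mul_of_nonneg_left ?_ (inv_nonneg.2 (hMpos k).le)
    refine le_tsum_of_sub_le hψ0 hψ (tendsto_meanWindow_atBot hp0 hp1 (hFabs k) (hFbot k))
      (fun n => ?_) _
    rw [meanWindow_sub_meanWindow hp0 hp hp1 (hFabs k)]
    linarith [hFsub k n]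
  have hone : ∀ s ∈ AddSubmonoid.closure {s | p s ≠ 0}, ∀ m, f m = 1 → f (m - s) = 1 := by
    intro s hs
    induction hs using AddSubmonoid.closure_induction with
    | mem s hs =>
      exact fun m hm => eq_of_le_convZ hp0 hp.summable hp.tsum_eq.le hfb zero_le_one hf1 hm
        (hfsub m) hs
    | zero => simp
    | add a b _ _ ha hb => intro m hm; rw [← sub_sub]; exact hb _ (ha _ hm)
  choose w hw using exists_window_of_closure_eq_top hgen
  have hlim : ∀ m : ℤ, Tendsto (fun L => f (-w L + m)) atTop (𝓝 1) := by
    intro m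
    refine tendsto_const_nhds.congr' ?_
    filter_upwards [eventually_ge_atTop m.natAbs] with L hL
    have h1 := hone _ (hw L (-m) (by rw [abs_neg, Int.abs_eq_natAbs]; omega)) 0 hf0
    rw [← h1]; congr 1; ring
  have h1 := tendsto_meanWindow (u := fun L i => f (-w L + i)) hp0 hp1 (fun _ _ => hfb _) hlim 0
  rw [meanWindow_const, one_mul] at h1
  exact absurd (le_of_tendsto h1 (Eventually.of_forall fun L => by
    rw [meanWindow_comp_add]; exact hR _)) (not_le.2 hμ)

/-- Key renewal theorem on `ℤ` for bounded solutions vanishing at `-∞`. -/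
lemma tendsto_of_renewal_equation {p ψ g : ℤ → ℝ} {C : ℝ} (hp0 : ∀ s, 0 ≤ p s)
    (hp : HasSum p 1) (hp1 : Summable fun s : ℤ => |(s : ℝ)| * p s)
    (hμ : 0 < ∑' s : ℤ, (s : ℝ) * p s) (hgen : AddSubgroup.closure {s | p s ≠ 0} = ⊤)
    (hψ0 : ∀ n, 0 ≤ ψ n) (hψ : Summable ψ) (hg0 : ∀ n, 0 ≤ g n) (hgC : ∀ n, g n ≤ C)
    (hgbot : Tendsto g atBot (𝓝 0)) (hg : ∀ n, g n = convZ p g n + ψ n) :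
    ∃ c, 0 ≤ c ∧ Tendsto g atTop (𝓝 c) ∧ (c = 0 → ∀ n, g n = 0) := by
  have hgb : ∀ n, |g n| ≤ C := fun n => by rw [abs_of_nonneg (hg0 n)]; exact hgC n
  set R := meanWindow p g with hR
  set μ := ∑' s : ℤ, (s : ℝ) * p s with hμdef
  have hRd : ∀ n, R n - R (n - 1) = ψ n := fun n => by
    rw [hR, meanWindow_sub_meanWindow hp0 hp hp1 hgb]; linarith [hg n]
  have hRbot : Tendsto R atBot (𝓝 0) := tendsto_meanWindow_atBot hp0 hp1 hgb hgbot
  have hRle : ∀ n, R n ≤ ∑' j, ψ j := le_tsum_of_sub_le hψ0 hψ hRbot fun n => (hRd n).le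
  have hRmono : Monotone R := monotone_int_of_le_succ fun n => by
    have := hRd (n + 1)
    rw [add_sub_cancel_right] at this
    linarith [hψ0 (n + 1)]
  have hRbdd : BddAbove (Set.range R) := ⟨_, by rintro _ ⟨n, rfl⟩; exact hRle n⟩
  have hRtop : Tendsto R atTop (𝓝 (⨆ n, R n)) := tendsto_atTop_ciSup hRmono hRbdd
  have hlim : Tendsto g atTop (𝓝 ((⨆ n, R n) / μ)) := by
    rw [tendsto_iff_ultrafilter]
    intro 𝒰 h𝒰
    choose f hfb hf using fun m : ℤ =>
      exists_ultralimit 𝒰 (u := fun k => g (k + m)) (C := C) fun k => hgb _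
    have hsh : ∀ m : ℤ, Tendsto (fun k : ℤ => k + m) 𝒰 atTop := fun m =>
      (tendsto_atTop_add_const_right _ m tendsto_id).mono_left h𝒰
    have hfh : ∀ m, f m = convZ p f m := by
      intro m
      have h1 := tendsto_convZ (u := fun k i => g (k + i)) hp0 hp.summable (fun _ _ => hgb _) hf m
      have h2 := h1.add ((hψ.tendsto_cofinite_zero.mono_left
        (Int.cofinite_eq ▸ le_sup_right)).comp (hsh m))
      simp only [convZ_comp_add, Function.comp_def, ← hg, add_zero] at h2
      exact tendsto_nhds_unique (hf m) h2
    have hconst : f = fun _ => f 0 :=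
      funext fun m => const_of_harmonic hp0 hp.summable hp.tsum_eq.le hgen hfb hfh m 0
    have h3 := tendsto_meanWindow (u := fun k i => g (k + i)) hp0 hp1 (fun _ _ => hgb _) hf 0
    rw [hconst, meanWindow_const] at h3
    simp only [meanWindow_comp_add] at h3
    have h4 : f 0 * μ = ⨆ n, R n := tendsto_nhds_unique h3 (hRtop.comp (hsh 0))
    rw [← h4, mul_div_cancel_right₀ _ hμ.ne']
    simpa using hf 0
  have hRnn : ∀ n, 0 ≤ R n := fun n => hRmono.le_of_tendsto hRbot n
  refine ⟨_, ge_of_tendsto' hlim hg0, hlim, fun hc n => ?_⟩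
  have hsup : ⨆ n, R n = 0 := by
    rcases div_eq_zero_iff.1 hc with h | h
    · exact h
    · exact absurd h hμ.ne'
  have hR0 : ∀ n, R n = 0 := fun n =>
    le_antisymm ((le_ciSup hRbdd n).trans_eq hsup) (hRnn n)
  have hψz : ∀ n, ψ n = 0 := fun n => by rw [← hRd, hR0, hR0, sub_zero]
  have hconst := const_of_harmonic hp0 hp.summable hp.tsum_eq.le hgen hgb
    (fun n => by have := hg n; rwa [hψz, add_zero] at this)
  have : Tendsto g atBot (𝓝 (g n)) := tendsto_const_nhds.congr fun m => hconst n m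
  exact tendsto_nhds_unique this hgbot

lemma exists_ne_zero_of_closure_eq_top {a : ℤ → ℝ}
    (hgen : AddSubgroup.closure {s | a s ≠ 0} = ⊤) : ∃ s, s ≠ 0 ∧ a s ≠ 0 := by
  by_contra! h
  have h1 : {s | a s ≠ 0} ⊆ {0} := fun s hs => by
    by_contra hne
    exact hs (h s hne)
  have h2 : AddSubgroup.closure {s | a s ≠ 0} ≤ ⊥ :=
    (AddSubgroup.closure_mono h1).trans (by simp)
  rw [hgen] at h2
  have : (1 : ℤ) ∈ (⊥ : AddSubgroup ℤ) := h2 trivial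
  simp at this

/-- The exponentially tilted walk has positive drift. -/
lemma mean_pos_of_tilt {a : ℤ → ℝ} {θ : ℝ} (hθ : 0 < θ) (ha0 : ∀ s, 0 ≤ a s)
    (ha : Summable a) (ha1 : ∑' s, a s ≤ 1)
    (hp : HasSum (fun s : ℤ => Real.exp (θ * s) * a s) 1)
    (hp1 : Summable fun s : ℤ => |(s : ℝ)| * (Real.exp (θ * s) * a s))
    (hgen : AddSubgroup.closure {s | a s ≠ 0} = ⊤) :
    0 < ∑' s : ℤ, (s : ℝ) * (Real.exp (θ * s) * a s) := by
  obtain ⟨i, hi, hai⟩ := exists_ne_zero_of_closure_eq_top hgen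
  have hs : Summable fun s : ℤ => (s : ℝ) * (Real.exp (θ * s) * a s) := by
    refine Summable.of_norm_bounded hp1 fun s => le_of_eq ?_
    rw [Real.norm_eq_abs, abs_mul,
      abs_of_nonneg (mul_nonneg (Real.exp_pos (θ * s)).le (ha0 s))]
  have hexp : ∀ s : ℤ, Real.exp (θ * s) * Real.exp (-(θ * s)) = 1 := fun s => by
    rw [← Real.exp_add, add_neg_cancel, Real.exp_zero]
  have hle : ∀ s : ℤ, Real.exp (θ * s) - 1 ≤ θ * s * Real.exp (θ * s) := fun s => by
    have h1 := mul_le_mul_of_nonneg_left (Real.add_one_le_exp (-(θ * s)))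
      (Real.exp_pos (θ * s)).le
    rw [hexp] at h1
    linarith
  have hlt : Real.exp (θ * i) - 1 < θ * i * Real.exp (θ * i) := by
    have h0 : -(θ * i) ≠ 0 := neg_ne_zero.2 (mul_ne_zero hθ.ne' (by exact_mod_cast hi))
    have h1 := mul_lt_mul_of_pos_left (Real.add_one_lt_exp h0) (Real.exp_pos (θ * i))
    rw [hexp] at h1
    linarith
  have hmain : ∑' s : ℤ, (Real.exp (θ * s) * a s - a s) <
      ∑' s : ℤ, θ * ((s : ℝ) * (Real.exp (θ * s) * a s)) := by
    refine Summable.tsum_lt_tsum (i := i) (fun s => ?_) ?_ (hp.summable.sub ha) (hs.mul_left θ)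
    · have := mul_le_mul_of_nonneg_right (hle s) (ha0 s)
      linarith
    · have := mul_lt_mul_of_pos_right hlt (lt_of_le_of_ne (ha0 i) hai.symm)
      linarith
  rw [hp.summable.tsum_sub ha, hp.tsum_eq, tsum_mul_left] at hmain
  exact pos_of_mul_pos_right (by linarith) hθ.le

lemma tendsto_iterate_convZ {a F : ℤ → ℝ} (ha0 : ∀ s, 0 ≤ a s) (ha : Summable a)
    (ha1 : ∑' s, a s ≤ 1) (hgen : AddSubgroup.closure {s | a s ≠ 0} = ⊤)
    (hF0 : ∀ n, 0 ≤ F n) (hF1 : ∀ n, F n ≤ 1) (hFtop : Tendsto F atTop (𝓝 0))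
    (hF : ∀ n, convZ a F n ≤ F n) :
    (∀ k n, 0 ≤ (convZ a)^[k] F n ∧ (convZ a)^[k] F n ≤ F n) ∧
      (∀ k n, (convZ a)^[k + 1] F n ≤ (convZ a)^[k] F n) ∧
      ∀ n, Tendsto (fun k => (convZ a)^[k] F n) atTop (𝓝 0) := by
  set T : ℕ → ℤ → ℝ := fun k => (convZ a)^[k] F with hT
  have hTs : ∀ k, T (k + 1) = convZ a (T k) := fun k => Function.iterate_succ_apply' _ _ _
  have hFb : ∀ n, |F n| ≤ 1 := fun n => by rw [abs_of_nonneg (hF0 n)]; exact hF1 n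
  have hbd : ∀ k n, 0 ≤ T k n ∧ T k n ≤ F n := by
    intro k
    induction k with
    | zero => exact fun n => ⟨hF0 n, le_rfl⟩
    | succ k ih =>
      intro n
      rw [hTs]
      refine ⟨tsum_nonneg fun s => mul_nonneg (ha0 s) (ih _).1, ?_⟩
      exact (convZ_mono ha0 ha (fun n => by
        rw [abs_of_nonneg (ih n).1]; exact (ih n).2.trans (hF1 n)) hFb (fun n => (ih n).2) n).trans
        (hF n)
  have hTb : ∀ k n, |T k n| ≤ 1 := fun k n => by
    rw [abs_of_nonneg (hbd k n).1]; exact (hbd k n).2.trans (hF1 n)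
  have hstep : ∀ k n, T (k + 1) n ≤ T k n := by
    intro k
    induction k with
    | zero => intro n; rw [hTs]; exact hF n
    | succ k ih =>
      intro n
      conv_lhs => rw [hTs]
      conv_rhs => rw [hTs]
      exact convZ_mono ha0 ha (hTb _) (hTb _) ih n
  set G : ℤ → ℝ := fun n => ⨅ k, T k n with hG
  have hlim : ∀ n, Tendsto (fun k => T k n) atTop (𝓝 (G n)) := fun n =>
    tendsto_atTop_ciInf (antitone_nat_of_succ_le fun k => hstep k n)
      ⟨0, by rintro _ ⟨k, rfl⟩; exact (hbd k n).1⟩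
  have hG0 : ∀ n, 0 ≤ G n := fun n => ge_of_tendsto' (hlim n) fun k => (hbd k n).1
  have hGF : ∀ n, G n ≤ F n := fun n => le_of_tendsto' (hlim n) fun k => (hbd k n).2
  have hGh : ∀ n, G n = convZ a G n := fun n => by
    have h1 := tendsto_convZ ha0 ha hTb hlim n
    simp only [← hTs] at h1
    exact tendsto_nhds_unique ((hlim n).comp (tendsto_add_atTop_nat 1)) h1
  have hGb : ∀ n, |G n| ≤ 1 := fun n => by
    rw [abs_of_nonneg (hG0 n)]; exact (hGF n).trans (hF1 n)
  have hGtop : Tendsto G atTop (𝓝 0) := squeeze_zero hG0 hGF hFtop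
  refine ⟨hbd, hstep, fun n => ?_⟩
  have h2 : Tendsto G atTop (𝓝 (G n)) := tendsto_const_nhds.congr fun m =>
    const_of_harmonic ha0 ha ha1 hgen hGb hGh n m
  rw [← tendsto_nhds_unique h2 hGtop]
  exact hlim n

lemma convZ_exp_mul (a F : ℤ → ℝ) (θ : ℝ) (n : ℤ) :
    convZ (fun s => Real.exp (θ * s) * a s) (fun s => Real.exp (θ * s) * F s) n =
      Real.exp (θ * n) * convZ a F n := by
  simp only [convZ]
  rw [← tsum_mul_left]
  refine tsum_congr fun s => ?_
  have : Real.exp (θ * n) = Real.exp (θ * s) * Real.exp (θ * ((n - s : ℤ) : ℝ)) := by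
    rw [← Real.exp_add]; push_cast; ring_nf
  rw [this]; ring

/-- Implicit renewal theorem on `ℤ`. -/
lemma tendsto_exp_mul_of_renewal {a F b : ℤ → ℝ} {θ : ℝ} (hθ : 0 < θ) (ha0 : ∀ s, 0 ≤ a s)
    (ha : Summable a) (ha1 : ∑' s, a s ≤ 1)
    (hp : HasSum (fun s : ℤ => Real.exp (θ * s) * a s) 1)
    (hp1 : Summable fun s : ℤ => |(s : ℝ)| * (Real.exp (θ * s) * a s))
    (hgen : AddSubgroup.closure {s | a s ≠ 0} = ⊤)
    (hF0 : ∀ n, 0 ≤ F n) (hF1 : ∀ n, F n ≤ 1) (hFtop : Tendsto F atTop (𝓝 0))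
    (hb0 : ∀ n, 0 ≤ b n) (hF : ∀ n, F n = convZ a F n + b n)
    (hb : Summable fun n : ℤ => Real.exp (θ * n) * b n) :
    ∃ c, 0 ≤ c ∧ Tendsto (fun n : ℤ => Real.exp (θ * n) * F n) atTop (𝓝 c) ∧
      (c = 0 → ∀ n, F n = 0) := by
  set p : ℤ → ℝ := fun s => Real.exp (θ * s) * a s with hpdef
  set ψ : ℤ → ℝ := fun s => Real.exp (θ * s) * b s with hψdef
  set g : ℤ → ℝ := fun s => Real.exp (θ * s) * F s with hgdef
  have hp0 : ∀ s, 0 ≤ p s := fun s => mul_nonneg (Real.exp_pos _).le (ha0 s)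
  have hψ0 : ∀ s, 0 ≤ ψ s := fun s => mul_nonneg (Real.exp_pos _).le (hb0 s)
  have hg0 : ∀ s, 0 ≤ g s := fun s => mul_nonneg (Real.exp_pos _).le (hF0 s)
  have hμ := mean_pos_of_tilt hθ ha0 ha ha1 hp hp1 hgen
  have hpgen : AddSubgroup.closure {s | p s ≠ 0} = ⊤ := by
    simpa [hpdef, Real.exp_ne_zero] using hgen
  have hgbot : Tendsto g atBot (𝓝 0) := by
    refine squeeze_zero hg0 (fun n => mul_le_of_le_one_right (Real.exp_pos _).le (hF1 n)) ?_
    exact Real.tendsto_exp_atBot.comp (((tendsto_const_mul_atBot_of_pos hθ).2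
      (tendsto_intCast_atBot_iff.2 tendsto_id)))
  have hg : ∀ n, g n = convZ p g n + ψ n := fun n => by
    rw [convZ_exp_mul, ← mul_add, ← hF]
  obtain ⟨hT, hTstep, hTlim⟩ := tendsto_iterate_convZ ha0 ha ha1 hgen hF0 hF1 hFtop
    (fun n => by linarith [hF n, hb0 n])
  set G : ℕ → ℤ → ℝ := fun k n => g n - Real.exp (θ * n) * (convZ a)^[k] F n with hG
  have hGlim : ∀ n, Tendsto (fun k => G k n) atTop (𝓝 (g n)) := fun n => by
    simpa using ((hTlim n).const_mul (Real.exp (θ * n))).const_sub (g n)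
  have hG0 : ∀ k n, 0 ≤ G k n := fun k n =>
    sub_nonneg.2 (mul_le_mul_of_nonneg_left (hT k n).2 (Real.exp_pos _).le)
  have hGg : ∀ k n, G k n ≤ g n := fun k n =>
    sub_le_self _ (mul_nonneg (Real.exp_pos _).le (hT k n).1)
  have hGs : ∀ k n, G (k + 1) n = convZ p (G k) n + ψ n := by
    intro k n
    have h1 : G k = fun n : ℤ => Real.exp (θ * n) * (F n - (convZ a)^[k] F n) := by
      funext n; simp only [hG, hgdef]; ring
    have hTb : ∀ n, |(convZ a)^[k] F n| ≤ 1 := fun n => by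
      rw [abs_of_nonneg (hT k n).1]; exact (hT k n).2.trans (hF1 n)
    have hFb : ∀ n, |F n| ≤ 1 := fun n => by rw [abs_of_nonneg (hF0 n)]; exact hF1 n
    rw [h1, convZ_exp_mul, convZ_sub ha0 ha hFb hTb]
    simp only [hG, hgdef, hψdef, Function.iterate_succ_apply']
    rw [hF n]; ring
  have hGmono : ∀ k n, G k n ≤ G (k + 1) n :=     fun k n => sub_le_sub_left
      (mul_le_mul_of_nonneg_left (hTstep k n) (Real.exp_pos _).le) _
  have hGb : ∀ k, ∃ C, ∀ n, G k n ≤ C := by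
    intro k
    induction k with
    | zero => exact ⟨0, fun n => by simp [hG, hgdef]⟩
    | succ k ih =>
      obtain ⟨C, hC⟩ := ih
      refine ⟨C + ∑' j, ψ j, fun n => ?_⟩
      rw [hGs]
      have hGabs : ∀ n, |G k n| ≤ C := fun n => by rw [abs_of_nonneg (hG0 k n)]; exact hC n
      have h1 := convZ_mono (g := fun _ => C) hp0 hp.summable hGabs (fun _ => le_rfl) hC n
      have h2 : convZ p (fun _ => C) n = C := by
        simp only [convZ]; rw [tsum_mul_right, hp.tsum_eq, one_mul]
      exact add_le_add (h1.trans_eq h2) (hb.le_tsum n fun _ _ => hψ0 _)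
  obtain ⟨C, hC⟩ := exists_bound_of_subsolution hp0 hp hp1 hμ hpgen hψ0 hb
  have hgC : ∀ n, g n ≤ C := fun n => le_of_tendsto' (hGlim n) fun k =>
    hC (G k) (hG0 k) (let ⟨D, hD⟩ := hGb k; ⟨D, by rintro _ ⟨n, rfl⟩; exact hD n⟩)
      (squeeze_zero (hG0 k) (hGg k) hgbot) (fun n => (hGmono k n).trans_eq (hGs k n)) n
  obtain ⟨c, hc0, hc, hcz⟩ :=
    tendsto_of_renewal_equation hp0 hp hp1 hμ hpgen hψ0 hb hg0 hgC hgbot hg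
  refine ⟨c, hc0, hc, fun h n => ?_⟩
  have := hcz h n
  simpa [hgdef, Real.exp_ne_zero] using this

lemma summable_of_tsum_ofReal_ne_top {ι : Type*} {f : ι → ℝ} (hf : ∀ i, 0 ≤ f i)
    (h : ∑' i, ENNReal.ofReal (f i) ≠ ⊤) : Summable f := by
  have := ENNReal.summable_toReal h
  simpa only [ENNReal.toReal_ofReal (hf _)] using this

lemma tsum_ofReal_geometric_le {κ h x : ℝ} (hκ : 0 < κ) (hh : 0 < h) (hx : 0 < x) (β : ℝ) :
    ∑' n : ℤ, ENNReal.ofReal (if x * Real.exp (n * h) < β then Real.exp (κ * h * n) else 0) ≤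
      ENNReal.ofReal ((x ^ κ)⁻¹ * (1 - Real.exp (-(κ * h)))⁻¹) * ENNReal.ofReal (|β| ^ κ) := by
  have hθ : 0 < κ * h := mul_pos hκ hh
  rcases le_or_gt β 0 with hβ | hβ
  · have : ∀ n : ℤ, ¬ x * Real.exp (n * h) < β := fun n =>
      not_lt.2 (hβ.trans (mul_pos hx (Real.exp_pos _)).le)
    simp [this]
  set N : ℤ := ⌊Real.log (β / x) / h⌋ with hN
  have hNle : N * h ≤ Real.log (β / x) := (le_div_iff₀ hh).1 (Int.floor_le _)
  set f : ℤ → ℝ := fun n => if n ≤ N then Real.exp (κ * h * n) else 0 with hf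
  have hf0 : ∀ n, 0 ≤ f n := fun n => by
    simp only [hf]; split_ifs; exacts [(Real.exp_pos _).le, le_rfl]
  have hr : Real.exp (-(κ * h)) < 1 := Real.exp_lt_one_iff.2 (by linarith)
  have hinj : Function.Injective fun i : ℕ => N - (i : ℤ) := fun i j h => by
    simp only at h; omega
  have hsum : HasSum f (Real.exp (κ * h * N) * (1 - Real.exp (-(κ * h)))⁻¹) := by
    rw [← hinj.hasSum_iff]
    · have hg := (hasSum_geometric_of_lt_one (Real.exp_pos (-(κ * h))).le hr).mul_left
        (Real.exp (κ * h * N))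
      refine (congrArg (HasSum · _) (show f ∘ (fun i : ℕ => N - (i : ℤ)) =
        fun i => Real.exp (κ * h * N) * Real.exp (-(κ * h)) ^ i from funext fun i => ?_)).mpr hg
      change (if N - (i : ℤ) ≤ N then Real.exp (κ * h * (N - (i : ℤ) : ℤ)) else 0) = _
      rw [if_pos (by omega), ← Real.exp_nat_mul, ← Real.exp_add]
      congr 1; push_cast; ring
    · intro n hn
      simp only [hf]
      rw [if_neg]
      intro hle
      exact hn ⟨(N - n).toNat, by simp only; omega⟩
  have hexpN : Real.exp (κ * h * N) ≤ (x ^ κ)⁻¹ * |β| ^ κ := by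
    have h1 : Real.exp (κ * h * N) ≤ (β / x) ^ κ := by
      rw [Real.rpow_def_of_pos (div_pos hβ hx)]
      apply Real.exp_le_exp.2
      nlinarith
    rw [Real.div_rpow hβ.le hx.le, div_eq_inv_mul] at h1
    rwa [abs_of_pos hβ]
  calc _ ≤ ∑' n : ℤ, ENNReal.ofReal (f n) := by
        refine ENNReal.tsum_le_tsum fun n => ENNReal.ofReal_le_ofReal ?_
        by_cases hn : x * Real.exp (n * h) < β
        · have h1 : n * h < Real.log (β / x) := by
            rw [Real.lt_log_iff_exp_lt (div_pos hβ hx), lt_div_iff₀ hx]; linarith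
          have h2 : n ≤ N := Int.le_floor.2 ((le_div_iff₀ hh).2 h1.le)
          simp [hf, hn, h2]
        · rw [if_neg hn]; exact hf0 n
    _ = ENNReal.ofReal (∑' n, f n) := (ENNReal.ofReal_tsum_of_nonneg hf0 hsum.summable).symm
    _ ≤ _ := by
        have hpos : 0 < (1 - Real.exp (-(κ * h)))⁻¹ := inv_pos.2 (by linarith)
        rw [hsum.tsum_eq, ← ENNReal.ofReal_mul (by positivity)]
        refine ENNReal.ofReal_le_ofReal ?_
        nlinarith

lemma pairwise_disjoint_eq_exp {Ω : Type*} {A : Ω → ℝ} {h : ℝ} (hh : 0 < h) :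
    Pairwise (Function.onFun Disjoint fun s : ℤ => {ω | A ω = Real.exp (s * h)}) := by
  intro s t hst
  refine Set.disjoint_left.2 fun ω h1 h2 => hst ?_
  have h3 : Real.exp (s * h) = Real.exp (t * h) := h1.symm.trans h2
  exact_mod_cast mul_right_cancel₀ hh.ne' (Real.exp_injective h3)

section Arithmetic

variable {Ω : Type*} [MeasurableSpace Ω] {P : Measure Ω} {A B X : Ω → ℝ} {κ h : ℝ}

lemma ae_eq_zero_or_eq_exp (hA0 : ∀ᵐ ω ∂P, 0 ≤ A ω)
    (hlog : P {ω | A ω ≠ 0 ∧ ∀ k : ℤ, Real.log (A ω) ≠ (k : ℝ) * h} = 0) :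
    ∀ᵐ ω ∂P, A ω = 0 ∨ ∃ k : ℤ, A ω = Real.exp (k * h) := by
  have h1 : ∀ᵐ ω ∂P, ¬ (A ω ≠ 0 ∧ ∀ k : ℤ, Real.log (A ω) ≠ (k : ℝ) * h) := by
    rw [ae_iff]; simpa using hlog
  filter_upwards [hA0, h1] with ω h0 h1
  by_cases hz : A ω = 0
  · exact Or.inl hz
  · push Not at h1
    obtain ⟨k, hk⟩ := h1 hz
    exact Or.inr ⟨k, by rw [← hk, Real.exp_log (lt_of_le_of_ne h0 (Ne.symm hz))]⟩

lemma lintegral_comp_eq_tsum (hA : Measurable A) (hh : 0 < h)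
    (hexp : ∀ᵐ ω ∂P, A ω = 0 ∨ ∃ k : ℤ, A ω = Real.exp (k * h)) {φ : ℝ → ENNReal}
    (hφ0 : φ 0 = 0) :
    ∫⁻ ω, φ (A ω) ∂P = ∑' s : ℤ, φ (Real.exp (s * h)) * P {ω | A ω = Real.exp (s * h)} := by
  have hmeas : ∀ s : ℤ, MeasurableSet {ω | A ω = Real.exp (s * h)} := fun s =>
    hA (measurableSet_singleton _)
  have h1 : ∫⁻ ω, φ (A ω) ∂P = ∫⁻ ω in ⋃ s : ℤ, {ω | A ω = Real.exp (s * h)}, φ (A ω) ∂P := by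
    rw [← lintegral_indicator (MeasurableSet.iUnion hmeas)]
    refine lintegral_congr_ae ?_
    filter_upwards [hexp] with ω hω
    rcases hω with h0 | hk
    · rw [h0, hφ0]
      by_cases hm : ω ∈ ⋃ s : ℤ, {ω | A ω = Real.exp (s * h)}
      · rw [Set.indicator_of_mem hm, h0, hφ0]
      · rw [Set.indicator_of_notMem hm]
    · rw [Set.indicator_of_mem (by simpa using hk)]
  rw [h1, lintegral_iUnion hmeas (pairwise_disjoint_eq_exp hh)]
  refine tsum_congr fun s => ?_
  rw [setLIntegral_congr_fun (g := fun _ => φ (Real.exp (s * h))) (hmeas s)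
    (fun ω hω => congrArg φ hω), setLIntegral_const]

variable [IsProbabilityMeasure P]

lemma summable_atom (hA : Measurable A) (hh : 0 < h) :
    (Summable fun s : ℤ => P.real {ω | A ω = Real.exp (s * h)}) ∧
      ∑' s : ℤ, P.real {ω | A ω = Real.exp (s * h)} ≤ 1 := by
  have hmeas : ∀ s : ℤ, MeasurableSet {ω | A ω = Real.exp (s * h)} := fun s =>
    hA (measurableSet_singleton _)
  have h1 : ∑' s : ℤ, P {ω | A ω = Real.exp (s * h)} ≤ 1 :=
    (tsum_meas_le_meas_iUnion_of_disjoint P hmeas (pairwise_disjoint_eq_exp hh)).trans prob_le_one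
  have h2 := (h1.trans_lt ENNReal.one_lt_top).ne
  refine ⟨ENNReal.summable_toReal h2, ?_⟩
  have h3 := ENNReal.toReal_mono ENNReal.one_ne_top h1
  rwa [ENNReal.tsum_toReal_eq fun s => measure_ne_top _ _] at h3

lemma hasSum_tilted_atom (hA : Measurable A) (hκ : 0 < κ) (hh : 0 < h)
    (hA0 : ∀ᵐ ω ∂P, 0 ≤ A ω)
    (hexp : ∀ᵐ ω ∂P, A ω = 0 ∨ ∃ k : ℤ, A ω = Real.exp (k * h))
    (hone : ∫ ω, A ω ^ κ ∂P = 1) :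
    HasSum (fun s : ℤ => Real.exp (κ * h * s) * P.real {ω | A ω = Real.exp (s * h)}) 1 := by
  have hInt : Integrable (fun ω => A ω ^ κ) P := by
    by_contra hn
    rw [integral_undef hn] at hone
    exact zero_ne_one hone
  have h1 := ofReal_integral_eq_lintegral_ofReal hInt
    (hA0.mono fun ω hω => Real.rpow_nonneg hω κ)
  rw [hone, lintegral_comp_eq_tsum (φ := fun t => ENNReal.ofReal (t ^ κ)) hA hh hexp
    (by simp [Real.zero_rpow hκ.ne'])] at h1
  have h2 : ∀ s : ℤ, ENNReal.ofReal (Real.exp (s * h) ^ κ) * P {ω | A ω = Real.exp (s * h)} =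
      ENNReal.ofReal (Real.exp (κ * h * s) * P.real {ω | A ω = Real.exp (s * h)}) := fun s => by
    rw [ENNReal.ofReal_mul (Real.exp_pos _).le, ofReal_measureReal, ← Real.exp_mul]
    congr 3; ring
  simp only [h2] at h1
  have hnn : ∀ s : ℤ, 0 ≤ Real.exp (κ * h * s) * P.real {ω | A ω = Real.exp (s * h)} := fun s =>
    mul_nonneg (Real.exp_pos _).le measureReal_nonneg
  have hs := summable_of_tsum_ofReal_ne_top hnn (by rw [← h1]; exact ENNReal.ofReal_ne_top)
  rw [← ENNReal.ofReal_tsum_of_nonneg hnn hs,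
    ENNReal.ofReal_eq_ofReal_iff zero_le_one (tsum_nonneg hnn)] at h1
  rw [h1]
  exact hs.hasSum

lemma summable_abs_mul_tilted_atom (hA : Measurable A) (hκ : 0 < κ) (hh : 0 < h)
    (hexp : ∀ᵐ ω ∂P, A ω = 0 ∨ ∃ k : ℤ, A ω = Real.exp (k * h))
    (hlog : ∫⁻ ω, ENNReal.ofReal (A ω ^ κ * max (Real.log (A ω)) 0) ∂P < ⊤) :
    Summable fun s : ℤ =>
      |(s : ℝ)| * (Real.exp (κ * h * s) * P.real {ω | A ω = Real.exp (s * h)}) := by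
  have hθ : 0 < κ * h := mul_pos hκ hh
  rw [lintegral_comp_eq_tsum (φ := fun t => ENNReal.ofReal (t ^ κ * max (Real.log t) 0)) hA hh
    hexp (by simp)] at hlog
  set a : ℤ → ℝ := fun s => P.real {ω | A ω = Real.exp (s * h)} with ha
  have ha0 : ∀ s, 0 ≤ a s := fun s => measureReal_nonneg
  have h2 : ∀ s : ℤ, ENNReal.ofReal (Real.exp (s * h) ^ κ * max (Real.log (Real.exp (s * h))) 0) *
      P {ω | A ω = Real.exp (s * h)} =
      ENNReal.ofReal (Real.exp (κ * h * s) * max (s * h) 0 * a s) := fun s => by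
    rw [ENNReal.ofReal_mul (p := Real.exp (κ * h * s) * max (s * h) 0) (by positivity),
      ofReal_measureReal, ← Real.exp_mul, Real.log_exp]
    congr 4; ring
  simp only [h2] at hlog
  have hs := summable_of_tsum_ofReal_ne_top
    (fun s => mul_nonneg (by positivity) (ha0 s)) hlog.ne
  refine Summable.of_nonneg_of_le
    (fun s => mul_nonneg (abs_nonneg _) (mul_nonneg (Real.exp_pos _).le (ha0 s)))
    (fun s => ?_) (((summable_atom (P := P) hA hh).1.mul_left (κ * h)⁻¹).add (hs.mul_left h⁻¹))
  rcases le_total 0 (s : ℝ) with h0 | h0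
  · rw [abs_of_nonneg h0, max_eq_left (by positivity)]
    have e : h⁻¹ * (Real.exp (κ * h * s) * (s * h) * a s) = s * (Real.exp (κ * h * s) * a s) := by
      field_simp
    rw [e]
    exact le_add_of_nonneg_left (mul_nonneg (by positivity) (ha0 s))
  · rw [abs_of_nonpos h0]
    have h3 : -(s : ℝ) * Real.exp (κ * h * s) ≤ (κ * h)⁻¹ := by
      have h4 := mul_le_mul_of_nonneg_right (Real.add_one_le_exp (-(κ * h * s)))
        (Real.exp_pos (κ * h * s)).le
      rw [← Real.exp_add, neg_add_cancel, Real.exp_zero] at h4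
      rw [inv_eq_one_div, le_div_iff₀ hθ]
      linarith [Real.exp_pos (κ * h * s)]
    rw [← mul_assoc]
    exact (mul_le_mul_of_nonneg_right h3 (ha0 s)).trans
      (le_add_of_nonneg_right (mul_nonneg (by positivity)
        (mul_nonneg (by positivity) (ha0 s))))

lemma closure_atom_eq_top (hA0 : ∀ᵐ ω ∂P, 0 ≤ A ω) (hspan : CondLogArithSpan P A h) :
    AddSubgroup.closure {s : ℤ | P.real {ω | A ω = Real.exp (s * h)} ≠ 0} = ⊤ := by
  obtain ⟨hh, hlog, hmax⟩ := hspan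
  obtain ⟨d, hd⟩ := Int.subgroup_cyclic
    (AddSubgroup.closure {s : ℤ | P.real {ω | A ω = Real.exp (s * h)} ≠ 0})
  rw [← AddSubgroup.zmultiples_eq_closure] at hd
  have hpos : ∀ᵐ ω ∂P, ∀ s : ℤ, A ω = Real.exp (s * h) → ∃ k : ℤ, s = k * d := by
    rw [ae_all_iff]
    intro s
    by_cases hs : P.real {ω | A ω = Real.exp (s * h)} = 0
    · rw [measureReal_eq_zero_iff] at hs
      have h1 : ∀ᵐ ω ∂P, ¬ A ω = Real.exp (s * h) := by rw [ae_iff]; simpa using hs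
      filter_upwards [h1] with ω h1 h2 using absurd h2 h1
    · have h1 := AddSubgroup.subset_closure
        (show s ∈ {s : ℤ | P.real {ω | A ω = Real.exp (s * h)} ≠ 0} from hs)
      rw [hd] at h1
      obtain ⟨k, hk⟩ := AddSubgroup.mem_zmultiples_iff.1 h1
      exact Eventually.of_forall fun ω _ => ⟨k, by rw [← hk, smul_eq_mul]⟩
  have key : ∀ e : ℤ, 0 < e → (∀ k : ℤ, ∃ j : ℤ, k * d = j * e) → e ≤ 1 := by
    intro e he hde
    have h2 : (e : ℝ) * h ≤ h := by
      refine hmax _ (by positivity) ?_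
      have h3 : ∀ᵐ ω ∂P, ¬ (A ω ≠ 0 ∧ ∀ k : ℤ, Real.log (A ω) ≠ (k : ℝ) * (e * h)) := by
        filter_upwards [hpos, ae_eq_zero_or_eq_exp hA0 hlog] with ω h4 h5 h6
        rcases h5 with h5 | ⟨s, hs⟩
        · exact h6.1 h5
        · obtain ⟨k, hk⟩ := h4 s hs
          obtain ⟨j, hj⟩ := hde k
          refine h6.2 j ?_
          rw [hs, Real.log_exp, hk, hj]; push_cast; ring
      rw [ae_iff] at h3
      simpa using h3
    have : (e : ℝ) ≤ 1 := by nlinarith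
    exact_mod_cast this
  have hdne : d ≠ 0 := by
    rintro rfl
    have := key 2 (by norm_num) fun k => ⟨0, by simp⟩
    omega
  have hd1 : |d| ≤ 1 := key |d| (abs_pos.2 hdne) fun k => by
    rcases abs_choice d with hc | hc
    · exact ⟨k, by rw [hc]⟩
    · exact ⟨-k, by rw [hc]; ring⟩
  rw [hd, eq_top_iff]
  intro s _
  rw [AddSubgroup.mem_zmultiples_iff]
  have : d = 1 ∨ d = -1 := by
    obtain ⟨h1, h2⟩ := abs_le.1 hd1
    omega
  rcases this with rfl | rfl
  · exact ⟨s, by simp⟩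
  · exact ⟨-s, by simp⟩

lemma measureReal_mul_gt_eq_convZ (hA : Measurable A) (hX : Measurable X)
    (hh : 0 < h) (hexp : ∀ᵐ ω ∂P, A ω = 0 ∨ ∃ k : ℤ, A ω = Real.exp (k * h))
    (hindep : IndepFun (fun ω => (A ω, B ω)) X P) {x : ℝ} (hx : 0 < x) (n : ℤ) :
    P.real {ω | A ω * X ω > x * Real.exp (n * h)} =
      convZ (fun s => P.real {ω | A ω = Real.exp (s * h)})
        (fun n => P.real {ω | X ω > x * Real.exp (n * h)}) n := by
  have hAX : IndepFun A X P := hindep.comp measurable_fst measurable_id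
  have hmeas : ∀ s : ℤ, MeasurableSet {ω | A ω = Real.exp (s * h)} := fun s =>
    hA (measurableSet_singleton _)
  have hmX : ∀ m : ℤ, MeasurableSet {ω | X ω > x * Real.exp (m * h)} := fun m =>
    hX measurableSet_Ioi
  have hset : {ω | A ω * X ω > x * Real.exp (n * h)} =ᵐ[P]
      ⋃ s : ℤ, {ω | A ω = Real.exp (s * h)} ∩
        {ω | X ω > x * Real.exp ((n - s : ℤ) * h)} := by
    filter_upwards [hexp] with ω hω
    apply propext
    change A ω * X ω > x * Real.exp (n * h) ↔ ω ∈ ⋃ s : ℤ, _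
    have hiff : ∀ s : ℤ, Real.exp (s * h) * X ω > x * Real.exp (n * h) ↔
        X ω > x * Real.exp ((n - s : ℤ) * h) := fun s => by
      have e : x * Real.exp (n * h) =
          Real.exp (s * h) * (x * Real.exp ((n - s : ℤ) * h)) := by
        rw [mul_left_comm, ← Real.exp_add]; push_cast; ring_nf
      rw [e]
      exact mul_lt_mul_iff_right₀ (Real.exp_pos _)
    simp only [Set.mem_iUnion, Set.mem_inter_iff, Set.mem_ofPred_eq]
    constructor
    · intro hgt
      rcases hω with h0 | ⟨s, hs⟩
      · rw [h0, zero_mul] at hgt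
        exact absurd hgt (not_lt.2 (mul_pos hx (Real.exp_pos _)).le)
      · exact ⟨s, hs, (hiff s).1 (hs ▸ hgt)⟩
    · rintro ⟨s, hs, hgt⟩
      rw [hs]
      exact (hiff s).2 hgt
  have h1 := (measure_congr hset).trans (measure_iUnion (fun s t hst =>
    (pairwise_disjoint_eq_exp hh hst).mono Set.inter_subset_left Set.inter_subset_left)
    fun s => (hmeas s).inter (hmX _))
  rw [measureReal_def, h1, ENNReal.tsum_toReal_eq fun s => measure_ne_top _ _]
  refine tsum_congr fun s => ?_
  have h2 := hAX.measure_inter_preimage_eq_mul {Real.exp (s * h)}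
    (Set.Ioi (x * Real.exp ((n - s : ℤ) * h))) (measurableSet_singleton _) measurableSet_Ioi
  exact (congrArg ENNReal.toReal h2).trans ENNReal.toReal_mul

lemma measureReal_gt_eq_add (hA : Measurable A) (hB : Measurable B) (hX : Measurable X)
    (heq : Measure.map X P = Measure.map (fun ω => max (A ω * X ω) (B ω)) P) (y : ℝ) :
    P.real {ω | X ω > y} =
      P.real {ω | A ω * X ω > y} + P.real {ω | B ω > y ∧ A ω * X ω ≤ y} := by
  have hAX : Measurable fun ω => A ω * X ω := hA.mul hX
  have h1 : P {ω | X ω > y} = P {ω | max (A ω * X ω) (B ω) > y} := by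
    have := congrArg (fun μ => μ (Set.Ioi y)) heq
    rwa [Measure.map_apply hX measurableSet_Ioi,
      Measure.map_apply (hAX.max hB) measurableSet_Ioi] at this
  rw [measureReal_def, h1, ← measureReal_def, ← measureReal_union]
  · congr 1
    ext ω
    simp only [Set.mem_ofPred_eq, Set.mem_union, gt_iff_lt, lt_max_iff]
    constructor
    · rintro (h2 | h2)
      · exact Or.inl h2
      · rcases lt_or_ge y (A ω * X ω) with h3 | h3
        exacts [Or.inl h3, Or.inr ⟨h2, h3⟩]
    · rintro (h2 | h2)
      exacts [Or.inl h2, Or.inr h2.1]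
  · exact Set.disjoint_left.2 fun ω h2 h3 => not_lt.2 h3.2 h2
  · exact (hB measurableSet_Ioi).inter (hAX measurableSet_Iic)

lemma summable_exp_mul_measureReal_gt (hB : Measurable B) (hκ : 0 < κ) (hh : 0 < h)
    (hBint : ∫⁻ ω, ENNReal.ofReal (|B ω| ^ κ) ∂P < ⊤) {x : ℝ} (hx : 0 < x) :
    Summable fun n : ℤ => Real.exp (κ * h * n) * P.real {ω | B ω > x * Real.exp (n * h)} := by
  refine summable_of_tsum_ofReal_ne_top
    (fun n => mul_nonneg (Real.exp_pos _).le measureReal_nonneg) ?_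
  have hmeas : ∀ n : ℤ, MeasurableSet {ω | x * Real.exp (n * h) < B ω} := fun n =>
    hB measurableSet_Ioi
  have h1 : ∀ n : ℤ,
      ENNReal.ofReal (Real.exp (κ * h * n) * P.real {ω | B ω > x * Real.exp (n * h)}) =
      ∫⁻ ω, ENNReal.ofReal
        (if x * Real.exp (n * h) < B ω then Real.exp (κ * h * n) else 0) ∂P := fun n => by
    rw [ENNReal.ofReal_mul (Real.exp_pos _).le, ofReal_measureReal,
      ← lintegral_indicator_const (hmeas n)]
    refine lintegral_congr fun ω => ?_
    by_cases hω : x * Real.exp (n * h) < B ω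
    · rw [if_pos hω, Set.indicator_of_mem (by exact hω)]
    · rw [if_neg hω, Set.indicator_of_notMem (by exact hω), ENNReal.ofReal_zero]
  simp only [h1]
  rw [← lintegral_tsum fun n =>
    (Measurable.ite (hmeas n) measurable_const measurable_const).ennreal_ofReal.aemeasurable]
  refine ((lintegral_mono fun ω => tsum_ofReal_geometric_le hκ hh hx (B ω)).trans_lt ?_).ne
  rw [lintegral_const_mul' _ _ ENNReal.ofReal_ne_top]
  exact ENNReal.mul_lt_top ENNReal.ofReal_lt_top hBint

lemma tendsto_measureReal_gt_atTop (hX : Measurable X) :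
    Tendsto (fun y => P.real {ω | X ω > y}) atTop (𝓝 0) := by
  have := Measure.isProbabilityMeasure_map (μ := P) hX.aemeasurable
  have h1 := (tendsto_cdf_atTop (Measure.map X P)).const_sub 1
  rw [sub_self] at h1
  refine h1.congr fun y => ?_
  rw [cdf_eq_real, ← probReal_compl_eq_one_sub measurableSet_Iic, Set.compl_Iic, measureReal_def,
    Measure.map_apply hX measurableSet_Ioi]
  rfl

/-- The tail of a solution of the maximum equation along a geometric lattice. -/
lemma exists_tendsto_tail (hA : Measurable A) (hB : Measurable B) (hX : Measurable X)
    (hA1 : AssumptionA1 P A κ h) (hBint : ∫⁻ ω, ENNReal.ofReal (|B ω| ^ κ) ∂P < ⊤)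
    (hindep : IndepFun (fun ω => (A ω, B ω)) X P)
    (heq : Measure.map X P = Measure.map (fun ω => max (A ω * X ω) (B ω)) P) {x : ℝ}
    (hx : 0 < x) :
    ∃ c, 0 ≤ c ∧ Tendsto (fun n : ℤ => Real.exp (κ * h * n) *
        P.real {ω | X ω > x * Real.exp (n * h)}) atTop (𝓝 c) ∧
      (c = 0 → ∀ n : ℤ, P.real {ω | X ω > x * Real.exp (n * h)} = 0) := by
  obtain ⟨hκ, hA0, hone, hlog, hspan⟩ := hA1
  have hh := hspan.1
  have hexp := ae_eq_zero_or_eq_exp hA0 hspan.2.1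
  refine tendsto_exp_mul_of_renewal
    (b := fun n => P.real {ω | B ω > x * Real.exp (n * h) ∧ A ω * X ω ≤ x * Real.exp (n * h)})
    (mul_pos hκ hh) (fun _ => measureReal_nonneg) (summable_atom hA hh).1 (summable_atom hA hh).2
    (hasSum_tilted_atom hA hκ hh hA0 hexp hone)
    (summable_abs_mul_tilted_atom hA hκ hh hexp hlog) (closure_atom_eq_top hA0 hspan)
    (fun _ => measureReal_nonneg) (fun _ => measureReal_le_one) ?_ (fun _ => measureReal_nonneg)
    (fun n => ?_) ?_
  · refine (tendsto_measureReal_gt_atTop hX).comp (Tendsto.const_mul_atTop hx ?_)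
    exact Real.tendsto_exp_atTop.comp
      ((tendsto_intCast_atTop_iff.2 tendsto_id).atTop_mul_const hh)
  · rw [← measureReal_mul_gt_eq_convZ hA hX hh hexp hindep hx]
    exact measureReal_gt_eq_add hA hB hX heq _
  · refine Summable.of_nonneg_of_le
      (fun n => mul_nonneg (Real.exp_pos _).le measureReal_nonneg) (fun n => ?_)
      (summable_exp_mul_measureReal_gt hB hκ hh hBint hx)
    exact mul_le_mul_of_nonneg_left (measureReal_mono fun ω hω => hω.1) (Real.exp_pos _).le

end Arithmetic

/-- Theorem 3 (Iksanov): maximum equation `X =_d AX ∨ B` under (A1) and `E|B|^κ < ∞`: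
`x^κ e^{κnh} P(X > x e^{nh}) → q(x)` for EVERY `x > 0`, with `q > 0` when
`B ≥ 0` a.s. and `P(B > 0) > 0`. -/
theorem stmt5 {Ω : Type*} [MeasurableSpace Ω] (P : Measure Ω) [IsProbabilityMeasure P]
    (A B X : Ω → ℝ) (hAmeas : Measurable A) (hBmeas : Measurable B) (hXmeas : Measurable X)
    (κ h : ℝ) (hA1 : AssumptionA1 P A κ h)
    (hB : (∫⁻ ω, ENNReal.ofReal (|B ω| ^ κ) ∂P) < ⊤)
    (hindep : IndepFun (fun ω => (A ω, B ω)) X P)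
    (heq : Measure.map X P = Measure.map (fun ω => max (A ω * X ω) (B ω)) P) :
    ∃ q : ℝ → ℝ, MemQ κ h q ∧
      (∀ x : ℝ, 0 < x →
        Tendsto (fun n : ℕ =>
            x ^ κ * Real.exp (κ * (n * h)) * (P {ω | X ω > x * Real.exp (n * h)}).toReal)
          atTop (𝓝 (q x))) ∧
      ((∀ᵐ ω ∂P, 0 ≤ B ω) → 0 < P {ω | 0 < B ω} →
        ∀ x : ℝ, 0 < x → 0 < q x) := by
  choose! c hc0 hc hcz using fun (x : ℝ) (hx : 0 < x) =>
    exists_tendsto_tail hAmeas hBmeas hXmeas hA1 hB hindep heq hx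
  obtain ⟨hκ, -, -, -, hh, -⟩ := hA1
  have hlim : ∀ x : ℝ, 0 < x → Tendsto (fun n : ℕ =>
      Real.exp (κ * (n * h)) * (P {ω | X ω > x * Real.exp (n * h)}).toReal) atTop (𝓝 (c x)) := by
    intro x hx
    refine ((hc x hx).comp tendsto_natCast_atTop_atTop).congr fun n => ?_
    simp only [Function.comp_apply, Int.cast_natCast, measureReal_def]
    congr 2; ring
  have hcancel : ∀ x : ℝ, 0 < x → x ^ (-κ) * (x ^ κ * c x) = c x := fun x hx => by
    rw [← mul_assoc, ← Real.rpow_add hx, neg_add_cancel, Real.rpow_zero, one_mul]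
  have hq : ∀ x : ℝ, 0 < x → Tendsto (fun n : ℕ =>
      x ^ κ * Real.exp (κ * (n * h)) * (P {ω | X ω > x * Real.exp (n * h)}).toReal)
      atTop (𝓝 (x ^ κ * c x)) := fun x hx => by
    simpa only [mul_assoc] using (hlim x hx).const_mul (x ^ κ)
  refine ⟨fun x => x ^ κ * c x, ⟨fun x hx => mul_nonneg (Real.rpow_nonneg hx.le _) (hc0 x hx),
    ?_, ?_⟩, hq, ?_⟩
  · intro x hx y hy hxy
    simp only [hcancel x hx, hcancel y hy]
    refine le_of_tendsto_of_tendsto' (hlim y hy) (hlim x hx) fun n => ?_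
    refine mul_le_mul_of_nonneg_left ?_ (Real.exp_pos _).le
    refine ENNReal.toReal_mono (measure_ne_top _ _) (measure_mono fun ω hω => ?_)
    exact (mul_le_mul_of_nonneg_right hxy (Real.exp_pos _).le).trans_lt hω
  · intro x hx
    refine tendsto_nhds_unique (hq _ (mul_pos hx (Real.exp_pos h)))
      (((hq x hx).comp (tendsto_add_atTop_nat 1)).congr fun n => ?_)
    have e1 : x * Real.exp h * Real.exp (n * h) = x * Real.exp ((n + 1 : ℕ) * h) := by
      rw [mul_assoc, ← Real.exp_add]; push_cast; ring_nf
    have e2 : (x * Real.exp h) ^ κ * Real.exp (κ * (n * h)) =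
        x ^ κ * Real.exp (κ * ((n + 1 : ℕ) * h)) := by
      rw [Real.mul_rpow hx.le (Real.exp_pos h).le, ← Real.exp_mul, mul_assoc, ← Real.exp_add]
      push_cast; ring_nf
    rw [e1, e2]
    rfl
  · intro _ hBpos x hx
    refine mul_pos (Real.rpow_pos_of_pos hx _) (lt_of_le_of_ne (hc0 x hx) fun h0 => hBpos.ne' ?_)
    have hX0 := hcz x hx h0.symm
    have hAX : Measurable fun ω => A ω * X ω := hAmeas.mul hXmeas
    have hB0 : ∀ n : ℕ, P {ω | x * Real.exp ((-(n : ℤ) : ℤ) * h) < B ω} = 0 := fun n => by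
      have h1 : P.real {ω | X ω > x * Real.exp ((-(n : ℤ) : ℤ) * h)} = _ := hX0 _
      rw [measureReal_eq_zero_iff] at h1
      have h2 := congrArg (fun μ => μ (Set.Ioi (x * Real.exp ((-(n : ℤ) : ℤ) * h)))) heq
      rw [Measure.map_apply hXmeas measurableSet_Ioi,
        Measure.map_apply (hAX.max hBmeas) measurableSet_Ioi] at h2
      refine measure_mono_null (fun ω hω => ?_) (h2.symm.trans h1)
      exact lt_max_of_lt_right (show x * Real.exp ((-(n : ℤ) : ℤ) * h) < B ω from hω)
    refine measure_mono_null (fun ω hω => ?_) (measure_iUnion_null hB0)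
    have hlim0 : Tendsto (fun n : ℕ => x * Real.exp ((-(n : ℤ) : ℤ) * h)) atTop (𝓝 (x * 0)) := by
      refine (Real.tendsto_exp_atBot.comp ?_).const_mul x
      simp only [Int.cast_neg, Int.cast_natCast, neg_mul]
      exact tendsto_neg_atTop_atBot.comp (tendsto_natCast_atTop_atTop.atTop_mul_const hh)
    rw [mul_zero] at hlim0
    obtain ⟨n, hn⟩ := (hlim0.eventually (gt_mem_nhds (show (0 : ℝ) < B ω from hω))).exists
    exact Set.mem_iUnion.2 ⟨n, hn⟩
end
end
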